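/- arXiv:1409.2588 — 2 statements merged into one kernel-verified Lean document; each statement's English description precedes it below -/
import Mathlib

section
/- Let d ≥ 2 and suppose E ⊂ ℝ^d is a compact set with dim_H(E) > (d+1)/2. Then for every integer k ≥ 1 there exists a non-empty open interval I ⊂ (0,∞) such that for each t ∈ I there exists a non-degenerate k-chain in E with constant gap t. -/
open MeasureTheory Set
open scoped ENNReal

open CompactlySupported in
lemma exists_measure_integral_le_cost {X : Type*} [TopologicalSpace X] [CompactSpace X] [T2Space X]
    [MeasurableSpace X] [BorelSpace X] {ι : Type*} (φ : ι → X → ℝ) (w : ι → ℝ)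
    (hφ : ∀ i x, 0 ≤ φ i x) (hw : ∀ i, 0 ≤ w i) {m : ℝ} (hm : 0 < m)
    (hcover : ∃ c : ι →₀ ℝ, 0 ≤ c ∧ ∀ x, 1 ≤ c.sum fun i a => a * φ i x)
    (hlow : ∀ c : ι →₀ ℝ, 0 ≤ c → (∀ x, 1 ≤ c.sum fun i a => a * φ i x) →
      m ≤ c.sum fun i a => a * w i) :
    ∃ μ : Measure X, IsFiniteMeasure μ ∧ μ univ = ENNReal.ofReal m ∧
      ∀ (f : C(X, ℝ)) (c : ι →₀ ℝ), 0 ≤ c → (∀ x, f x ≤ c.sum fun i a => a * φ i x) →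
        ∫ x, f x ∂μ ≤ c.sum fun i a => a * w i := by
  classical
  let val : X → (ι →₀ ℝ) →ₗ[ℝ] ℝ := fun x => Finsupp.linearCombination ℝ fun i => φ i x
  let cost : (ι →₀ ℝ) →ₗ[ℝ] ℝ := Finsupp.linearCombination ℝ w
  have hval : ∀ c x, (c.sum fun i a => a * φ i x) = val x c := fun c x => by
    simp [val, Finsupp.linearCombination_apply]
  have hcost : ∀ c, (c.sum fun i a => a * w i) = cost c := fun c => by
    simp [cost, Finsupp.linearCombination_apply]
  simp only [hval, hcost] at hcover hlow ⊢
  have hcost0 : ∀ c, 0 ≤ c → 0 ≤ cost c := fun c hc => by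
    rw [← hcost]; exact Finset.sum_nonneg fun i _ => mul_nonneg (hc i) (hw i)
  have hval0 : ∀ c x, 0 ≤ c → 0 ≤ val x c := fun c x hc => by
    rw [← hval]; exact Finset.sum_nonneg fun i _ => mul_nonneg (hc i) (hφ i x)
  let S : C_c(X, ℝ) → Set (ι →₀ ℝ) := fun f => {c | 0 ≤ c ∧ ∀ x, f x ≤ val x c}
  let p : C_c(X, ℝ) → ℝ := fun f => sInf (cost '' S f)
  have hbdd : ∀ f, BddBelow (cost '' S f) := fun f =>
    ⟨0, by rintro _ ⟨c, hc, rfl⟩; exact hcost0 c hc.1⟩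
  obtain ⟨c₀, hc₀, hc₀1⟩ := hcover
  have hne : ∀ f, (cost '' S f).Nonempty := by
    intro f
    obtain ⟨M, hM⟩ := isCompact_univ.bddAbove_image (f := f) f.continuous.continuousOn
    refine ⟨_, (max M 0) • c₀, ⟨smul_nonneg (le_max_right _ _) hc₀, fun x => ?_⟩, rfl⟩
    rw [map_smul, smul_eq_mul]
    calc f x ≤ max M 0 := (hM ⟨x, trivial, rfl⟩).trans (le_max_left _ _)
      _ = max M 0 * 1 := (mul_one _).symm
      _ ≤ _ := by gcongr; exact hc₀1 x
  have hp0 : ∀ f, 0 ≤ p f := fun f => le_csInf (hne f) (by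
    rintro _ ⟨c, hc, rfl⟩; exact hcost0 c hc.1)
  have hple : ∀ f c, c ∈ S f → p f ≤ cost c := fun f c hc => csInf_le (hbdd f) ⟨c, hc, rfl⟩
  have padd : ∀ f g, p (f + g) ≤ p f + p g := by
    intro f g
    refine le_of_forall_pos_lt_add fun ε hε => ?_
    obtain ⟨_, ⟨c, hc, rfl⟩, h1⟩ := exists_lt_of_csInf_lt (hne f) (lt_add_of_pos_right (p f) (half_pos hε))
    obtain ⟨_, ⟨e, he, rfl⟩, h2⟩ := exists_lt_of_csInf_lt (hne g) (lt_add_of_pos_right (p g) (half_pos hε))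
    have := hple (f + g) (c + e) ⟨add_nonneg hc.1 he.1, fun x => by
      rw [map_add]; exact add_le_add (hc.2 x) (he.2 x)⟩
    rw [map_add] at this
    linarith
  have psmul_le : ∀ a : ℝ, 0 < a → ∀ f, p (a • f) ≤ a * p f := by
    intro a ha f
    rw [← div_le_iff₀' ha]
    refine le_csInf (hne f) ?_
    rintro _ ⟨c, hc, rfl⟩
    rw [div_le_iff₀' ha]
    have := hple (a • f) (a • c) ⟨smul_nonneg ha.le hc.1, fun x => by
      rw [map_smul]; exact mul_le_mul_of_nonneg_left (hc.2 x) ha.le⟩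
    simpa using this
  have psmul : ∀ a : ℝ, 0 < a → ∀ f, p (a • f) = a * p f := by
    intro a ha f
    refine le_antisymm (psmul_le a ha f) ?_
    have := psmul_le a⁻¹ (inv_pos.2 ha) (a • f)
    rw [smul_smul, inv_mul_cancel₀ ha.ne', one_smul] at this
    calc a * p f ≤ a * (a⁻¹ * p (a • f)) := by gcongr
      _ = p (a • f) := by rw [← mul_assoc, mul_inv_cancel₀ ha.ne', one_mul]
  have hX : Nonempty X := by
    by_contra hX
    have := hlow 0 le_rfl (fun x => (hX ⟨x⟩).elim)
    simp at this
    linarith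
  let o : C_c(X, ℝ) := ⟨1, HasCompactSupport.of_compactSpace 1⟩
  have ho1 : ∀ x, o x = 1 := fun x => rfl
  have ho : o ≠ 0 := by
    obtain ⟨x⟩ := hX
    intro h
    have := ho1 x
    rw [h] at this
    simp at this
  obtain ⟨L, hLo, hLp⟩ := exists_extension_of_le_sublinear
    (LinearPMap.mkSpanSingleton (K := ℝ) o m ho) p psmul padd (by
      rintro ⟨x, hx⟩
      obtain ⟨a, rfl⟩ := Submodule.mem_span_singleton.1 hx
      refine (LinearPMap.mkSpanSingleton'_apply (σ := RingHom.id ℝ) o m _ a hx).trans_le ?_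
      simp only [RingHom.id_apply, smul_eq_mul]
      rcases le_or_gt a 0 with h | h
      · exact (mul_nonpos_of_nonpos_of_nonneg h hm.le).trans (hp0 _)
      · rw [psmul a h]
        gcongr
        refine le_csInf (hne o) ?_
        rintro _ ⟨c, hc, rfl⟩
        exact hlow c hc.1 hc.2)
  have hLo' : L o = m := by
    have h := hLo ⟨o, Submodule.mem_span_singleton_self o⟩
    rw [h]
    exact LinearPMap.mkSpanSingleton_apply ℝ ℝ ho m
  have hLpos : ∀ f : C_c(X, ℝ), 0 ≤ f → 0 ≤ L f := by
    intro f hf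
    have h1 := hLp (-f)
    have h2 : p (-f) ≤ cost 0 := hple _ _ ⟨le_rfl, fun x => by
      have : 0 ≤ f x := hf x
      simpa using this⟩
    rw [map_neg] at h1
    rw [map_zero] at h2
    linarith
  let Λ : C_c(X, ℝ) →ₚ[ℝ] ℝ := PositiveLinearMap.mk₀ L hLpos
  have hΛ : ∀ f, Λ f = L f := fun f => rfl
  refine ⟨RealRMK.rieszMeasure Λ, inferInstance, ?_, ?_⟩
  · have h := RealRMK.integral_rieszMeasure Λ o
    rw [hΛ, hLo'] at h
    simp only [ho1, integral_const, smul_eq_mul, mul_one] at h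
    rw [← h, ofReal_measureReal]
  · intro f c hc hfc
    let g : C_c(X, ℝ) := ⟨f, HasCompactSupport.of_compactSpace f⟩
    have h := RealRMK.integral_rieszMeasure Λ g
    rw [hΛ] at h
    calc ∫ x, f x ∂_ = L g := h
      _ ≤ p g := hLp g
      _ ≤ cost c := hple g c ⟨hc, hfc⟩

/-- The index of the dyadic cube of side `2⁻ⁿ` containing `x`. -/
noncomputable def dyadicCell {d : ℕ} (n : ℕ) (x : EuclideanSpace ℝ (Fin d)) : Fin d → ℤ :=
  fun i => ⌊(2 : ℝ) ^ n * x i⌋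

lemma measurable_dyadicCell {d : ℕ} (n : ℕ) :
    Measurable (dyadicCell n : EuclideanSpace ℝ (Fin d) → Fin d → ℤ) :=
  measurable_pi_lambda _ fun i => Int.measurable_floor.comp (by fun_prop)

lemma dist_le_of_dyadicCell_eq {d : ℕ} {n : ℕ} {x y : EuclideanSpace ℝ (Fin d)}
    (h : dyadicCell n x = dyadicCell n y) : dist x y ≤ d * ((2 : ℝ) ^ n)⁻¹ := by
  have h2 : (0 : ℝ) < 2 ^ n := by positivity
  rw [EuclideanSpace.dist_eq, Real.sqrt_le_left (by positivity)]
  have key : ∀ i, dist (x i) (y i) ^ 2 ≤ (((2 : ℝ) ^ n)⁻¹) ^ 2 := by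
    intro i
    have h1 := Int.abs_sub_lt_one_of_floor_eq_floor (congrFun h i)
    rw [← mul_sub, abs_mul, abs_of_pos h2] at h1
    rw [Real.dist_eq]
    gcongr
    rw [← one_div, le_div_iff₀' h2]
    exact h1.le
  calc ∑ i, dist (x i) (y i) ^ 2 ≤ ∑ i : Fin d, (((2 : ℝ) ^ n)⁻¹) ^ 2 :=
        Finset.sum_le_sum fun i _ => key i
    _ = d * (((2 : ℝ) ^ n)⁻¹) ^ 2 := by simp
    _ ≤ (d : ℝ) ^ 2 * (((2 : ℝ) ^ n)⁻¹) ^ 2 := by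
        gcongr
        exact_mod_cast Nat.le_self_pow two_ne_zero d
    _ = _ := by ring

lemma dyadicCell_mem_Icc {d : ℕ} {n : ℕ} {x y : EuclideanSpace ℝ (Fin d)}
    (h : dist x y ≤ 2 * ((2 : ℝ) ^ n)⁻¹) :
    dyadicCell n y ∈ Finset.Icc (fun i => dyadicCell n x i - 2) (fun i => dyadicCell n x i + 2) := by
  have h2 : (0 : ℝ) < 2 ^ n := by positivity
  have key : ∀ i, |(2 : ℝ) ^ n * x i - 2 ^ n * y i| ≤ 2 := by
    intro i
    rw [← mul_sub, abs_mul, abs_of_pos h2, ← le_div_iff₀' h2, div_eq_mul_inv]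
    refine le_trans ?_ h
    rw [dist_eq_norm]
    exact PiLp.norm_apply_le (x - y) i
  simp only [Finset.mem_Icc, Pi.le_def, dyadicCell]
  refine ⟨fun i => ?_, fun i => ?_⟩
  all_goals
    have h1 := abs_le.1 (key i)
    have h3 := Int.floor_le ((2 : ℝ) ^ n * x i)
    have h4 := Int.floor_le ((2 : ℝ) ^ n * y i)
    have h5 := Int.lt_floor_add_one ((2 : ℝ) ^ n * x i)
    have h6 := Int.lt_floor_add_one ((2 : ℝ) ^ n * y i)
    rw [← Int.lt_add_one_iff, ← Int.cast_lt (R := ℝ)]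
    push_cast
    linarith

lemma finite_image_dyadicCell {d : ℕ} (n : ℕ) {E : Set (EuclideanSpace ℝ (Fin d))}
    (hE : Bornology.IsBounded E) : (dyadicCell n '' E).Finite := by
  obtain ⟨R, hR⟩ := hE.exists_norm_le
  have h2 : (0 : ℝ) < 2 ^ n := by positivity
  refine (Set.finite_Icc (fun _ : Fin d => ⌊-((2 : ℝ) ^ n * R)⌋) fun _ => ⌊(2 : ℝ) ^ n * R⌋).subset ?_
  rintro _ ⟨x, hx, rfl⟩
  have key : ∀ i, |x i| ≤ R := fun i => (PiLp.norm_apply_le x i).trans (hR x hx)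
  refine ⟨fun i => Int.floor_le_floor ?_, fun i => Int.floor_le_floor ?_⟩
  · have := (abs_le.1 (key i)).1
    rw [← mul_neg]; gcongr
  · have := (abs_le.1 (key i)).2
    gcongr

open Measure in
lemma exists_pos_le_dyadic_cost {d : ℕ} {E : Set (EuclideanSpace ℝ (Fin d))} {s s' : ℝ}
    (hs : 0 < s) (hss : s < s') (hE : μH[s'] E ≠ 0) :
    ∃ m : ℝ, 0 < m ∧ ∀ c : (ℕ × (Fin d → ℤ)) →₀ ℝ, 0 ≤ c →
      (∀ x ∈ E, 1 ≤ c.sum fun Q a => a * if dyadicCell Q.1 x = Q.2 then 1 else 0) →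
      m ≤ c.sum fun Q a => a * ((2 : ℝ) ^ (-s)) ^ Q.1 := by
  classical
  by_contra! hcon
  apply hE
  set ρ : ℝ := 2 ^ (s - s') with hρ
  have hρ0 : 0 < ρ := by positivity
  have hρ1 : ρ < 1 := Real.rpow_lt_one_of_one_lt_of_neg (by norm_num) (by linarith)
  set κ : ℝ := (1 - ρ) / 2 with hκ
  have hκ0 : 0 < κ := by rw [hκ]; linarith
  have hs' : 0 < s' := hs.trans hss
  choose c hc0 hc1 hcm using fun k : ℕ => hcon (1 / ((k : ℝ) + 1)) (by positivity)
  let T : ℕ → Finset (ℕ × (Fin d → ℤ)) := fun k => (c k).support.filter fun Q => κ * ρ ^ Q.1 ≤ c k Q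
  let K : ℝ := (d : ℝ) ^ s' * κ⁻¹
  have hK0 : 0 ≤ K := by positivity
  have hT : ∀ k, ∑ Q ∈ T k, ((d : ℝ) * ((2 : ℝ) ^ Q.1)⁻¹) ^ s' ≤ K * (1 / ((k : ℝ) + 1)) := by
    intro k
    calc ∑ Q ∈ T k, ((d : ℝ) * ((2 : ℝ) ^ Q.1)⁻¹) ^ s'
        ≤ ∑ Q ∈ T k, K * (c k Q * ((2 : ℝ) ^ (-s)) ^ Q.1) := by
          refine Finset.sum_le_sum fun Q hQ => ?_
          have hQ := (Finset.mem_filter.1 hQ).2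
          rw [Real.mul_rpow (by positivity) (by positivity), Real.inv_rpow (by positivity),
            ← Real.rpow_natCast 2 Q.1, ← Real.rpow_mul (by norm_num), ← Real.rpow_neg (by norm_num)]
          have e1 : (2 : ℝ) ^ (-((Q.1 : ℝ) * s')) = ρ ^ Q.1 * ((2 : ℝ) ^ (-s)) ^ Q.1 := by
            rw [hρ, ← mul_pow, ← Real.rpow_add (by norm_num), ← Real.rpow_natCast,
              ← Real.rpow_mul (by norm_num)]
            congr 1; ring
          rw [e1]
          have h3 : ρ ^ Q.1 ≤ κ⁻¹ * c k Q := by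
            rw [← div_eq_inv_mul, le_div_iff₀' hκ0]; exact hQ
          calc (d : ℝ) ^ s' * (ρ ^ Q.1 * ((2 : ℝ) ^ (-s)) ^ Q.1)
              ≤ (d : ℝ) ^ s' * ((κ⁻¹ * c k Q) * ((2 : ℝ) ^ (-s)) ^ Q.1) := by gcongr
            _ = _ := by simp only [K]; ring
      _ ≤ ∑ Q ∈ (c k).support, K * (c k Q * ((2 : ℝ) ^ (-s)) ^ Q.1) :=
          Finset.sum_le_sum_of_subset_of_nonneg (Finset.filter_subset _ _) fun Q _ _ =>
            mul_nonneg hK0 (mul_nonneg (hc0 k Q) (by positivity))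
      _ = K * (c k).sum fun Q a => a * ((2 : ℝ) ^ (-s)) ^ Q.1 := by
          rw [← Finset.mul_sum]; rfl
      _ ≤ _ := by gcongr; exact (hcm k).le
  have hcov : ∀ k, ∀ x ∈ E, ∃ Q ∈ T k, dyadicCell Q.1 x = Q.2 := by
    intro k x hx
    by_contra! hno
    have h1 := hc1 k x hx
    have h2 : ((c k).sum fun Q a => a * if dyadicCell Q.1 x = Q.2 then (1 : ℝ) else 0) ≤ 1 / 2 := by
      calc ((c k).sum fun Q a => a * if dyadicCell Q.1 x = Q.2 then (1 : ℝ) else 0)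
          = ∑ Q ∈ (c k).support.filter (fun Q => dyadicCell Q.1 x = Q.2), c k Q := by
            rw [Finset.sum_filter]
            exact Finset.sum_congr rfl fun Q _ => by simp
        _ ≤ ∑ Q ∈ (c k).support.filter (fun Q => dyadicCell Q.1 x = Q.2), κ * ρ ^ Q.1 := by
            refine Finset.sum_le_sum fun Q hQ => ?_
            rw [Finset.mem_filter] at hQ
            by_contra! hlt
            exact hno Q (Finset.mem_filter.2 ⟨hQ.1, hlt.le⟩) hQ.2
        _ = ∑ n ∈ ((c k).support.filter (fun Q => dyadicCell Q.1 x = Q.2)).image Prod.fst,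
              κ * ρ ^ n := by
            rw [Finset.sum_image]
            intro P hP Q hQ h
            have hP := (Finset.mem_filter.1 hP).2
            have hQ := (Finset.mem_filter.1 hQ).2
            exact Prod.ext h (by rw [← hP, ← hQ, h])
        _ ≤ ∑' n, κ * ρ ^ n := by
            refine Summable.sum_le_tsum _ (fun n _ => by positivity) ?_
            exact (summable_geometric_of_lt_one hρ0.le hρ1).mul_left _
        _ = 1 / 2 := by
            rw [tsum_mul_left, tsum_geometric_of_lt_one hρ0.le hρ1, hκ]
            have : 1 - ρ ≠ 0 := by linarith
            field_simp
    linarith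
  have hdiam : ∀ Q : ℕ × (Fin d → ℤ), Metric.ediam {x : EuclideanSpace ℝ (Fin d) |
      dyadicCell Q.1 x = Q.2} ≤ ENNReal.ofReal (d * ((2 : ℝ) ^ Q.1)⁻¹) := by
    intro Q
    refine Metric.ediam_le fun x hx y hy => ?_
    rw [edist_dist]
    exact ENNReal.ofReal_le_ofReal (dist_le_of_dyadicCell_eq (hx.trans hy.symm))
  have hzero : Filter.Tendsto (fun k : ℕ => K * (1 / ((k : ℝ) + 1))) Filter.atTop (nhds 0) := by
    simpa using (tendsto_one_div_add_atTop_nhds_zero_nat (𝕜 := ℝ)).const_mul K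
  have hle := hausdorffMeasure_le_liminf_sum (β := ℕ) (ι := fun k => T k) s' E
    (l := Filter.atTop) (fun k => ENNReal.ofReal ((K * (1 / ((k : ℝ) + 1))) ^ s'⁻¹)) ?_
    (fun k Q => {x | dyadicCell Q.1.1 x = Q.1.2}) ?_ ?_
  · refine le_antisymm (hle.trans ?_) zero_le
    have hlim : Filter.Tendsto (fun k : ℕ => ENNReal.ofReal (K * (1 / ((k : ℝ) + 1))))
        Filter.atTop (nhds 0) := by
      simpa using ENNReal.tendsto_ofReal hzero
    rw [← hlim.liminf_eq]
    refine Filter.liminf_le_liminf (Filter.Eventually.of_forall fun k => ?_)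
    calc ∑ Q : T k, Metric.ediam {x : EuclideanSpace ℝ (Fin d) | dyadicCell Q.1.1 x = Q.1.2} ^ s'
        = ∑ Q ∈ T k, Metric.ediam {x : EuclideanSpace ℝ (Fin d) | dyadicCell Q.1 x = Q.2} ^ s' :=
          Finset.sum_coe_sort (T k)
            (fun Q => Metric.ediam {x : EuclideanSpace ℝ (Fin d) | dyadicCell Q.1 x = Q.2} ^ s')
      _ ≤ ∑ Q ∈ T k, ENNReal.ofReal ((d * ((2 : ℝ) ^ Q.1)⁻¹) ^ s') := by
          refine Finset.sum_le_sum fun Q _ => ?_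
          rw [← ENNReal.ofReal_rpow_of_nonneg (by positivity) hs'.le]
          exact ENNReal.rpow_le_rpow (hdiam Q) hs'.le
      _ = ENNReal.ofReal (∑ Q ∈ T k, (d * ((2 : ℝ) ^ Q.1)⁻¹) ^ s') :=
          (ENNReal.ofReal_sum_of_nonneg fun Q _ => by positivity).symm
      _ ≤ _ := ENNReal.ofReal_le_ofReal (hT k)
  · have h1 := hzero.rpow_const (p := s'⁻¹) (Or.inr (by positivity))
    rw [Real.zero_rpow (by positivity)] at h1
    simpa using ENNReal.tendsto_ofReal h1
  · refine Filter.Eventually.of_forall fun k Q => (hdiam Q.1).trans (ENNReal.ofReal_le_ofReal ?_)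
    rw [Real.le_rpow_inv_iff_of_pos (by positivity) (by positivity) hs']
    refine le_trans ?_ (hT k)
    exact Finset.single_le_sum (f := fun Q : ℕ × (Fin d → ℤ) => ((d : ℝ) * ((2 : ℝ) ^ Q.1)⁻¹) ^ s')
      (fun Q _ => by positivity) Q.2
  · refine Filter.Eventually.of_forall fun k x hx => ?_
    obtain ⟨Q, hQ, h⟩ := hcov k x hx
    exact mem_iUnion.2 ⟨⟨Q, hQ⟩, h⟩

open Measure in
theorem exists_frostman_measure {d : ℕ} {E : Set (EuclideanSpace ℝ (Fin d))} (hE : IsCompact E)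
    {s : ℝ} (hs : 0 < s) (hsE : ENNReal.ofReal s < dimH E) :
    ∃ μ : Measure (EuclideanSpace ℝ (Fin d)), IsFiniteMeasure μ ∧ μ ≠ 0 ∧ μ Eᶜ = 0 ∧
      ∃ C : ℝ, 0 ≤ C ∧ ∀ x r, 0 < r → μ (Metric.closedBall x r) ≤ ENNReal.ofReal (C * r ^ s) := by
  classical
  obtain ⟨s', hss', hs'E⟩ := ENNReal.lt_iff_exists_nnreal_btwn.1 hsE
  have hss : s < s' := by
    rw [← ENNReal.ofReal_coe_nnreal] at hss'
    exact ENNReal.ofReal_lt_ofReal_iff_of_nonneg hs.le |>.1 hss'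
  obtain ⟨m, hm, hlow⟩ := exists_pos_le_dyadic_cost hs hss
    (by rw [hausdorffMeasure_of_lt_dimH hs'E]; exact ENNReal.top_ne_zero)
  have : CompactSpace E := isCompact_iff_compactSpace.1 hE
  let φ : ℕ × (Fin d → ℤ) → E → ℝ := fun Q x => if dyadicCell Q.1 x.1 = Q.2 then 1 else 0
  have hsum : ∀ (n : ℕ) (F : Finset (Fin d → ℤ)) (x : E), dyadicCell n x.1 ∈ F →
      1 ≤ (Finsupp.indicator (({n} : Finset ℕ) ×ˢ F) fun _ _ => (1 : ℝ)).sum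
        fun Q a => a * φ Q x := by
    intro n F x hx
    rw [Finsupp.sum_indicator_index (fun _ => (1 : ℝ)) (by simp)]
    refine le_trans ?_ (Finset.single_le_sum (f := fun Q => 1 * φ Q x)
      (fun Q _ => by simp only [φ]; positivity)
      (Finset.mk_mem_product (Finset.mem_singleton_self n) hx))
    simp [φ]
  have hnonneg : ∀ T : Finset (ℕ × (Fin d → ℤ)),
      0 ≤ (Finsupp.indicator T fun _ _ => (1 : ℝ)) := by
    intro T Q
    rw [Finsupp.indicator_apply]
    split_ifs <;> simp
  have hφ0 : ∀ Q x, 0 ≤ φ Q x := fun Q x => by simp only [φ]; positivity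
  obtain ⟨μ, hμf, hμ, hμc⟩ := exists_measure_integral_le_cost φ
    (fun Q => ((2 : ℝ) ^ (-s)) ^ Q.1) hφ0 (fun Q => by positivity) hm
    (by
      have hfin := finite_image_dyadicCell 0 hE.isBounded
      refine ⟨Finsupp.indicator (({0} : Finset ℕ) ×ˢ hfin.toFinset) fun _ _ => (1 : ℝ),
        hnonneg _, fun x => hsum _ _ _ ?_⟩
      rw [Set.Finite.mem_toFinset]
      exact mem_image_of_mem _ x.2)
    (fun c hc h => hlow c hc fun x hx => h ⟨x, hx⟩)
  have hball : ∀ x : EuclideanSpace ℝ (Fin d), ∀ n : ℕ,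
      μ (Subtype.val ⁻¹' Metric.closedBall x ((1 / 2 : ℝ) ^ n)) ≤
        ENNReal.ofReal (5 ^ d * ((2 : ℝ) ^ (-s)) ^ n) := by
    intro x n
    let f : C(E, ℝ) := ⟨fun y => max 0 (min 1 (2 - dist x y.1 * 2 ^ n)), by fun_prop⟩
    have hf1 : ∀ y : E, y.1 ∈ Metric.closedBall x ((1 / 2 : ℝ) ^ n) → 1 ≤ f y := by
      intro y hy
      rw [Metric.mem_closedBall, dist_comm, one_div, inv_pow, ← one_div, le_div_iff₀ (by positivity)]
        at hy
      exact le_max_of_le_right (le_min le_rfl (by linarith))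
    have hf0 : ∀ y, 0 ≤ f y := fun y => le_max_left _ _
    set T := Finset.Icc (fun i => dyadicCell n x i - 2) (fun i => dyadicCell n x i + 2) with hT
    have hint := hμc f (Finsupp.indicator (({n} : Finset ℕ) ×ˢ T) fun _ _ => (1 : ℝ)) (hnonneg _) (by
      intro y
      by_cases hy : dyadicCell n y.1 ∈ T
      · exact (max_le zero_le_one (min_le_left _ _)).trans (hsum n T y hy)
      · have : 2 * ((2 : ℝ) ^ n)⁻¹ < dist x y.1 := by
          by_contra! h
          exact hy (dyadicCell_mem_Icc h)
        have h0 : f y = 0 := by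
          refine max_eq_left (min_le_of_right_le ?_)
          rw [← div_eq_mul_inv, div_lt_iff₀ (by positivity)] at this
          linarith
        rw [h0]
        exact Finset.sum_nonneg fun Q _ => mul_nonneg (hnonneg _ Q) (hφ0 Q y))
    rw [Finsupp.sum_indicator_index (fun _ => (1 : ℝ)) (by simp), Finset.singleton_product,
      Finset.sum_map] at hint
    simp only [Function.Embedding.coeFn_mk, one_mul, Finset.sum_const, hT, nsmul_eq_mul,
      Pi.card_Icc, Int.card_Icc] at hint
    have hcard : ∀ i : Fin d, (dyadicCell n x i + 2 + 1 - (dyadicCell n x i - 2)).toNat = 5 := by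
      intro i; omega
    simp only [hcard, Finset.prod_const, Finset.card_univ, Fintype.card_fin, Nat.cast_pow,
      Nat.cast_ofNat] at hint
    refine le_trans ?_ (ENNReal.ofReal_le_ofReal hint)
    have hmeas : MeasurableSet (Subtype.val ⁻¹' Metric.closedBall x ((1 / 2 : ℝ) ^ n) : Set E) :=
      (Metric.isClosed_closedBall.measurableSet).preimage measurable_subtype_coe
    rw [ofReal_integral_eq_lintegral_ofReal
      (f.continuous.integrable_of_hasCompactSupport (HasCompactSupport.of_compactSpace _))
      (Filter.Eventually.of_forall hf0), ← lintegral_indicator_one hmeas]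
    refine lintegral_mono fun y => ?_
    refine indicator_le (g := fun y => ENNReal.ofReal (f y)) (fun y hy => ?_) y
    simpa using hf1 y hy
  refine ⟨μ.map Subtype.val, inferInstance, ?_, ?_, m + 5 ^ d * 2 ^ s, by positivity, ?_⟩
  · rw [Ne, Measure.map_eq_zero_iff measurable_subtype_coe.aemeasurable, ← Measure.measure_univ_eq_zero,
      hμ]
    simpa using hm
  · rw [Measure.map_apply measurable_subtype_coe hE.isClosed.measurableSet.compl]
    simp
  · intro x r hr
    rw [Measure.map_apply measurable_subtype_coe Metric.isClosed_closedBall.measurableSet]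
    rcases le_or_gt r 1 with h1 | h1
    · obtain ⟨n, hn1, hn2⟩ := exists_nat_pow_near_of_lt_one hr h1 (by norm_num : (0 : ℝ) < 1 / 2)
        (by norm_num)
      refine (measure_mono (preimage_mono (Metric.closedBall_subset_closedBall hn2))).trans
        ((hball x n).trans (ENNReal.ofReal_le_ofReal ?_))
      have e1 : ((2 : ℝ) ^ (-s)) ^ n = 2 ^ s * (((1 / 2 : ℝ)) ^ (n + 1)) ^ s := by
        rw [one_div, ← Real.rpow_natCast, ← Real.rpow_natCast, Real.inv_rpow (by norm_num),
          ← Real.rpow_neg (by norm_num), ← Real.rpow_mul (by norm_num), ← Real.rpow_mul (by norm_num),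
          ← Real.rpow_add (by norm_num)]
        congr 1; push_cast; ring
      calc 5 ^ d * ((2 : ℝ) ^ (-s)) ^ n ≤ 5 ^ d * (2 ^ s * r ^ s) := by rw [e1]; gcongr
        _ ≤ _ := by nlinarith [mul_nonneg hm.le (Real.rpow_nonneg hr.le s)]
    · refine (measure_mono (subset_univ _)).trans (hμ.le.trans (ENNReal.ofReal_le_ofReal ?_))
      have := Real.one_le_rpow h1.le hs.le
      have h2 : (0:ℝ) ≤ 5 ^ d * 2 ^ s := by positivity
      nlinarith

lemma exists_abs_le_rpow_of_bessel_ode {J P : ℝ → ℝ} {n : ℝ} (hn : 1 ≤ n)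
    (hJ : ∀ r, HasDerivAt J (-P r) r)
    (hP : ∀ r, 0 < r → HasDerivAt P (J r - n / r * P r) r) {M : ℝ} (hM : ∀ r, |J r| ≤ M) :
    ∃ C, 0 < C ∧ ∀ r, 0 ≤ r → |J r| ≤ C * (1 + r) ^ (-(n / 2)) := by
  have hn0 : 0 < n := by linarith
  let G : ℝ → ℝ := fun r => r ^ n * (J r ^ 2 + P r ^ 2 - n / r * (J r * P r))
  have hG : ∀ r, 0 < r → HasDerivAt G (r ^ n * (n / r ^ 2 * (J r * P r))) r := by
    intro r hr
    have h1 := Real.hasDerivAt_rpow_const (x := r) (p := n) (Or.inl hr.ne')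
    have h2 : HasDerivAt (fun r : ℝ => n / r) (-(n / r ^ 2)) r := by
      simpa [div_eq_mul_inv] using (hasDerivAt_inv hr.ne').const_mul n
    have h3 := h1.mul ((((hJ r).pow 2).add ((hP r hr).pow 2)).sub (h2.mul ((hJ r).mul (hP r hr))))
    refine h3.congr_deriv ?_
    rw [Real.rpow_sub hr, Real.rpow_one]
    simp only [Pi.add_apply, Pi.sub_apply, Pi.mul_apply, Pi.pow_apply]
    field_simp
    ring
  have hlow : ∀ r, n ≤ r → r ^ n * ((J r ^ 2 + P r ^ 2) / 2) ≤ G r := by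
    intro r hr
    have hr0 : 0 < r := by linarith
    have h1 : n / r ≤ 1 := (div_le_one hr0).2 hr
    have h2 : 0 ≤ n / r := by positivity
    have h3 : n / r * (J r * P r) ≤ (J r ^ 2 + P r ^ 2) / 2 := by
      have h4 : J r * P r ≤ (J r ^ 2 + P r ^ 2) / 2 := by nlinarith [sq_nonneg (J r - P r)]
      have h5 : 0 ≤ (J r ^ 2 + P r ^ 2) / 2 := by positivity
      nlinarith
    simp only [G]
    gcongr
    linarith
  let H : ℝ → ℝ := fun r => G r * Real.exp (n / r)
  have hH : ∀ r, 0 < r → HasDerivAt H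
      (Real.exp (n / r) * (r ^ n * (n / r ^ 2 * (J r * P r)) - n / r ^ 2 * G r)) r := by
    intro r hr
    have h2 : HasDerivAt (fun r : ℝ => n / r) (-(n / r ^ 2)) r := by
      simpa [div_eq_mul_inv] using (hasDerivAt_inv hr.ne').const_mul n
    refine ((hG r hr).mul h2.exp).congr_deriv ?_
    ring
  have hanti : AntitoneOn H (Ici n) := by
    refine antitoneOn_of_deriv_nonpos (convex_Ici n) (fun r hr => ?_) (fun r hr => ?_) fun r hr => ?_
    · exact (hH r (hn0.trans_le hr)).continuousAt.continuousWithinAt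
    all_goals rw [interior_Ici] at hr
    · exact (hH r (hn0.trans hr)).differentiableAt.differentiableWithinAt
    · have hr0 : 0 < r := hn0.trans hr
      rw [(hH r hr0).deriv]
      refine mul_nonpos_of_nonneg_of_nonpos (Real.exp_pos _).le ?_
      have h1 := hlow r (le_of_lt hr)
      have h4 : J r * P r ≤ (J r ^ 2 + P r ^ 2) / 2 := by nlinarith [sq_nonneg (J r - P r)]
      have h5 : 0 < r ^ n := by positivity
      have h6 : 0 ≤ n / r ^ 2 := by positivity
      have h7 : r ^ n * (J r * P r) ≤ G r := le_trans (by gcongr) h1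
      nlinarith
  have hM0 : 0 ≤ M := (abs_nonneg _).trans (hM 0)
  have hbig : ∀ r, n ≤ r → |J r| ≤ Real.sqrt (2 * H n) * r ^ (-(n / 2)) := by
    intro r hr
    have hr0 : 0 < r := by linarith
    have h1 := hanti self_mem_Ici hr hr
    have h2 := hlow r hr
    have hG0 : 0 ≤ G r := le_trans (by positivity) h2
    have h3 : G r ≤ H r := le_mul_of_one_le_right hG0 (Real.one_le_exp (by positivity))
    have h4 : r ^ n * J r ^ 2 ≤ 2 * H n := by nlinarith [mul_nonneg (Real.rpow_nonneg hr0.le n) (sq_nonneg (P r))]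
    have h5 : J r ^ 2 ≤ 2 * H n * (r ^ (-(n / 2))) ^ 2 := by
      rw [← Real.rpow_natCast (r ^ (-(n / 2))), ← Real.rpow_mul hr0.le]
      have : -(n / 2) * ((2 : ℕ) : ℝ) = -n := by push_cast; ring
      rw [this, Real.rpow_neg hr0.le, ← div_eq_mul_inv, le_div_iff₀' (by positivity)]
      exact h4
    rw [← Real.sqrt_sq_eq_abs]
    refine (Real.sqrt_le_sqrt h5).trans_eq ?_
    rw [Real.sqrt_mul' _ (by positivity), Real.sqrt_sq (by positivity)]
  refine ⟨(M + 1) * (1 + n) ^ (n / 2) + Real.sqrt (2 * H n) * 2 ^ (n / 2), by positivity, fun r hr => ?_⟩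
  have hr1 : 0 < 1 + r := by linarith
  rw [Real.rpow_neg hr1.le, ← div_eq_mul_inv, le_div_iff₀ (by positivity)]
  rcases le_or_gt n r with h | h
  · have hr0 : 0 < r := by linarith
    calc |J r| * (1 + r) ^ (n / 2) ≤ (Real.sqrt (2 * H n) * r ^ (-(n / 2))) * (2 * r) ^ (n / 2) := by
          gcongr
          · exact hbig r h
          · linarith
      _ = Real.sqrt (2 * H n) * 2 ^ (n / 2) := by
          rw [Real.mul_rpow (by norm_num) hr0.le, Real.rpow_neg hr0.le]
          have : r ^ (n / 2) ≠ 0 := by positivity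
          field_simp
      _ ≤ _ := by
          have : 0 ≤ (M + 1) * (1 + n) ^ (n / 2) := by positivity
          linarith
  · calc |J r| * (1 + r) ^ (n / 2) ≤ (M + 1) * (1 + n) ^ (n / 2) := by
          gcongr
          linarith [hM r]
      _ ≤ _ := by
          have : 0 ≤ Real.sqrt (2 * H n) * 2 ^ (n / 2) := by positivity
          linarith

/-- A finite measure on the unit sphere invariant under all linear isometries. -/
structure IsSphereMeasure {d : ℕ} (σ : Measure (EuclideanSpace ℝ (Fin d))) : Prop where
  finite : IsFiniteMeasure σ
  ae_norm : ∀ᵐ x ∂σ, ‖x‖ = 1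
  map_eq : ∀ g : EuclideanSpace ℝ (Fin d) ≃ₗᵢ[ℝ] EuclideanSpace ℝ (Fin d), σ.map g = σ

section sphere

variable {d : ℕ} {σ : Measure (EuclideanSpace ℝ (Fin d))}

lemma IsSphereMeasure.integral_comp (hσ : IsSphereMeasure σ) {F : Type*} [NormedAddCommGroup F]
    [NormedSpace ℝ F] (g : EuclideanSpace ℝ (Fin d) ≃ₗᵢ[ℝ] EuclideanSpace ℝ (Fin d))
    (f : EuclideanSpace ℝ (Fin d) → F) : ∫ x, f (g x) ∂σ = ∫ x, f x ∂σ := by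
  conv_rhs => rw [← hσ.map_eq g]
  exact (g.toHomeomorph.measurableEmbedding.integral_map f).symm

lemma IsSphereMeasure.charFun_eq_of_norm_eq (hσ : IsSphereMeasure σ)
    {ξ η : EuclideanSpace ℝ (Fin d)} (h : ‖ξ‖ = ‖η‖) : charFun σ ξ = charFun σ η := by
  have hg := Submodule.reflection_sub h
  set g := (ℝ ∙ (ξ - η))ᗮ.reflection
  rw [charFun_apply, charFun_apply, ← hσ.integral_comp g (fun x => Complex.exp (inner ℝ x η * _)),
    ← hg]
  simp only [g.inner_map_map]

lemma IsSphereMeasure.charFun_eq_integral_cos (hσ : IsSphereMeasure σ)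
    (ξ : EuclideanSpace ℝ (Fin d)) :
    charFun σ ξ = ((∫ x, Real.cos (inner ℝ x ξ) ∂σ : ℝ) : ℂ) := by
  have := hσ.finite
  have h1 : charFun σ (-ξ) = charFun σ ξ := hσ.charFun_eq_of_norm_eq (norm_neg ξ)
  rw [charFun_neg] at h1
  rw [← Complex.conj_eq_iff_re.1 h1, charFun_apply]
  have hint : Integrable (fun x => Complex.exp (inner ℝ x ξ * Complex.I)) σ := by
    refine Integrable.of_bound (by fun_prop) 1 (Filter.Eventually.of_forall fun x => ?_)
    rw [Complex.norm_exp_ofReal_mul_I]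
  rw [← Complex.reCLM_apply, ← Complex.reCLM.integral_comp_comm hint]
  simp [Complex.exp_ofReal_mul_I_re]

lemma IsSphereMeasure.abs_apply_le (hσ : IsSphereMeasure σ) (i : Fin d) :
    ∀ᵐ x ∂σ, |x i| ≤ 1 := by
  filter_upwards [hσ.ae_norm] with x hx
  exact (PiLp.norm_apply_le x i).trans hx.le

lemma IsSphereMeasure.integral_mul_sin_eq_zero (hσ : IsSphereMeasure σ)
    {e f : EuclideanSpace ℝ (Fin d)} (hef : inner ℝ e f = 0) :
    ∫ x, inner ℝ x f * Real.sin (inner ℝ x e) ∂σ = 0 := by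
  set g := (ℝ ∙ f)ᗮ.reflection
  have hgf : g f = -f := Submodule.reflection_orthogonalComplement_singleton_eq_neg f
  have hge : g e = e := Submodule.reflection_mem_subspace_eq_self
    (by rw [Submodule.mem_orthogonal_singleton_iff_inner_left]; exact hef)
  have h := hσ.integral_comp g fun x => inner ℝ x f * Real.sin (inner ℝ x e)
  have h1 : ∀ x, inner ℝ (g x) f = -inner ℝ x f := fun x => by
    have : f = g (-f) := by rw [map_neg, hgf, neg_neg]
    conv_lhs => rw [this, g.inner_map_map, inner_neg_right]
  have h2 : ∀ x, inner ℝ (g x) e = inner ℝ x e := fun x => by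
    conv_lhs => rw [← hge, g.inner_map_map]
  simp only [h1, h2, neg_mul, integral_neg] at h
  linarith

lemma IsSphereMeasure.integral_mul_sin (hσ : IsSphereMeasure σ) {i j : Fin d} (hij : i ≠ j) (r : ℝ) :
    ∫ x, x i * Real.sin (r * x i) ∂σ = r * ∫ x, x j ^ 2 * Real.cos (r * x i) ∂σ := by
  have := hσ.finite
  let F : ℝ → EuclideanSpace ℝ (Fin d) → ℝ := fun θ x =>
    (-Real.sin θ * x i + Real.cos θ * x j) * Real.sin (r * (Real.cos θ * x i + Real.sin θ * x j))
  let F' : ℝ → EuclideanSpace ℝ (Fin d) → ℝ := fun θ x =>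
    (-Real.cos θ * x i + -Real.sin θ * x j) * Real.sin (r * (Real.cos θ * x i + Real.sin θ * x j))
    + (-Real.sin θ * x i + Real.cos θ * x j) * (Real.cos (r * (Real.cos θ * x i + Real.sin θ * x j))
      * (r * (-Real.sin θ * x i + Real.cos θ * x j)))
  have hzero : ∀ θ, ∫ x, F θ x ∂σ = 0 := by
    intro θ
    have h := hσ.integral_mul_sin_eq_zero
      (e := r • (Real.cos θ • EuclideanSpace.single i 1 + Real.sin θ • EuclideanSpace.single j 1))
      (f := -Real.sin θ • EuclideanSpace.single i 1 + Real.cos θ • EuclideanSpace.single j 1) (by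
        have h1 : inner ℝ (EuclideanSpace.single i (1 : ℝ)) (EuclideanSpace.single j (1 : ℝ)) = 0 := by
          simp [EuclideanSpace.inner_single_left, hij]
        have h2 : inner ℝ (EuclideanSpace.single j (1 : ℝ)) (EuclideanSpace.single i (1 : ℝ)) = 0 := by
          rw [real_inner_comm, h1]
        simp [inner_add_left, inner_add_right, inner_smul_left, inner_smul_right, h1, h2]
        ring)
    rw [← h]
    refine integral_congr_ae (Filter.Eventually.of_forall fun x => ?_)
    simp [F, inner_add_right, inner_smul_right, EuclideanSpace.inner_single_right, mul_add]
  have hbd : ∀ᵐ x ∂σ, ∀ θ ∈ (univ : Set ℝ), ‖F' θ x‖ ≤ 2 + 2 * (|r| * 2) := by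
    filter_upwards [hσ.abs_apply_le i, hσ.abs_apply_le j] with x hi hj θ _
    have hs := Real.abs_sin_le_one θ
    have hc := Real.abs_cos_le_one θ
    have e1 : |-Real.sin θ * x i + Real.cos θ * x j| ≤ 2 := by
      refine (abs_add_le _ _).trans ?_
      rw [abs_mul, abs_mul, abs_neg]
      nlinarith [abs_nonneg (x i), abs_nonneg (x j), abs_nonneg (Real.sin θ), abs_nonneg (Real.cos θ)]
    have e2 : |-Real.cos θ * x i + -Real.sin θ * x j| ≤ 2 := by
      refine (abs_add_le _ _).trans ?_
      rw [abs_mul, abs_mul, abs_neg, abs_neg]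
      nlinarith [abs_nonneg (x i), abs_nonneg (x j), abs_nonneg (Real.sin θ), abs_nonneg (Real.cos θ)]
    refine (norm_add_le _ _).trans ?_
    rw [norm_mul, norm_mul, norm_mul, norm_mul, Real.norm_eq_abs, Real.norm_eq_abs, Real.norm_eq_abs,
      Real.norm_eq_abs, Real.norm_eq_abs]
    refine add_le_add ?_ ?_
    · exact (mul_le_mul e2 (Real.abs_sin_le_one _) (abs_nonneg _) (by norm_num)).trans_eq (by norm_num)
    · exact mul_le_mul e1 ((mul_le_mul (Real.abs_cos_le_one _)
        (mul_le_mul_of_nonneg_left e1 (abs_nonneg r)) (by positivity) zero_le_one).trans_eq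
          (one_mul _)) (by positivity) (by norm_num)
  have hder := (hasDerivAt_integral_of_dominated_loc_of_deriv_le (μ := σ) (F := F) (F' := F')
    (x₀ := (0 : ℝ)) (bound := fun _ => 2 + 2 * (|r| * 2)) (s := univ) Filter.univ_mem
    (Filter.Eventually.of_forall fun θ => by simp only [F]; fun_prop) (by
      refine Integrable.of_bound (by simp only [F]; fun_prop) 1 ?_
      filter_upwards [hσ.abs_apply_le j] with x hj
      simp only [F, Real.sin_zero, Real.cos_zero, norm_mul, Real.norm_eq_abs]
      simp only [neg_zero, zero_mul, zero_add, one_mul, add_zero]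
      exact mul_le_one₀ hj (abs_nonneg _) (Real.abs_sin_le_one _)) (by simp only [F']; fun_prop)
    hbd (integrable_const _)
    (Filter.Eventually.of_forall fun x θ _ => by
      have h1 := ((Real.hasDerivAt_sin θ).neg.mul_const (x i)).add
        ((Real.hasDerivAt_cos θ).mul_const (x j))
      have h2 := (((Real.hasDerivAt_cos θ).mul_const (x i)).add
        ((Real.hasDerivAt_sin θ).mul_const (x j))).const_mul r
      exact h1.mul h2.sin)).2
  have h0 : ∫ x, F' 0 x ∂σ = 0 := by
    have : (fun θ => ∫ x, F θ x ∂σ) = fun _ => 0 := funext hzero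
    rw [this] at hder
    exact hder.unique (hasDerivAt_const _ _)
  have hI1 : Integrable (fun x => x i * Real.sin (r * x i)) σ := by
    refine Integrable.of_bound (by fun_prop) 1 ?_
    filter_upwards [hσ.abs_apply_le i] with x hi
    rw [norm_mul]
    exact mul_le_one₀ hi (abs_nonneg _) (Real.abs_sin_le_one _)
  have hI2 : Integrable (fun x => x j ^ 2 * Real.cos (r * x i)) σ := by
    refine Integrable.of_bound (by fun_prop) 1 ?_
    filter_upwards [hσ.abs_apply_le j] with x hj
    rw [norm_mul, norm_pow]
    exact mul_le_one₀ (pow_le_one₀ (abs_nonneg _) hj) (abs_nonneg _) (Real.abs_cos_le_one _)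
  have h3 : ∀ x, F' 0 x = -(x i * Real.sin (r * x i)) + r * (x j ^ 2 * Real.cos (r * x i)) := by
    intro x
    simp only [F', Real.sin_zero, Real.cos_zero]
    simp only [neg_zero, zero_mul, zero_add, one_mul, add_zero]
    ring
  simp only [h3] at h0
  rw [integral_add (f := fun x => -_) hI1.neg (hI2.const_mul r), integral_neg, integral_const_mul] at h0
  linarith

lemma IsSphereMeasure.exists_charFun_le (hσ : IsSphereMeasure σ) (hd : 2 ≤ d) :
    ∃ C, 0 < C ∧ ∀ ξ, ‖charFun σ ξ‖ ≤ C * (1 + ‖ξ‖) ^ (-(((d : ℝ) - 1) / 2)) := by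
  have := hσ.finite
  have : NeZero d := ⟨by omega⟩
  let i : Fin d := 0
  let J : ℝ → ℝ := fun r => ∫ x, Real.cos (r * x i) ∂σ
  let P : ℝ → ℝ := fun r => ∫ x, x i * Real.sin (r * x i) ∂σ
  let Q : ℝ → ℝ := fun r => ∫ x, x i ^ 2 * Real.cos (r * x i) ∂σ
  have hI0 : ∀ r, Integrable (fun x : EuclideanSpace ℝ (Fin d) => Real.cos (r * x i)) σ := fun r =>
    Integrable.of_bound (by fun_prop) 1 (Filter.Eventually.of_forall fun x => Real.abs_cos_le_one _)
  have hI1 : ∀ r, Integrable (fun x : EuclideanSpace ℝ (Fin d) => x i * Real.sin (r * x i)) σ := by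
    intro r
    refine Integrable.of_bound (by fun_prop) 1 ?_
    filter_upwards [hσ.abs_apply_le i] with x hi
    rw [norm_mul]
    exact mul_le_one₀ hi (abs_nonneg _) (Real.abs_sin_le_one _)
  have hI2 : ∀ r j, Integrable
      (fun x : EuclideanSpace ℝ (Fin d) => x j ^ 2 * Real.cos (r * x i)) σ := by
    intro r j
    refine Integrable.of_bound (by fun_prop) 1 ?_
    filter_upwards [hσ.abs_apply_le j] with x hj
    rw [norm_mul, norm_pow]
    exact mul_le_one₀ (pow_le_one₀ (abs_nonneg _) hj) (abs_nonneg _) (Real.abs_cos_le_one _)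
  have hJ : ∀ r, HasDerivAt J (-P r) r := by
    intro r
    have h := (hasDerivAt_integral_of_dominated_loc_of_deriv_le (μ := σ)
      (F := fun r x => Real.cos (r * x i)) (F' := fun r x => -Real.sin (r * x i) * (1 * x i))
      (x₀ := r) (bound := fun _ => 1) (s := univ) Filter.univ_mem
      (Filter.Eventually.of_forall fun r => by fun_prop) (hI0 r) (by fun_prop) (by
        filter_upwards [hσ.abs_apply_le i] with x hi r _
        rw [norm_mul, norm_neg, one_mul]
        exact mul_le_one₀ (Real.abs_sin_le_one _) (abs_nonneg _) hi) (integrable_const _)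
      (Filter.Eventually.of_forall fun x r _ => ((hasDerivAt_id r).mul_const (x i)).cos)).2
    refine h.congr_deriv ?_
    rw [← integral_neg]
    congr 1; ext x; ring
  have hP : ∀ r, HasDerivAt P (Q r) r := by
    intro r
    have h := (hasDerivAt_integral_of_dominated_loc_of_deriv_le (μ := σ)
      (F := fun r x => x i * Real.sin (r * x i))
      (F' := fun r x => x i * (Real.cos (r * x i) * (1 * x i)))
      (x₀ := r) (bound := fun _ => 1) (s := univ) Filter.univ_mem
      (Filter.Eventually.of_forall fun r => by fun_prop) (hI1 r) (by fun_prop) (by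
        filter_upwards [hσ.abs_apply_le i] with x hi r _
        rw [norm_mul, norm_mul, one_mul]
        exact mul_le_one₀ hi (by positivity) (mul_le_one₀ (Real.abs_cos_le_one _) (abs_nonneg _) hi))
      (integrable_const _)
      (Filter.Eventually.of_forall fun x r _ =>
        (((hasDerivAt_id r).mul_const (x i)).sin).const_mul (x i))).2
    refine h.congr_deriv ?_
    congr 1; ext x; ring
  have hode : ∀ r, r * (J r - Q r) = ((d : ℝ) - 1) * P r := by
    intro r
    have h1 : ∑ j ∈ Finset.univ.erase i, r * ∫ x, x j ^ 2 * Real.cos (r * x i) ∂σ =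
        ((d : ℝ) - 1) * P r := by
      rw [Finset.sum_congr rfl fun j hj => (hσ.integral_mul_sin (Finset.ne_of_mem_erase hj).symm r).symm,
        Finset.sum_const, Finset.card_erase_of_mem (Finset.mem_univ i), nsmul_eq_mul]
      rw [Finset.card_univ, Fintype.card_fin, Nat.cast_sub (by omega), Nat.cast_one]
    rw [← h1, ← Finset.mul_sum, ← integral_finsetSum _ fun j _ => hI2 r j,
      ← integral_sub (hI0 r) (hI2 r i)]
    congr 1
    refine integral_congr_ae ?_
    filter_upwards [hσ.ae_norm] with x hx
    have h2 := EuclideanSpace.norm_sq_eq x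
    rw [hx, ← Finset.add_sum_erase _ _ (Finset.mem_univ i)] at h2
    simp only [Real.norm_eq_abs, sq_abs] at h2
    rw [← Finset.sum_mul]
    linear_combination Real.cos (r * x i) * h2
  have hM : ∀ r, |J r| ≤ σ.real univ := fun r => by
    have := norm_integral_le_of_norm_le_const (μ := σ) (C := 1)
      (f := fun x : EuclideanSpace ℝ (Fin d) => Real.cos (r * x i))
      (Filter.Eventually.of_forall fun x => Real.abs_cos_le_one (r * x i))
    simpa using this
  obtain ⟨C, hC0, hC⟩ := exists_abs_le_rpow_of_bessel_ode (J := J) (P := P) (n := (d : ℝ) - 1)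
    (by have : (2 : ℝ) ≤ d := by exact_mod_cast hd
        linarith) hJ (fun r hr => (hP r).congr_deriv (by
          have := hode r
          field_simp
          linarith)) hM
  refine ⟨C, hC0, fun ξ => ?_⟩
  have h1 : charFun σ ξ = J ‖ξ‖ := by
    rw [hσ.charFun_eq_of_norm_eq (η := ‖ξ‖ • EuclideanSpace.single i 1) (by simp [norm_smul]),
      hσ.charFun_eq_integral_cos]
    simp [J, inner_smul_right, EuclideanSpace.inner_single_right]
  rw [h1, Complex.norm_real]
  exact hC _ (norm_nonneg ξ)

end sphere

/-- The surface measure of the unit sphere, as a measure on the ambient space. -/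
noncomputable def sphereMeasure (d : ℕ) : Measure (EuclideanSpace ℝ (Fin d)) :=
  (volume : Measure (EuclideanSpace ℝ (Fin d))).toSphere.map Subtype.val

open scoped Pointwise in
lemma sphereMeasure_apply {d : ℕ} {A : Set (EuclideanSpace ℝ (Fin d))} (hA : MeasurableSet A) :
    sphereMeasure d A = d * volume (Ioo (0 : ℝ) 1 • (A ∩ Metric.sphere 0 1)) := by
  rw [sphereMeasure, Measure.map_apply measurable_subtype_coe hA,
    Measure.toSphere_apply' _ (measurable_subtype_coe hA), Subtype.image_preimage_coe, inter_comm,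
    finrank_euclideanSpace_fin]

open scoped Pointwise in
lemma isSphereMeasure_sphereMeasure (d : ℕ) : IsSphereMeasure (sphereMeasure d) where
  finite := by rw [sphereMeasure]; infer_instance
  ae_norm := by
    rw [sphereMeasure, ae_map_iff measurable_subtype_coe.aemeasurable
      (measurableSet_eq_fun measurable_norm measurable_const)]
    exact Filter.Eventually.of_forall fun x => norm_eq_of_mem_sphere x
  map_eq g := by
    ext A hA
    rw [Measure.map_apply g.continuous.measurable hA, sphereMeasure_apply hA,
      sphereMeasure_apply (g.continuous.measurable hA)]
    congr 1
    rw [← g.measurePreserving.measure_preimage_equiv (f := g.toMeasurableEquiv)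
      (Ioo (0 : ℝ) 1 • (A ∩ Metric.sphere 0 1))]
    congr 1
    ext x
    simp only [Set.mem_smul, mem_preimage, mem_inter_iff, mem_sphere_zero_iff_norm]
    constructor
    · rintro ⟨r, hr, y, hy, rfl⟩
      exact ⟨r, hr, g y, ⟨hy.1, by rw [g.norm_map]; exact hy.2⟩, (map_smul g r y).symm⟩
    · rintro ⟨r, hr, y, hy, h⟩
      refine ⟨r, hr, g.symm y, ⟨by simpa using hy.1, by rw [g.symm.norm_map]; exact hy.2⟩, ?_⟩
      apply g.injective
      simpa using h

lemma integral_eq_integral_sphereMeasure {d : ℕ} [NeZero d] {f : EuclideanSpace ℝ (Fin d) → ℂ}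
    (hf : Integrable f) :
    ∫ x, f x = ∫ t in Ioi (0 : ℝ), (t : ℂ) ^ (d - 1) * ∫ x, f (t • x) ∂sphereMeasure d := by
  have hmp := (volume : Measure (EuclideanSpace ℝ (Fin d))).measurePreserving_homeomorphUnitSphereProd
  have hemb := (homeomorphUnitSphereProd (EuclideanSpace ℝ (Fin d))).measurableEmbedding
  set τ := (volume : Measure (EuclideanSpace ℝ (Fin d))).toSphere
  let g : Metric.sphere (0 : EuclideanSpace ℝ (Fin d)) 1 × Ioi (0 : ℝ) → ℂ := fun p => f (p.2.1 • p.1.1)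
  have hg : ∀ x : ({0}ᶜ : Set (EuclideanSpace ℝ (Fin d))),
      g (homeomorphUnitSphereProd (EuclideanSpace ℝ (Fin d)) x) = f x.1 := by
    intro x
    have : ‖x.1‖ ≠ 0 := norm_ne_zero_iff.2 x.2
    simp [g, smul_smul, this]
  have hgint : Integrable g (τ.prod (.volumeIoiPow (Module.finrank ℝ (EuclideanSpace ℝ (Fin d)) - 1))) := by
    rw [← hmp.integrable_comp_emb hemb]
    have : g ∘ homeomorphUnitSphereProd (EuclideanSpace ℝ (Fin d)) = f ∘ Subtype.val := funext hg
    rw [this, ← integrableOn_iff_comap_subtypeVal (measurableSet_singleton _).compl]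
    exact hf.integrableOn
  calc ∫ x, f x = ∫ x : ({0}ᶜ : Set (EuclideanSpace ℝ (Fin d))), f x.1 ∂(volume.comap Subtype.val) := by
        rw [integral_subtype_comap (measurableSet_singleton _).compl f, restrict_compl_singleton]
    _ = ∫ p, g p ∂τ.prod (.volumeIoiPow (Module.finrank ℝ (EuclideanSpace ℝ (Fin d)) - 1)) := by
        rw [← hmp.integral_comp hemb]
        exact integral_congr_ae (Filter.Eventually.of_forall fun x => (hg x).symm)
    _ = ∫ t, ∫ x, g (x, t) ∂τ ∂(.volumeIoiPow (Module.finrank ℝ (EuclideanSpace ℝ (Fin d)) - 1)) :=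
        integral_prod_symm _ hgint
    _ = ∫ t : Ioi (0 : ℝ), ((t.1 : ℂ) ^ (d - 1) * ∫ x, f (t.1 • x) ∂sphereMeasure d)
          ∂(volume.comap Subtype.val) := by
        simp only [Measure.volumeIoiPow, ENNReal.ofReal, finrank_euclideanSpace_fin]
        rw [integral_withDensity_eq_integral_smul (by fun_prop)]
        refine integral_congr_ae (Filter.Eventually.of_forall fun t => ?_)
        have h0 : 0 ≤ t.1 ^ (d - 1) := pow_nonneg t.2.out.le _
        have h1 : ∫ x, f (t.1 • x) ∂sphereMeasure d = ∫ x, g (x, t) ∂τ :=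
          (MeasurableEmbedding.subtype_coe
            Metric.isClosed_sphere.measurableSet).integral_map fun x => f (t.1 • x)
        simp only [h1, NNReal.smul_def, Real.coe_toNNReal _ h0, Complex.real_smul, Complex.ofReal_pow]
    _ = _ := integral_subtype_comap measurableSet_Ioi
        fun t : ℝ => (t : ℂ) ^ (d - 1) * ∫ x, f (t • x) ∂sphereMeasure d

/-- The Fourier transform of `exp (-b ‖·‖²)`. -/
noncomputable def gaussKernel {d : ℕ} (b : ℝ) (x : EuclideanSpace ℝ (Fin d)) : ℝ :=
  (Real.pi / b) ^ ((d : ℝ) / 2) * Real.exp (-‖x‖ ^ 2 / (4 * b))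

section gauss

variable {d : ℕ}

lemma continuous_gaussKernel (b : ℝ) :
    Continuous (gaussKernel b : EuclideanSpace ℝ (Fin d) → ℝ) := by
  unfold gaussKernel; fun_prop

lemma gaussKernel_pos {b : ℝ} (hb : 0 < b) (x : EuclideanSpace ℝ (Fin d)) :
    0 < gaussKernel b x := by
  unfold gaussKernel; positivity

lemma gaussKernel_le {b : ℝ} (hb : 0 < b) (x : EuclideanSpace ℝ (Fin d)) :
    gaussKernel b x ≤ (Real.pi / b) ^ ((d : ℝ) / 2) := by
  refine mul_le_of_le_one_right (by positivity) (Real.exp_le_one_iff.2 ?_)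
  rw [neg_div]
  exact neg_nonpos.2 (by positivity)

lemma integrable_exp_neg_mul_sq_norm {b : ℝ} (hb : 0 < b) :
    Integrable fun ξ : EuclideanSpace ℝ (Fin d) => Real.exp (-b * ‖ξ‖ ^ 2) := by
  have := (GaussianFourier.integrable_cexp_neg_mul_sq_norm_add (V := EuclideanSpace ℝ (Fin d))
    (b := (b : ℂ)) (by simpa using hb) 0 0).norm
  simpa [Complex.norm_exp, ← Complex.ofReal_pow] using this

lemma integral_exp_mul_charFun (μ : Measure (EuclideanSpace ℝ (Fin d))) [IsFiniteMeasure μ]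
    {b : ℝ} (hb : 0 < b) :
    ∫ ξ, (Real.exp (-b * ‖ξ‖ ^ 2) : ℂ) * charFun μ ξ = ((∫ x, gaussKernel b x ∂μ : ℝ) : ℂ) := by
  have hint : Integrable (fun p : EuclideanSpace ℝ (Fin d) × EuclideanSpace ℝ (Fin d) =>
      (Real.exp (-b * ‖p.1‖ ^ 2) : ℂ) * Complex.exp (inner ℝ p.2 p.1 * Complex.I))
      (volume.prod μ) := by
    refine ((integrable_exp_neg_mul_sq_norm hb).ofReal.mul_prod
      (integrable_const (1 : ℂ)) (ν := μ)).mono (by fun_prop) (Filter.Eventually.of_forall fun p => ?_)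
    rw [norm_mul, norm_mul, Complex.norm_exp_ofReal_mul_I]
    simp
  simp only [charFun_apply, ← integral_const_mul]
  rw [integral_integral_swap hint, ← integral_complex_ofReal]
  refine integral_congr_ae (Filter.Eventually.of_forall fun x => ?_)
  have h := GaussianFourier.integral_cexp_neg_mul_sq_norm_add (V := EuclideanSpace ℝ (Fin d))
    (b := (b : ℂ)) (by simpa using hb) Complex.I x
  simp only [gaussKernel]
  have e : ∀ ξ : EuclideanSpace ℝ (Fin d), (Real.exp (-b * ‖ξ‖ ^ 2) : ℂ) *
      Complex.exp (inner ℝ x ξ * Complex.I) =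
      Complex.exp (-(b : ℂ) * ‖ξ‖ ^ 2 + Complex.I * inner ℝ x ξ) := by
    intro ξ
    rw [Complex.ofReal_exp, ← Complex.exp_add]
    congr 1; push_cast; ring
  simp only [e, h, finrank_euclideanSpace_fin]
  rw [Complex.ofReal_mul, Complex.ofReal_cpow (by positivity)]
  congr 1
  · push_cast; rfl
  · rw [Complex.ofReal_exp]; congr 1; push_cast; rw [Complex.I_sq]; ring

lemma integral_exp_mul_charFun_mul (μ ν σ : Measure (EuclideanSpace ℝ (Fin d))) [IsFiniteMeasure μ]
    [IsFiniteMeasure ν] [IsFiniteMeasure σ] {b : ℝ} (hb : 0 < b) (t : ℝ) :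
    ∫ ξ, (Real.exp (-b * ‖ξ‖ ^ 2) : ℂ) * (charFun μ ξ * charFun ν (-ξ) * charFun σ (t • ξ)) =
      ((∫ p, gaussKernel b (p.1.1 - p.1.2 + t • p.2) ∂((μ.prod ν).prod σ) : ℝ) : ℂ) := by
  have hmeas : Measurable fun p : (EuclideanSpace ℝ (Fin d) × EuclideanSpace ℝ (Fin d)) ×
      EuclideanSpace ℝ (Fin d) => p.1.1 - p.1.2 + t • p.2 := by fun_prop
  have h := integral_exp_mul_charFun
    (((μ.prod ν).prod σ).map fun p => p.1.1 - p.1.2 + t • p.2) hb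
  rw [integral_map hmeas.aemeasurable (continuous_gaussKernel b).aestronglyMeasurable] at h
  rw [← h]
  congr 1; ext ξ; congr 1
  rw [charFun_apply (μ := Measure.map _ _), integral_map hmeas.aemeasurable (by fun_prop), charFun_apply,
    charFun_apply, charFun_apply, ← integral_prod_mul, ← integral_prod_mul]
  congr 1; ext p
  rw [← Complex.exp_add, ← Complex.exp_add]
  congr 1
  simp only [inner_add_left, inner_sub_left, inner_smul_left, inner_smul_right, inner_neg_right]
  simp; ring

lemma lintegral_exp_mul_enorm_charFun_sq (μ : Measure (EuclideanSpace ℝ (Fin d)))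
    [IsFiniteMeasure μ] {b : ℝ} (hb : 0 < b) :
    ∫⁻ ξ, ENNReal.ofReal (Real.exp (-b * ‖ξ‖ ^ 2)) * ‖charFun μ ξ‖ₑ ^ 2 =
      ∫⁻ x, ∫⁻ y, ENNReal.ofReal (gaussKernel b (x - y)) ∂μ ∂μ := by
  have h := integral_exp_mul_charFun_mul μ μ (Measure.dirac 0) hb 0
  have e : ∀ ξ, charFun μ ξ * charFun μ (-ξ) = ((‖charFun μ ξ‖ ^ 2 : ℝ) : ℂ) := fun ξ => by
    rw [charFun_neg, Complex.mul_conj, Complex.normSq_eq_norm_sq]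
  simp only [zero_smul, charFun_zero, e, add_zero] at h
  simp only [probReal_univ, Complex.ofReal_one, mul_one, ← Complex.ofReal_mul] at h
  rw [integral_complex_ofReal, Complex.ofReal_inj] at h
  have hb1 : Integrable (fun ξ => Real.exp (-b * ‖ξ‖ ^ 2) * ‖charFun μ ξ‖ ^ 2) := by
    refine (integrable_exp_neg_mul_sq_norm hb).mul_bdd (c := μ.real univ ^ 2)
      (by have := continuous_charFun (μ := μ); fun_prop) (Filter.Eventually.of_forall fun ξ => ?_)
    rw [norm_pow, norm_norm]
    gcongr
    exact norm_charFun_le ξ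
  have hb2 : Integrable (fun p : (EuclideanSpace ℝ (Fin d) × EuclideanSpace ℝ (Fin d)) ×
      EuclideanSpace ℝ (Fin d) => gaussKernel b (p.1.1 - p.1.2))
      ((μ.prod μ).prod (Measure.dirac 0)) := by
    have := continuous_gaussKernel (d := d) b
    refine Integrable.of_bound (by fun_prop) ((Real.pi / b) ^ ((d : ℝ) / 2))
      (Filter.Eventually.of_forall fun p => ?_)
    rw [Real.norm_of_nonneg (gaussKernel_pos hb _).le]
    exact gaussKernel_le hb _
  have h2 := congrArg ENNReal.ofReal h
  rw [ofReal_integral_eq_lintegral_ofReal hb1 (Filter.Eventually.of_forall fun ξ => by positivity),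
    ofReal_integral_eq_lintegral_ofReal hb2
      (Filter.Eventually.of_forall fun p => (gaussKernel_pos hb _).le)] at h2
  have hmeas := (continuous_gaussKernel (d := d) b).measurable
  rw [lintegral_prod _ (by fun_prop)] at h2
  simp only [lintegral_const, measure_univ, mul_one] at h2
  rw [lintegral_prod _ (by fun_prop)] at h2
  rw [← h2]
  refine lintegral_congr fun ξ => ?_
  rw [ENNReal.ofReal_mul (Real.exp_pos _).le, ENNReal.ofReal_pow (norm_nonneg _), ofReal_norm]

end gauss

section energy

variable {d : ℕ} {μ : Measure (EuclideanSpace ℝ (Fin d))}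

lemma exists_lintegral_exp_neg_sq_le {C₀ s : ℝ} (hC₀ : 0 ≤ C₀)
    (hμ : ∀ x r, 0 < r → μ (Metric.closedBall x r) ≤ ENNReal.ofReal (C₀ * r ^ s)) :
    ∃ K, 0 ≤ K ∧ ∀ x R, 0 < R →
      ∫⁻ y, ENNReal.ofReal (Real.exp (-(R * ‖x - y‖) ^ 2 / 4)) ∂μ ≤ ENNReal.ofReal (K * R ^ (-s)) := by
  have hsum : Summable fun m : ℕ => Real.exp (-(m : ℝ) / 4) * ((m : ℝ) + 1) ^ s := by
    have h1 := (summable_nat_add_iff 1).2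
      (Real.summable_pow_mul_exp_neg_nat_mul ⌈s⌉₊ (r := 1 / 4) (by norm_num))
    refine Summable.of_nonneg_of_le (fun m => by positivity) (fun m => ?_)
      (h1.mul_left (Real.exp (1 / 4)))
    have h2 : ((m : ℝ) + 1) ^ s ≤ ((m : ℝ) + 1) ^ ⌈s⌉₊ := by
      rw [← Real.rpow_natCast]
      exact Real.rpow_le_rpow_of_exponent_le (by linarith [m.cast_nonneg (α := ℝ)]) (Nat.le_ceil s)
    calc Real.exp (-(m : ℝ) / 4) * ((m : ℝ) + 1) ^ s
        ≤ Real.exp (-(m : ℝ) / 4) * ((m : ℝ) + 1) ^ ⌈s⌉₊ := by gcongr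
      _ = _ := by
        push_cast
        rw [mul_left_comm, ← Real.exp_add, mul_comm]
        congr 2; ring
  set S := ∑' m : ℕ, Real.exp (-(m : ℝ) / 4) * ((m : ℝ) + 1) ^ s
  have hS : 0 ≤ S := tsum_nonneg fun m => by positivity
  refine ⟨C₀ * S, by positivity, fun x R hR => ?_⟩
  calc ∫⁻ y, ENNReal.ofReal (Real.exp (-(R * ‖x - y‖) ^ 2 / 4)) ∂μ
      ≤ ∫⁻ y, ∑' m : ℕ, (Metric.closedBall x (((m : ℝ) + 1) / R)).indicator
          (fun _ => ENNReal.ofReal (Real.exp (-(m : ℝ) / 4))) y ∂μ := by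
        refine lintegral_mono fun y => ?_
        refine le_trans ?_ (ENNReal.le_tsum ⌊R * ‖x - y‖⌋₊)
        have h0 : 0 ≤ R * ‖x - y‖ := by positivity
        have h1 := Nat.floor_le h0
        have h2 := Nat.lt_floor_add_one (R * ‖x - y‖)
        rw [indicator_of_mem]
        · refine ENNReal.ofReal_le_ofReal (Real.exp_le_exp.2 ?_)
          have h3 : ((⌊R * ‖x - y‖⌋₊ : ℕ) : ℝ) ≤ ((⌊R * ‖x - y‖⌋₊ : ℕ) : ℝ) ^ 2 := by
            exact_mod_cast Nat.le_self_pow two_ne_zero _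
          have h4 : ((⌊R * ‖x - y‖⌋₊ : ℕ) : ℝ) ^ 2 ≤ (R * ‖x - y‖) ^ 2 := by gcongr
          linarith
        · rw [Metric.mem_closedBall, dist_comm, dist_eq_norm, le_div_iff₀' hR]
          exact h2.le
    _ = ∑' m : ℕ, ENNReal.ofReal (Real.exp (-(m : ℝ) / 4)) *
          μ (Metric.closedBall x (((m : ℝ) + 1) / R)) := by
        rw [lintegral_tsum fun m => (measurable_const.indicator
          Metric.isClosed_closedBall.measurableSet).aemeasurable]
        congr 1; ext m
        rw [lintegral_indicator_const Metric.isClosed_closedBall.measurableSet]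
    _ ≤ ∑' m : ℕ, ENNReal.ofReal (C₀ * R ^ (-s) * (Real.exp (-(m : ℝ) / 4) * ((m : ℝ) + 1) ^ s)) := by
        refine ENNReal.tsum_le_tsum fun m => ?_
        refine (mul_le_mul_right (hμ x (((m : ℝ) + 1) / R) (by positivity)) _).trans_eq ?_
        rw [← ENNReal.ofReal_mul (Real.exp_pos _).le, Real.div_rpow (by positivity) hR.le,
          Real.rpow_neg hR.le]
        congr 1
        field_simp
    _ = _ := by
        rw [← ENNReal.ofReal_tsum_of_nonneg (fun m => by positivity) (hsum.mul_left _), tsum_mul_left]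
        congr 1; simp only [S]; ring

lemma one_add_rpow_le_tsum {a : ℝ} (ha : 0 ≤ a) {r : ℝ} (hr : 0 ≤ r) :
    ENNReal.ofReal ((1 + r) ^ (-a)) ≤ ∑' j : ℕ, ENNReal.ofReal (Real.exp 4 * ((2 : ℝ) ^ j) ^ (-a)) *
      ENNReal.ofReal (Real.exp (-((4 : ℝ) ^ j)⁻¹ * r ^ 2)) := by
  obtain ⟨j, hj1, hj2⟩ := exists_nat_pow_near (x := 1 + r) (y := 2) (by linarith) (by norm_num)
  refine le_trans ?_ (ENNReal.le_tsum j)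
  rw [← ENNReal.ofReal_mul (by positivity)]
  refine ENNReal.ofReal_le_ofReal ?_
  have h1 : (1 + r) ^ (-a) ≤ ((2 : ℝ) ^ j) ^ (-a) :=
    Real.rpow_le_rpow_of_nonpos (by positivity) hj1 (by linarith)
  have h2 : ((4 : ℝ) ^ j)⁻¹ * r ^ 2 ≤ 4 := by
    rw [inv_mul_le_iff₀ (by positivity)]
    have : r ≤ 2 ^ (j + 1) := by linarith
    calc r ^ 2 ≤ (2 ^ (j + 1)) ^ 2 := by gcongr
      _ = 4 ^ j * 4 := by rw [← pow_mul, mul_comm (j + 1), pow_mul]; norm_num [pow_succ]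
  have h3 : 1 ≤ Real.exp 4 * Real.exp (-((4 : ℝ) ^ j)⁻¹ * r ^ 2) := by
    rw [← Real.exp_add]
    exact Real.one_le_exp (by linarith)
  calc (1 + r) ^ (-a) ≤ ((2 : ℝ) ^ j) ^ (-a) * 1 := by rw [mul_one]; exact h1
    _ ≤ ((2 : ℝ) ^ j) ^ (-a) * (Real.exp 4 * Real.exp (-((4 : ℝ) ^ j)⁻¹ * r ^ 2)) := by gcongr
    _ = _ := by ring

lemma exists_lintegral_charFun_restrict_le [IsFiniteMeasure μ] {C₀ s : ℝ} (hd : 1 ≤ d) (hC₀ : 0 ≤ C₀)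
    (hs : ((d : ℝ) + 1) / 2 < s)
    (hμ : ∀ x r, 0 < r → μ (Metric.closedBall x r) ≤ ENNReal.ofReal (C₀ * r ^ s)) :
    ∃ θ : ℝ, 0 < θ ∧ ∃ C : ℝ≥0∞, C ≠ ∞ ∧ ∀ B, MeasurableSet B →
      ∫⁻ ξ, ENNReal.ofReal ((1 + ‖ξ‖) ^ (-(((d : ℝ) - 1) / 2))) * ‖charFun (μ.restrict B) ξ‖ₑ ^ 2 ≤
        C * μ B ^ (1 + θ) := by
  have hs0 : 0 < s := by have := d.cast_nonneg (α := ℝ); linarith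
  obtain ⟨K, hK0, hK⟩ := exists_lintegral_exp_neg_sq_le hC₀ hμ
  set a : ℝ := ((d : ℝ) - 1) / 2 with ha
  have hd1 : (1 : ℝ) ≤ d := by exact_mod_cast hd
  have ha0 : 0 ≤ a := by rw [ha]; linarith
  set θ : ℝ := (s - ((d : ℝ) + 1) / 2) / (2 * s) with hθ
  have hθ0 : 0 < θ := div_pos (by linarith) (by linarith)
  have hθ1 : 0 < 1 - θ := by
    rw [hθ, sub_pos, div_lt_one (by linarith)]; linarith
  have hsθ : (d : ℝ) - a - s * (1 - θ) < 0 := by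
    have : s * θ = (s - ((d : ℝ) + 1) / 2) / 2 := by rw [hθ]; field_simp
    rw [mul_sub, this, ha]; linarith
  set ρ : ℝ := 2 ^ ((d : ℝ) - a - s * (1 - θ)) with hρ
  have hρ1 : ρ < 1 := Real.rpow_lt_one_of_one_lt_of_neg (by norm_num) hsθ
  have hρ0 : 0 < ρ := by positivity
  set M : ℝ := Real.exp 4 * Real.pi ^ ((d : ℝ) / 2) * K ^ (1 - θ)
  have hM : 0 ≤ M := by positivity
  refine ⟨θ, hθ0, ∑' j : ℕ, ENNReal.ofReal (M * ρ ^ j), ?_, fun B hB => ?_⟩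
  · rw [← ENNReal.ofReal_tsum_of_nonneg (fun j => by positivity)
      ((summable_geometric_of_lt_one hρ0.le hρ1).mul_left M)]
    exact ENNReal.ofReal_ne_top
  have hinner : ∀ (j : ℕ) (x : EuclideanSpace ℝ (Fin d)),
      ∫⁻ y in B, ENNReal.ofReal (gaussKernel ((4 : ℝ) ^ j)⁻¹ (x - y)) ∂μ ≤
        ENNReal.ofReal (Real.pi ^ ((d : ℝ) / 2) * ((2 : ℝ) ^ j) ^ (d : ℝ) *
          (K * ((2 : ℝ) ^ j) ^ (-s)) ^ (1 - θ)) * μ B ^ θ := by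
    intro j x
    have h2 : (4 : ℝ) ^ j = (2 ^ j) ^ 2 := by rw [← pow_mul, mul_comm, pow_mul]; norm_num
    have e : ∀ y : EuclideanSpace ℝ (Fin d), gaussKernel ((4 : ℝ) ^ j)⁻¹ (x - y) =
        Real.pi ^ ((d : ℝ) / 2) * ((2 : ℝ) ^ j) ^ (d : ℝ) *
          Real.exp (-(2 ^ j * ‖x - y‖) ^ 2 / 4) := by
      intro y
      rw [gaussKernel, div_inv_eq_mul, Real.mul_rpow Real.pi_pos.le (by positivity), h2,
        ← Real.rpow_natCast ((2 : ℝ) ^ j) 2, ← Real.rpow_mul (by positivity)]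
      congr 2
      · push_cast; ring_nf
      · rw [Real.rpow_natCast]; field_simp
    simp only [e]
    have e2 : ∀ y : EuclideanSpace ℝ (Fin d), ENNReal.ofReal (Real.pi ^ ((d : ℝ) / 2) *
        ((2 : ℝ) ^ j) ^ (d : ℝ) * Real.exp (-(2 ^ j * ‖x - y‖) ^ 2 / 4)) =
        ENNReal.ofReal (Real.pi ^ ((d : ℝ) / 2) * ((2 : ℝ) ^ j) ^ (d : ℝ)) *
          ENNReal.ofReal (Real.exp (-(2 ^ j * ‖x - y‖) ^ 2 / 4)) := fun y =>
      ENNReal.ofReal_mul (by positivity)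
    simp only [e2]
    rw [lintegral_const_mul' _ _ ENNReal.ofReal_ne_top,
      ENNReal.ofReal_mul (p := Real.pi ^ ((d : ℝ) / 2) * ((2 : ℝ) ^ j) ^ (d : ℝ)) (by positivity),
      mul_assoc]
    gcongr
    set I := ∫⁻ y in B, ENNReal.ofReal (Real.exp (-(2 ^ j * ‖x - y‖) ^ 2 / 4)) ∂μ
    have hI1 : I ≤ ENNReal.ofReal (K * ((2 : ℝ) ^ j) ^ (-s)) :=
      (setLIntegral_le_lintegral _ _).trans (hK x (2 ^ j) (by positivity))
    have hI2 : I ≤ μ B := by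
      calc I ≤ ∫⁻ y in B, 1 ∂μ := by
            refine lintegral_mono fun y => ?_
            rw [← ENNReal.ofReal_one]
            refine ENNReal.ofReal_le_ofReal (Real.exp_le_one_iff.2 ?_)
            rw [neg_div]
            exact neg_nonpos.2 (by positivity)
        _ = μ B := by simp
    calc I = I ^ (1 - θ) * I ^ θ := by
          rw [← ENNReal.rpow_add_of_nonneg _ _ hθ1.le hθ0.le, sub_add_cancel, ENNReal.rpow_one]
      _ ≤ ENNReal.ofReal (K * ((2 : ℝ) ^ j) ^ (-s)) ^ (1 - θ) * μ B ^ θ := by gcongr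
      _ = _ := by rw [ENNReal.ofReal_rpow_of_nonneg (by positivity) hθ1.le]
  have hterm : ∀ j : ℕ, ENNReal.ofReal (Real.exp 4 * ((2 : ℝ) ^ j) ^ (-a)) *
      ∫⁻ ξ, ENNReal.ofReal (Real.exp (-((4 : ℝ) ^ j)⁻¹ * ‖ξ‖ ^ 2)) * ‖charFun (μ.restrict B) ξ‖ₑ ^ 2 ≤
      ENNReal.ofReal (M * ρ ^ j) * μ B ^ (1 + θ) := by
    intro j
    rw [lintegral_exp_mul_enorm_charFun_sq _ (by positivity)]
    calc _ ≤ ENNReal.ofReal (Real.exp 4 * ((2 : ℝ) ^ j) ^ (-a)) * ∫⁻ _ in B,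
          (ENNReal.ofReal (Real.pi ^ ((d : ℝ) / 2) * ((2 : ℝ) ^ j) ^ (d : ℝ) *
          (K * ((2 : ℝ) ^ j) ^ (-s)) ^ (1 - θ)) * μ B ^ θ) ∂μ := by
          gcongr with x
          exact hinner j x
      _ = (ENNReal.ofReal (Real.exp 4 * ((2 : ℝ) ^ j) ^ (-a)) *
          ENNReal.ofReal (Real.pi ^ ((d : ℝ) / 2) * ((2 : ℝ) ^ j) ^ (d : ℝ) *
          (K * ((2 : ℝ) ^ j) ^ (-s)) ^ (1 - θ))) * (μ B ^ θ * μ B) := by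
          rw [lintegral_const, Measure.restrict_apply_univ]; ring
      _ = _ := by
          rw [← ENNReal.ofReal_mul (by positivity), add_comm 1 θ,
            ENNReal.rpow_add_of_nonneg _ _ hθ0.le zero_le_one, ENNReal.rpow_one]
          congr 2
          have e3 : ρ ^ j = ((2 : ℝ) ^ j) ^ (-a) * ((2 : ℝ) ^ j) ^ (d : ℝ) *
              ((2 : ℝ) ^ j) ^ (-s * (1 - θ)) := by
            rw [← Real.rpow_add (by positivity), ← Real.rpow_add (by positivity), hρ,
              ← Real.rpow_natCast, ← Real.rpow_natCast, ← Real.rpow_mul (by norm_num),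
              ← Real.rpow_mul (by norm_num)]
            congr 1; ring
          rw [Real.mul_rpow hK0 (by positivity), ← Real.rpow_mul (by positivity), e3]
          simp only [M]; ring
  have hmeas : Measurable fun ξ => ‖charFun (μ.restrict B) ξ‖ₑ ^ 2 := by
    have := measurable_charFun (μ := μ.restrict B); fun_prop
  calc _ ≤ ∫⁻ ξ, ∑' j : ℕ, ENNReal.ofReal (Real.exp 4 * ((2 : ℝ) ^ j) ^ (-a)) *
        (ENNReal.ofReal (Real.exp (-((4 : ℝ) ^ j)⁻¹ * ‖ξ‖ ^ 2)) *
          ‖charFun (μ.restrict B) ξ‖ₑ ^ 2) := by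
        refine lintegral_mono fun ξ => ?_
        simp only [← mul_assoc]
        rw [ENNReal.tsum_mul_right]
        gcongr
        exact one_add_rpow_le_tsum ha0 (norm_nonneg ξ)
    _ = ∑' j : ℕ, ENNReal.ofReal (Real.exp 4 * ((2 : ℝ) ^ j) ^ (-a)) *
        ∫⁻ ξ, (ENNReal.ofReal (Real.exp (-((4 : ℝ) ^ j)⁻¹ * ‖ξ‖ ^ 2)) *
          ‖charFun (μ.restrict B) ξ‖ₑ ^ 2) := by
        rw [lintegral_tsum fun j => by fun_prop]
        congr 1; ext j
        rw [lintegral_const_mul' _ _ ENNReal.ofReal_ne_top]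
    _ ≤ ∑' j : ℕ, ENNReal.ofReal (M * ρ ^ j) * μ B ^ (1 + θ) := ENNReal.tsum_le_tsum hterm
    _ = _ := ENNReal.tsum_mul_right

end energy

section sphericalEnergy

variable {d : ℕ} {σ μ : Measure (EuclideanSpace ℝ (Fin d))}

lemma one_add_mul_rpow_neg_le {a t r : ℝ} (ha : 0 ≤ a) (ht : 0 < t) (hr : 0 ≤ r) :
    (1 + t * r) ^ (-a) ≤ (1 + t ^ (-a)) * (1 + r) ^ (-a) := by
  have h1 : 0 ≤ (1 + r) ^ (-a) := by positivity
  have h2 : 0 ≤ t ^ (-a) := by positivity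
  rcases le_total 1 t with h | h
  · have : (1 + t * r) ^ (-a) ≤ (1 + r) ^ (-a) :=
      Real.rpow_le_rpow_of_nonpos (by positivity) (by nlinarith) (by linarith)
    nlinarith
  · have : (1 + t * r) ^ (-a) ≤ (t * (1 + r)) ^ (-a) :=
      Real.rpow_le_rpow_of_nonpos (by positivity) (by nlinarith) (by linarith)
    rw [Real.mul_rpow ht.le (by positivity)] at this
    nlinarith

lemma IsSphereMeasure.exists_charFun_smul_le (hσ : IsSphereMeasure σ) (hd : 2 ≤ d) :
    ∃ C, 0 < C ∧ ∀ t : ℝ, 0 < t → ∀ ξ, ‖charFun σ (t • ξ)‖ ≤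
      C * (1 + t ^ (-(((d : ℝ) - 1) / 2))) * (1 + ‖ξ‖) ^ (-(((d : ℝ) - 1) / 2)) := by
  obtain ⟨C, hC, h⟩ := hσ.exists_charFun_le hd
  have hd' : (2 : ℝ) ≤ d := by exact_mod_cast hd
  refine ⟨C, hC, fun t ht ξ => (h _).trans ?_⟩
  rw [mul_assoc, norm_smul, Real.norm_of_nonneg ht.le]
  gcongr
  exact one_add_mul_rpow_neg_le (by linarith) ht (norm_nonneg ξ)

lemma integrable_charFun_sq_mul_rpow [IsFiniteMeasure μ] {a : ℝ}
    (h : ∫⁻ ξ, ENNReal.ofReal ((1 + ‖ξ‖) ^ (-a)) * ‖charFun μ ξ‖ₑ ^ 2 ≠ ∞) :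
    Integrable fun ξ => ‖charFun μ ξ‖ ^ 2 * (1 + ‖ξ‖) ^ (-a) := by
  have hm := measurable_charFun (μ := μ)
  refine ⟨by fun_prop, ?_⟩
  rw [hasFiniteIntegral_iff_ofReal (Filter.Eventually.of_forall fun ξ => by positivity)]
  refine lt_of_eq_of_lt (lintegral_congr fun ξ => ?_) h.lt_top
  rw [ENNReal.ofReal_mul (by positivity), ENNReal.ofReal_pow (norm_nonneg _), ofReal_norm, mul_comm]

/-- `∫ |μ̂(ξ)|² σ̂(tξ) dξ`, the density of the distribution of distances of `μ` up to a power
of `t`, when `σ` is the surface measure of the unit sphere. -/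
noncomputable def sphericalEnergy (σ μ : Measure (EuclideanSpace ℝ (Fin d))) (t : ℝ) : ℂ :=
  ∫ ξ, ((‖charFun μ ξ‖ ^ 2 : ℝ) : ℂ) * charFun σ (t • ξ)

lemma IsSphereMeasure.continuousOn_sphericalEnergy (hσ : IsSphereMeasure σ) (hd : 2 ≤ d)
    [IsFiniteMeasure μ]
    (hint : Integrable fun ξ => ‖charFun μ ξ‖ ^ 2 * (1 + ‖ξ‖) ^ (-(((d : ℝ) - 1) / 2))) :
    ContinuousOn (sphericalEnergy σ μ) (Ioi 0) := by
  have := hσ.finite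
  have hμc := continuous_charFun (μ := μ)
  have hσc := continuous_charFun (μ := σ)
  obtain ⟨C, hC, h⟩ := hσ.exists_charFun_smul_le hd
  have hd' : (2 : ℝ) ≤ d := by exact_mod_cast hd
  set a := ((d : ℝ) - 1) / 2 with ha
  refine fun t ht => ContinuousAt.continuousWithinAt ?_
  rw [mem_Ioi] at ht
  refine continuousAt_of_dominated (bound := fun ξ => C * (1 + (t / 2) ^ (-a)) *
    (‖charFun μ ξ‖ ^ 2 * (1 + ‖ξ‖) ^ (-a))) ?_ ?_ (hint.const_mul _) ?_
  · exact Filter.Eventually.of_forall fun u => by fun_prop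
  · filter_upwards [lt_mem_nhds (half_lt_self ht)] with u hu
    refine Filter.Eventually.of_forall fun ξ => ?_
    rw [norm_mul, Complex.norm_real, norm_pow, norm_norm]
    have h1 : u ^ (-a) ≤ (t / 2) ^ (-a) :=
      Real.rpow_le_rpow_of_nonpos (by positivity) hu.le (by linarith)
    calc _ ≤ ‖charFun μ ξ‖ ^ 2 * (C * (1 + u ^ (-a)) * (1 + ‖ξ‖) ^ (-a)) := by
          gcongr
          exact h u (by linarith) ξ
      _ ≤ ‖charFun μ ξ‖ ^ 2 * (C * (1 + (t / 2) ^ (-a)) * (1 + ‖ξ‖) ^ (-a)) := by gcongr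
      _ = _ := by ring
  · exact Filter.Eventually.of_forall fun ξ => by fun_prop

lemma integral_charFun_smul_sphereMeasure [NeZero d] (ξ : EuclideanSpace ℝ (Fin d)) :
    ∫ t in Ioi (0 : ℝ), ((t ^ (d - 1) * Real.exp (-t ^ 2) : ℝ) : ℂ) *
      charFun (sphereMeasure d) (t • ξ) = (gaussKernel 1 ξ : ℂ) := by
  have h := integral_eq_integral_sphereMeasure
    (GaussianFourier.integrable_cexp_neg_mul_sq_norm_add (V := EuclideanSpace ℝ (Fin d))
    (b := 1) (by simp) Complex.I ξ)
  rw [GaussianFourier.integral_cexp_neg_mul_sq_norm_add (by simp)] at h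
  have e : (gaussKernel 1 ξ : ℂ) = (Real.pi / 1 : ℂ) ^
      ((Module.finrank ℝ (EuclideanSpace ℝ (Fin d)) : ℂ) / 2) *
      Complex.exp (Complex.I ^ 2 * ‖ξ‖ ^ 2 / (4 * 1)) := by
    rw [gaussKernel, Complex.ofReal_mul, Complex.ofReal_cpow (by positivity),
      finrank_euclideanSpace_fin]
    congr 1
    · push_cast; rfl
    · rw [Complex.ofReal_exp]; congr 1; push_cast; rw [Complex.I_sq]; ring
  rw [e, h]
  refine setIntegral_congr_fun measurableSet_Ioi fun t ht => ?_
  have hn : ∀ᵐ x ∂sphereMeasure d, Complex.exp (-1 * ‖t • x‖ ^ 2 + Complex.I * inner ℝ ξ (t • x)) =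
      Complex.exp (-(t : ℂ) ^ 2) * Complex.exp (inner ℝ x (t • ξ) * Complex.I) := by
    filter_upwards [(isSphereMeasure_sphereMeasure d).ae_norm] with x hx
    rw [← Complex.exp_add, norm_smul, hx, mul_one, ← Complex.ofReal_pow, Real.norm_eq_abs, sq_abs,
      inner_smul_right, inner_smul_right, real_inner_comm]
    congr 1; push_cast; ring
  rw [integral_congr_ae hn, integral_const_mul, charFun_apply]
  push_cast
  ring

lemma exists_sphericalEnergy_re_pos (hd : 2 ≤ d) [IsFiniteMeasure μ] (hμ : μ ≠ 0)
    (hint : Integrable fun ξ => ‖charFun μ ξ‖ ^ 2 * (1 + ‖ξ‖) ^ (-(((d : ℝ) - 1) / 2))) :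
    ∃ t, 0 < t ∧ 0 < (sphericalEnergy (sphereMeasure d) μ t).re := by
  have hσ := isSphereMeasure_sphereMeasure d
  have := hσ.finite
  have : NeZero d := ⟨by omega⟩
  have hμc := continuous_charFun (μ := μ)
  have hσc := continuous_charFun (μ := sphereMeasure d)
  obtain ⟨C, hC, h⟩ := hσ.exists_charFun_smul_le hd
  have hd' : (2 : ℝ) ≤ d := by exact_mod_cast hd
  set a := ((d : ℝ) - 1) / 2 with ha
  set w : ℝ → ℝ := fun t => t ^ (d - 1) * Real.exp (-t ^ 2) with hw
  have hw0 : ∀ t, 0 < t → 0 ≤ w t := fun t ht => by positivity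
  have hwint : IntegrableOn (fun t => w t * (1 + t ^ (-a))) (Ioi 0) := by
    have h1 := integrableOn_rpow_mul_exp_neg_mul_sq (b := 1) one_pos (s := (d : ℝ) - 1) (by linarith)
    have h2 := integrableOn_rpow_mul_exp_neg_mul_sq (b := 1) one_pos (s := a) (by linarith)
    refine (h1.add h2).congr_fun (fun t ht => ?_) measurableSet_Ioi
    rw [mem_Ioi] at ht
    have e1 : t ^ (d - 1) = t ^ ((d : ℝ) - 1) := by
      rw [← Real.rpow_natCast, Nat.cast_sub (by omega), Nat.cast_one]
    have e2 : t ^ a = t ^ ((d : ℝ) - 1) * t ^ (-a) := by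
      rw [← Real.rpow_add ht]; congr 1; rw [ha]; ring
    simp only [Pi.add_apply, hw, e1, e2, neg_mul, one_mul]
    ring
  have hprod : Integrable (fun p : ℝ × EuclideanSpace ℝ (Fin d) => (w p.1 : ℂ) *
      (((‖charFun μ p.2‖ ^ 2 : ℝ) : ℂ) * charFun (sphereMeasure d) (p.1 • p.2)))
      ((volume.restrict (Ioi 0)).prod volume) := by
    refine (((hwint.integrable).mul_prod hint).const_mul C).mono
      (Continuous.aestronglyMeasurable (by fun_prop)) ?_
    have h0 : ∀ᵐ p ∂((volume.restrict (Ioi (0 : ℝ))).prod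
        (volume : Measure (EuclideanSpace ℝ (Fin d)))), p.1 ∈ Ioi (0 : ℝ) :=
      Measure.quasiMeasurePreserving_fst.ae (ae_restrict_mem measurableSet_Ioi)
    filter_upwards [h0] with p hp
    rw [mem_Ioi] at hp
    have hp1 := hw0 p.1 hp
    rw [norm_mul, norm_mul, Complex.norm_real, Complex.norm_real, Real.norm_of_nonneg hp1,
      norm_pow, norm_norm]
    refine le_trans ?_ (Real.le_norm_self _)
    calc w p.1 * (‖charFun μ p.2‖ ^ 2 * ‖charFun (sphereMeasure d) (p.1 • p.2)‖)
        ≤ w p.1 * (‖charFun μ p.2‖ ^ 2 * (C * (1 + p.1 ^ (-a)) * (1 + ‖p.2‖) ^ (-a))) := by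
          gcongr
          exact h _ hp _
      _ = _ := by ring
  have hswap := integral_integral_swap (f := fun (t : ℝ) (ξ : EuclideanSpace ℝ (Fin d)) =>
    (w t : ℂ) * (((‖charFun μ ξ‖ ^ 2 : ℝ) : ℂ) * charFun (sphereMeasure d) (t • ξ))) hprod
  have hleft := hprod.integral_prod_left
  simp only [integral_const_mul] at hswap hleft
  have e : ∀ ξ : EuclideanSpace ℝ (Fin d), ∫ t in Ioi (0 : ℝ), (w t : ℂ) *
      (((‖charFun μ ξ‖ ^ 2 : ℝ) : ℂ) * charFun (sphereMeasure d) (t • ξ)) =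
      ((‖charFun μ ξ‖ ^ 2 * gaussKernel 1 ξ : ℝ) : ℂ) := by
    intro ξ
    rw [Complex.ofReal_mul, ← integral_charFun_smul_sphereMeasure, ← integral_const_mul]
    congr 1; ext t; ring
  simp only [e, integral_complex_ofReal] at hswap
  have hpos : 0 < ∫ ξ, ‖charFun μ ξ‖ ^ 2 * gaussKernel 1 ξ := by
    have hgc := continuous_gaussKernel (d := d) 1
    refine integral_pos_of_integrable_nonneg_nonzero (x := 0) (by fun_prop) ?_
      (fun ξ => mul_nonneg (by positivity) (gaussKernel_pos one_pos ξ).le) ?_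
    · have := hprod.integral_prod_right
      simp only [e] at this
      simpa only [RCLike.re_eq_complex_re, Complex.ofReal_re] using this.re
    · have : μ.real univ ≠ 0 := by simpa [measureReal_eq_zero_iff] using hμ
      simpa [charFun_zero] using ⟨this, (gaussKernel_pos (d := d) one_pos 0).ne'⟩
  by_contra! hcon
  have hre : (∫ t in Ioi (0 : ℝ), (w t : ℂ) * sphericalEnergy (sphereMeasure d) μ t).re ≤ 0 := by
    have := integral_re (μ := volume.restrict (Ioi (0 : ℝ))) (𝕜 := ℂ) hleft
    simp only [RCLike.re_eq_complex_re] at this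
    simp only [sphericalEnergy]
    rw [← this]
    refine setIntegral_nonpos measurableSet_Ioi fun t ht => ?_
    rw [Complex.re_ofReal_mul]
    exact mul_nonpos_of_nonneg_of_nonpos (hw0 t ht) (hcon t ht)
  rw [show (∫ t in Ioi (0 : ℝ), (w t : ℂ) * sphericalEnergy (sphereMeasure d) μ t) = _ from hswap,
    Complex.ofReal_re] at hre
  exact hre.not_gt hpos

lemma exists_Ioo_sphericalEnergy_re_pos (hd : 2 ≤ d) [IsFiniteMeasure μ] (hμ : μ ≠ 0)
    (hint : Integrable fun ξ => ‖charFun μ ξ‖ ^ 2 * (1 + ‖ξ‖) ^ (-(((d : ℝ) - 1) / 2))) :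
    ∃ a b, 0 ≤ a ∧ a < b ∧
      ∀ t ∈ Ioo a b, 0 < (sphericalEnergy (sphereMeasure d) μ t).re := by
  obtain ⟨t, ht, hpos⟩ := exists_sphericalEnergy_re_pos hd hμ hint
  have hc := ((isSphereMeasure_sphereMeasure d).continuousOn_sphericalEnergy hd hint).continuousAt
    (Ioi_mem_nhds ht)
  have h1 := (Complex.continuous_re.continuousAt.comp hc).eventually (lt_mem_nhds hpos)
  obtain ⟨a, b, ⟨hat, htb⟩, hab⟩ := mem_nhds_iff_exists_Ioo_subset.1 h1
  exact ⟨max a 0, b, le_max_right _ _, max_lt (hat.trans htb) (ht.trans htb),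
    fun u hu => hab ⟨(le_max_left _ _).trans_lt hu.1, hu.2⟩⟩

end sphericalEnergy

section edgeMeasure

open Filter Topology

variable {d : ℕ} {σ μ : Measure (EuclideanSpace ℝ (Fin d))}

/-- A smoothing at scale `√b` of the natural measure on the pairs of points of `μ` at distance
`t`. -/
noncomputable def edgeMeasure (σ μ : Measure (EuclideanSpace ℝ (Fin d))) (t b : ℝ) :
    Measure (EuclideanSpace ℝ (Fin d) × EuclideanSpace ℝ (Fin d)) :=
  (((μ.prod μ).prod σ).withDensity
    fun p => ENNReal.ofReal (gaussKernel b (p.1.1 - p.1.2 + t • p.2))).map Prod.fst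

lemma edgeMeasure_apply {t b : ℝ}
    {S : Set (EuclideanSpace ℝ (Fin d) × EuclideanSpace ℝ (Fin d))} (hS : MeasurableSet S) :
    edgeMeasure σ μ t b S = ∫⁻ p in Prod.fst ⁻¹' S,
      ENNReal.ofReal (gaussKernel b (p.1.1 - p.1.2 + t • p.2)) ∂((μ.prod μ).prod σ) := by
  rw [edgeMeasure, Measure.map_apply measurable_fst hS, withDensity_apply _ (measurable_fst hS)]

lemma edgeMeasure_prod [IsFiniteMeasure μ] [IsFiniteMeasure σ] {t b : ℝ} (hb : 0 < b)
    {A B : Set (EuclideanSpace ℝ (Fin d))} (hA : MeasurableSet A) (hB : MeasurableSet B) :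
    edgeMeasure σ μ t b (A ×ˢ B) = ‖∫ ξ, (Real.exp (-b * ‖ξ‖ ^ 2) : ℂ) *
      (charFun (μ.restrict A) ξ * charFun (μ.restrict B) (-ξ) * charFun σ (t • ξ))‖ₑ := by
  have hg := continuous_gaussKernel (d := d) b
  rw [integral_exp_mul_charFun_mul _ _ _ hb, edgeMeasure_apply (hA.prod hB), ← prod_univ,
    ← Measure.prod_restrict, ← Measure.prod_restrict, Measure.restrict_univ,
    ← ofReal_integral_eq_lintegral_ofReal]
  · rw [← ofReal_norm, Complex.norm_real, Real.norm_of_nonneg]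
    exact integral_nonneg fun p => (gaussKernel_pos hb _).le
  · refine Integrable.of_bound (by fun_prop) ((Real.pi / b) ^ ((d : ℝ) / 2))
      (Eventually.of_forall fun p => ?_)
    rw [Real.norm_of_nonneg (gaussKernel_pos hb _).le]
    exact gaussKernel_le hb _
  · exact Eventually.of_forall fun p => (gaussKernel_pos hb _).le

lemma edgeMeasure_prod_le [IsFiniteMeasure μ] [IsFiniteMeasure σ] {t b a D θ : ℝ} {C : ℝ≥0∞}
    (hb : 0 < b) (hθ : 0 < θ) (hσ : ∀ ξ, ‖charFun σ (t • ξ)‖ ≤ D * (1 + ‖ξ‖) ^ (-a))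
    (hμ : ∀ B, MeasurableSet B → ∫⁻ ξ, ENNReal.ofReal ((1 + ‖ξ‖) ^ (-a)) *
      ‖charFun (μ.restrict B) ξ‖ₑ ^ 2 ≤ C * μ B ^ (1 + θ))
    {A B : Set (EuclideanSpace ℝ (Fin d))} (hA : MeasurableSet A) (hB : MeasurableSet B) :
    edgeMeasure σ μ t b (A ×ˢ B) ≤ ENNReal.ofReal D * C * (μ A * μ B) ^ ((1 + θ) / 2) := by
  have hAm := measurable_charFun (μ := μ.restrict A)
  have hBm := measurable_charFun (μ := μ.restrict B)
  set W : Measure (EuclideanSpace ℝ (Fin d)) :=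
    volume.withDensity fun ξ => ENNReal.ofReal ((1 + ‖ξ‖) ^ (-a))
  have hW : ∀ f : EuclideanSpace ℝ (Fin d) → ℝ≥0∞, Measurable f →
      ∫⁻ ξ, f ξ ∂W = ∫⁻ ξ, ENNReal.ofReal ((1 + ‖ξ‖) ^ (-a)) * f ξ := fun f hf =>
    lintegral_withDensity_eq_lintegral_mul _ (by fun_prop) hf
  rw [edgeMeasure_prod hb hA hB]
  calc _ ≤ ∫⁻ ξ, ENNReal.ofReal D * (ENNReal.ofReal ((1 + ‖ξ‖) ^ (-a)) *
        (‖charFun (μ.restrict A) ξ‖ₑ * ‖charFun (μ.restrict B) ξ‖ₑ)) := by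
        refine (enorm_integral_le_lintegral_enorm _).trans (lintegral_mono fun ξ => ?_)
        have h1 : ‖(Real.exp (-b * ‖ξ‖ ^ 2) : ℂ)‖ₑ ≤ 1 := by
          rw [← ofReal_norm, Complex.norm_real, Real.norm_of_nonneg (Real.exp_pos _).le,
            ENNReal.ofReal_le_one, Real.exp_le_one_iff, neg_mul, neg_nonpos]
          positivity
        have h2 : ‖charFun (μ.restrict B) (-ξ)‖ₑ = ‖charFun (μ.restrict B) ξ‖ₑ := by
          rw [charFun_neg, ← ofReal_norm, RCLike.norm_conj, ofReal_norm]
        have h3 : ‖charFun σ (t • ξ)‖ₑ ≤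
            ENNReal.ofReal D * ENNReal.ofReal ((1 + ‖ξ‖) ^ (-a)) := by
          rw [← ofReal_norm, ← ENNReal.ofReal_mul' (by positivity)]
          exact ENNReal.ofReal_le_ofReal (hσ ξ)
        rw [enorm_mul, enorm_mul, enorm_mul, h2]
        calc _ ≤ 1 * (‖charFun (μ.restrict A) ξ‖ₑ * ‖charFun (μ.restrict B) ξ‖ₑ *
              (ENNReal.ofReal D * ENNReal.ofReal ((1 + ‖ξ‖) ^ (-a)))) := by gcongr
          _ = _ := by ring
    _ = ENNReal.ofReal D * ∫⁻ ξ, ((fun ξ => ‖charFun (μ.restrict A) ξ‖ₑ) *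
          fun ξ => ‖charFun (μ.restrict B) ξ‖ₑ) ξ ∂W := by
        rw [lintegral_const_mul' _ _ ENNReal.ofReal_ne_top, hW _ (by fun_prop)]
        rfl
    _ ≤ ENNReal.ofReal D * ((∫⁻ ξ, ‖charFun (μ.restrict A) ξ‖ₑ ^ (2 : ℝ) ∂W) ^ (1 / 2 : ℝ) *
          (∫⁻ ξ, ‖charFun (μ.restrict B) ξ‖ₑ ^ (2 : ℝ) ∂W) ^ (1 / 2 : ℝ)) := by
        gcongr
        exact ENNReal.lintegral_mul_le_Lp_mul_Lq _ Real.HolderConjugate.two_two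
          (by fun_prop) (by fun_prop)
    _ ≤ ENNReal.ofReal D * ((C * μ A ^ (1 + θ)) ^ (1 / 2 : ℝ) *
          (C * μ B ^ (1 + θ)) ^ (1 / 2 : ℝ)) := by
        simp only [ENNReal.rpow_two]
        rw [hW _ (by fun_prop), hW _ (by fun_prop)]
        gcongr
        · exact hμ A hA
        · exact hμ B hB
    _ = _ := by
        have e : (C * C) ^ (1 / 2 : ℝ) = C := by
          rw [← sq, ← ENNReal.rpow_two, ← ENNReal.rpow_mul]; norm_num
        rw [← ENNReal.mul_rpow_of_nonneg _ _ (by norm_num), mul_mul_mul_comm,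
          ← ENNReal.mul_rpow_of_nonneg _ _ (by linarith : 0 ≤ 1 + θ),
          ENNReal.mul_rpow_of_nonneg _ _ (by norm_num), e, ← ENNReal.rpow_mul, mul_assoc,
          mul_one_div]

lemma tendsto_edgeMeasure_univ [IsFiniteMeasure μ] [IsFiniteMeasure σ] {t a D : ℝ}
    (hσ : ∀ ξ, ‖charFun σ (t • ξ)‖ ≤ D * (1 + ‖ξ‖) ^ (-a))
    (hint : Integrable fun ξ => ‖charFun μ ξ‖ ^ 2 * (1 + ‖ξ‖) ^ (-a)) :
    Tendsto (fun b => edgeMeasure σ μ t b univ) (𝓝[>] 0) (𝓝 ‖sphericalEnergy σ μ t‖ₑ) := by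
  have hμc := continuous_charFun (μ := μ)
  have hσc := continuous_charFun (μ := σ)
  have e : ∀ ξ, charFun μ ξ * charFun μ (-ξ) = ((‖charFun μ ξ‖ ^ 2 : ℝ) : ℂ) := fun ξ => by
    rw [charFun_neg, Complex.mul_conj, Complex.normSq_eq_norm_sq]
  have h : Tendsto (fun b => ∫ ξ, (Real.exp (-b * ‖ξ‖ ^ 2) : ℂ) *
      (charFun μ ξ * charFun μ (-ξ) * charFun σ (t • ξ))) (𝓝[>] (0 : ℝ))
      (𝓝 (sphericalEnergy σ μ t)) := by
    refine tendsto_integral_filter_of_dominated_convergence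
      (fun ξ => D * (‖charFun μ ξ‖ ^ 2 * (1 + ‖ξ‖) ^ (-a)))
      (Eventually.of_forall fun b => by fun_prop) ?_ (hint.const_mul D)
      (Eventually.of_forall fun ξ => ?_)
    · filter_upwards [self_mem_nhdsWithin] with b hb
      rw [mem_Ioi] at hb
      refine Eventually.of_forall fun ξ => ?_
      rw [e, norm_mul, norm_mul, Complex.norm_real, Complex.norm_real, norm_pow, norm_norm,
        Real.norm_of_nonneg (Real.exp_pos _).le]
      have h1 : Real.exp (-b * ‖ξ‖ ^ 2) ≤ 1 := by
        rw [Real.exp_le_one_iff, neg_mul, neg_nonpos]; positivity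
      calc _ ≤ 1 * (‖charFun μ ξ‖ ^ 2 * (D * (1 + ‖ξ‖) ^ (-a))) := by
            gcongr
            exact hσ ξ
        _ = _ := by ring
    · have h1 : Continuous fun b : ℝ => (Real.exp (-b * ‖ξ‖ ^ 2) : ℂ) *
          (charFun μ ξ * charFun μ (-ξ) * charFun σ (t • ξ)) := by fun_prop
      have h2 := (h1.tendsto 0).mono_left (nhdsWithin_le_nhds (s := Ioi 0))
      rw [e] at h2 ⊢
      simpa using h2
  refine (h.enorm).congr' ?_
  filter_upwards [self_mem_nhdsWithin] with b hb
  rw [← univ_prod_univ, edgeMeasure_prod hb MeasurableSet.univ MeasurableSet.univ,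
    Measure.restrict_univ]

lemma tendsto_edgeMeasure_dist [IsFiniteMeasure μ] [IsFiniteMeasure σ]
    (hσ : ∀ᵐ x ∂σ, ‖x‖ = 1) {t δ : ℝ} (ht : 0 < t) (hδ : 0 < δ) :
    Tendsto (fun b => edgeMeasure σ μ t b {p | δ < |dist p.1 p.2 - t|}) (𝓝[>] 0) (𝓝 0) := by
  have hreal : Tendsto (fun b : ℝ => (Real.pi / b) ^ ((d : ℝ) / 2) * Real.exp (-δ ^ 2 / (4 * b)))
      (𝓝[>] 0) (𝓝 0) := by
    have h1 := (tendsto_rpow_mul_exp_neg_mul_atTop_nhds_zero ((d : ℝ) / 2) (δ ^ 2 / 4)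
      (by positivity)).comp tendsto_inv_nhdsGT_zero
    have h2 := h1.const_mul (Real.pi ^ ((d : ℝ) / 2))
    rw [mul_zero] at h2
    refine h2.congr' ?_
    filter_upwards [self_mem_nhdsWithin] with b hb
    rw [mem_Ioi] at hb
    rw [Function.comp, div_eq_mul_inv Real.pi, Real.mul_rpow Real.pi_pos.le (by positivity), mul_assoc]
    congr 3
    field_simp
  have hlim := ENNReal.Tendsto.mul_const (b := ((μ.prod μ).prod σ) univ)
    (ENNReal.tendsto_ofReal hreal) (Or.inr (measure_ne_top _ _))
  rw [ENNReal.ofReal_zero, zero_mul] at hlim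
  refine tendsto_of_tendsto_of_tendsto_of_le_of_le' tendsto_const_nhds hlim
    (Eventually.of_forall fun b => zero_le) ?_
  filter_upwards [self_mem_nhdsWithin] with b hb
  rw [mem_Ioi] at hb
  have hS : MeasurableSet {p : EuclideanSpace ℝ (Fin d) × EuclideanSpace ℝ (Fin d) |
      δ < |dist p.1 p.2 - t|} := measurableSet_lt (by fun_prop) (by fun_prop)
  rw [edgeMeasure_apply hS]
  calc _ ≤ ∫⁻ _ in Prod.fst ⁻¹' {p | δ < |dist p.1 p.2 - t|}, ENNReal.ofReal
        ((Real.pi / b) ^ ((d : ℝ) / 2) * Real.exp (-δ ^ 2 / (4 * b))) ∂((μ.prod μ).prod σ) := by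
        refine lintegral_mono_ae ?_
        have h0 : ∀ᵐ p ∂((μ.prod μ).prod σ), ‖p.2‖ = 1 :=
          Measure.quasiMeasurePreserving_snd.ae hσ
        filter_upwards [ae_restrict_of_ae h0, ae_restrict_mem (measurable_fst hS)] with p hp1 hp2
        have h1 : δ < |dist p.1.1 p.1.2 - t| := hp2
        have h2 : |dist p.1.1 p.1.2 - t| ≤ ‖p.1.1 - p.1.2 + t • p.2‖ := by
          have := abs_norm_sub_norm_le (p.1.1 - p.1.2) (-(t • p.2))
          rwa [norm_neg, norm_smul, hp1, mul_one, Real.norm_of_nonneg ht.le, sub_neg_eq_add,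
            ← dist_eq_norm] at this
        refine ENNReal.ofReal_le_ofReal ?_
        rw [gaussKernel]
        gcongr
        exact h1.le.trans h2
    _ ≤ _ := by
        rw [setLIntegral_const]
        gcongr
        exact subset_univ _

lemma tendsto_measure_univ {Ω ι : Type*} [MeasurableSpace Ω] [TopologicalSpace Ω]
    [OpensMeasurableSpace Ω] {L : Filter ι} {ν : FiniteMeasure Ω} {νs : ι → FiniteMeasure Ω}
    (h : Tendsto νs L (𝓝 ν)) :
    Tendsto (fun i => (νs i : Measure Ω) univ) L (𝓝 ((ν : Measure Ω) univ)) := by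
  simpa [Function.comp_def] using (ENNReal.continuous_coe.tendsto _).comp
    ((FiniteMeasure.continuous_mass.tendsto ν).comp h)

lemma measure_le_of_tendsto_of_isOpen {Ω ι : Type*} [MeasurableSpace Ω] [TopologicalSpace Ω]
    [HasOuterApproxClosed Ω] [OpensMeasurableSpace Ω] {L : Filter ι} [L.NeBot]
    {ν : FiniteMeasure Ω} {νs : ι → FiniteMeasure Ω} (h : Tendsto νs L (𝓝 ν)) {G : Set Ω}
    (hG : IsOpen G) {c : ℝ≥0∞} (hc : ∀ᶠ i in L, (νs i : Measure Ω) G ≤ c) :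
    (ν : Measure Ω) G ≤ c := by
  rcases eq_or_ne c ∞ with rfl | hc'
  · exact le_top
  have h1 := FiniteMeasure.limsup_measure_closed_le_of_tendsto h hG.isClosed_compl
  have hmass := tendsto_measure_univ h
  have h2 : (ν : Measure Ω) univ - c ≤ (ν : Measure Ω) Gᶜ := by
    refine le_trans ?_ h1
    rw [← (ENNReal.Tendsto.sub hmass tendsto_const_nhds (Or.inr hc')).limsup_eq]
    refine limsup_le_limsup ?_
    filter_upwards [hc] with i hi
    rw [tsub_le_iff_left, ← measure_add_measure_compl hG.measurableSet]
    gcongr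
  rw [tsub_le_iff_left, ← measure_add_measure_compl hG.measurableSet] at h2
  exact (ENNReal.add_le_add_iff_right (measure_ne_top _ _)).1 h2

lemma measure_prod_le_rpow_of_isOpen {X : Type*} [MeasurableSpace X] [TopologicalSpace X]
    {μ : Measure X} [IsFiniteMeasure μ] [μ.OuterRegular] {Γ : Measure (X × X)} {M : ℝ≥0∞} {q : ℝ}
    (hM : M ≠ ∞) (hq : 0 < q)
    (h : ∀ U V, IsOpen U → IsOpen V → Γ (U ×ˢ V) ≤ M * (μ U * μ V) ^ q) (A B : Set X) :
    Γ (A ×ˢ B) ≤ M * (μ A * μ B) ^ q := by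
  have hε : ∀ n : ℕ, (((n : ℝ≥0∞) + 1)⁻¹) ≠ 0 := fun n => by simp
  choose U hAU hUo hU using fun n : ℕ => A.exists_isOpen_le_add μ (hε n)
  choose V hBV hVo hV using fun n : ℕ => B.exists_isOpen_le_add μ (hε n)
  have hlim : ∀ S : Set X, Tendsto (fun n : ℕ => μ S + ((n : ℝ≥0∞) + 1)⁻¹) atTop (𝓝 (μ S)) := by
    intro S
    have := ENNReal.tendsto_inv_nat_nhds_zero.comp (tendsto_add_atTop_nat 1)
    simpa [Function.comp_def] using this.const_add (μ S)
  have h1 : Tendsto (fun n : ℕ => M * ((μ A + ((n : ℝ≥0∞) + 1)⁻¹) *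
      (μ B + ((n : ℝ≥0∞) + 1)⁻¹)) ^ q) atTop (𝓝 (M * (μ A * μ B) ^ q)) :=
    ENNReal.Tendsto.const_mul (((ENNReal.continuous_rpow_const).tendsto _).comp
      (ENNReal.Tendsto.mul (hlim A) (Or.inr (measure_ne_top _ _)) (hlim B)
        (Or.inr (measure_ne_top _ _)))) (Or.inr hM)
  refine ge_of_tendsto' h1 fun n => ?_
  calc Γ (A ×ˢ B) ≤ Γ (U n ×ˢ V n) := measure_mono (prod_mono (hAU n) (hBV n))
    _ ≤ M * (μ (U n) * μ (V n)) ^ q := h _ _ (hUo n) (hVo n)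
    _ ≤ _ := by
      gcongr
      · exact hU n
      · exact hV n

lemma exists_measure_dist_eq [IsFiniteMeasure μ] [IsFiniteMeasure σ] {t a D θ : ℝ} {C : ℝ≥0∞}
    {E : Set (EuclideanSpace ℝ (Fin d))} (hE : IsCompact E) (hμE : μ Eᶜ = 0) (ht : 0 < t)
    (hσ1 : ∀ᵐ x ∂σ, ‖x‖ = 1) (hσ : ∀ ξ, ‖charFun σ (t • ξ)‖ ≤ D * (1 + ‖ξ‖) ^ (-a))
    (hθ : 0 < θ) (hC : C ≠ ∞)
    (hμ : ∀ B, MeasurableSet B → ∫⁻ ξ, ENNReal.ofReal ((1 + ‖ξ‖) ^ (-a)) *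
      ‖charFun (μ.restrict B) ξ‖ₑ ^ 2 ≤ C * μ B ^ (1 + θ))
    (hint : Integrable fun ξ => ‖charFun μ ξ‖ ^ 2 * (1 + ‖ξ‖) ^ (-a))
    (hne : sphericalEnergy σ μ t ≠ 0) :
    ∃ Γ : Measure (EuclideanSpace ℝ (Fin d) × EuclideanSpace ℝ (Fin d)), IsFiniteMeasure Γ ∧
      Γ ≠ 0 ∧ (∀ᵐ p ∂Γ, p.1 ∈ E ∧ p.2 ∈ E ∧ dist p.1 p.2 = t) ∧
      ∀ A B, Γ (A ×ˢ B) ≤ ENNReal.ofReal D * C * (μ A * μ B) ^ ((1 + θ) / 2) := by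
  set M := ENNReal.ofReal D * C with hM
  have hMtop : M ≠ ∞ := ENNReal.mul_ne_top ENNReal.ofReal_ne_top hC
  have hq : 0 < (1 + θ) / 2 := by linarith
  set m := M * (μ univ * μ univ) ^ ((1 + θ) / 2) with hm
  have hmtop : m ≠ ∞ := ENNReal.mul_ne_top hMtop (ENNReal.rpow_ne_top_of_nonneg hq.le
    (ENNReal.mul_ne_top (measure_ne_top _ _) (measure_ne_top _ _)))
  let b : ℕ → ℝ := fun n => 1 / ((n : ℝ) + 1)
  have hb0 : ∀ n, 0 < b n := fun n => by positivity
  have hb : Tendsto b atTop (𝓝[>] 0) := tendsto_nhdsWithin_iff.2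
    ⟨tendsto_one_div_add_atTop_nhds_zero_nat, Eventually.of_forall hb0⟩
  have hle : ∀ n A B, MeasurableSet A → MeasurableSet B →
      edgeMeasure σ μ t (b n) (A ×ˢ B) ≤ M * (μ A * μ B) ^ ((1 + θ) / 2) :=
    fun n A B hA hB => edgeMeasure_prod_le (hb0 n) hθ hσ hμ hA hB
  have huniv : ∀ n, edgeMeasure σ μ t (b n) univ ≤ m := fun n => by
    rw [← univ_prod_univ]; exact hle n _ _ MeasurableSet.univ MeasurableSet.univ
  have hfin : ∀ n, IsFiniteMeasure (edgeMeasure σ μ t (b n)) := fun n =>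
    ⟨(huniv n).trans_lt hmtop.lt_top⟩
  let ν : ℕ → FiniteMeasure (EuclideanSpace ℝ (Fin d) × EuclideanSpace ℝ (Fin d)) :=
    fun n => ⟨edgeMeasure σ μ t (b n), hfin n⟩
  let L : Ultrafilter ℕ := Ultrafilter.of atTop
  have hL : (L : Filter ℕ) ≤ atTop := Ultrafilter.of_le _
  have hcompl : (E ×ˢ E)ᶜ = Eᶜ ×ˢ univ ∪ univ ×ˢ Eᶜ := by
    ext p; simp only [mem_compl_iff, mem_prod, mem_union, mem_univ, and_true, true_and]; tauto
  have hsupp : ∀ Γ : Measure (EuclideanSpace ℝ (Fin d) × EuclideanSpace ℝ (Fin d)),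
      (∀ A B, MeasurableSet A → MeasurableSet B → Γ (A ×ˢ B) ≤ M * (μ A * μ B) ^ ((1 + θ) / 2)) →
      Γ (E ×ˢ E)ᶜ = 0 := by
    intro Γ hΓ
    have h1 := hΓ _ _ hE.measurableSet.compl MeasurableSet.univ
    have h2 := hΓ _ _ MeasurableSet.univ hE.measurableSet.compl
    rw [hμE, zero_mul, ENNReal.zero_rpow_of_pos hq, mul_zero] at h1
    rw [hμE, mul_zero, ENNReal.zero_rpow_of_pos hq, mul_zero] at h2
    rw [hcompl]
    exact measure_union_null (nonpos_iff_eq_zero.1 h1) (nonpos_iff_eq_zero.1 h2)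
  obtain ⟨Γ, -, hΓ⟩ := (isCompact_setOfPred_finiteMeasure_le_of_isCompact m.toNNReal
    (hE.prod hE)).ultrafilter_le_nhds' (L.map ν) (Ultrafilter.mem_map.2 (univ_mem' fun n => by
      refine ⟨?_, ?_⟩
      · rw [← ENNReal.coe_le_coe, ENNReal.coe_toNNReal hmtop, FiniteMeasure.ennreal_mass]
        exact huniv n
      · rw [FiniteMeasure.null_iff_toMeasure_null]
        exact hsupp _ (hle n)))
  have hΓ : Tendsto ν L (𝓝 Γ) := hΓ
  have hΓle := measure_prod_le_rpow_of_isOpen hMtop hq fun U V hU hV =>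
    measure_le_of_tendsto_of_isOpen hΓ (hU.prod hV)
      (Eventually.of_forall fun n => hle n U V hU.measurableSet hV.measurableSet)
  refine ⟨Γ, inferInstance, ?_, ?_, hΓle⟩
  · intro h0
    have h1 := tendsto_measure_univ hΓ
    have h2 := tendsto_nhds_unique h1 (((tendsto_edgeMeasure_univ hσ hint).comp hb).mono_left hL)
    rw [h0, Measure.coe_zero, Pi.zero_apply] at h2
    exact hne (enorm_eq_zero.1 h2.symm)
  · have h1 : ∀ᵐ p ∂(Γ : Measure (EuclideanSpace ℝ (Fin d) × EuclideanSpace ℝ (Fin d))),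
        p ∈ E ×ˢ E := hsupp _ fun A B _ _ => hΓle A B
    have h2 : ∀ n : ℕ, ∀ᵐ p ∂(Γ : Measure (EuclideanSpace ℝ (Fin d) × EuclideanSpace ℝ (Fin d))),
        |dist p.1 p.2 - t| ≤ 1 / ((n : ℝ) + 1) := by
      intro n
      have h3 := ((tendsto_edgeMeasure_dist (μ := μ) hσ1 ht (hb0 n)).comp hb).mono_left hL
      rw [ae_iff]
      simp only [not_le]
      refine nonpos_iff_eq_zero.1 (le_of_forall_gt fun c hc => ?_)
      obtain ⟨c', hc'0, hc'⟩ := exists_between hc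
      refine lt_of_le_of_lt (measure_le_of_tendsto_of_isOpen hΓ
        (isOpen_lt continuous_const (by fun_prop)) ?_) hc'
      filter_upwards [h3.eventually (gt_mem_nhds hc'0)] with i hi using hi.le
    filter_upwards [h1, ae_all_iff.2 h2] with p hp1 hp2
    refine ⟨hp1.1, hp1.2, ?_⟩
    have := ge_of_tendsto' (tendsto_one_div_add_atTop_nhds_zero_nat (𝕜 := ℝ)) hp2
    exact sub_eq_zero.1 (abs_nonpos_iff.1 this)

end edgeMeasure

section walk

open scoped ProbabilityTheory

lemma exists_walk_avoiding {X : Type*} [MeasurableSpace X] [MeasurableSingletonClass X]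
    {κ : ProbabilityTheory.Kernel X X} [ProbabilityTheory.IsMarkovKernel κ]
    {R : Set (X × X)} (P : ℕ → X → Prop)
    (hP : ∀ n x, P (n + 1) x →
      (∀ᵐ y ∂κ x, P n y) ∧ (∀ᵐ y ∂κ x, (x, y) ∈ R) ∧ ∀ y, κ x {y} = 0)
    (k : ℕ) (S : Finset X) (x : X) (hx : P k x) (hxS : x ∉ S) :
    ∃ f : Fin (k + 1) → X, f 0 = x ∧ Function.Injective f ∧ (∀ i, f i ∉ S) ∧
      ∀ i : Fin k, (f i.castSucc, f i.succ) ∈ R := by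
  classical
  induction k generalizing S x with
  | zero =>
    exact ⟨fun _ => x, rfl, fun i j _ => Fin.ext (by omega), fun _ => hxS,
      fun i => i.elim0⟩
  | succ k ih =>
    obtain ⟨h1, h2, h3⟩ := hP k x hx
    have h4 : ∀ᵐ y ∂κ x, y ∉ insert x S := by
      rw [ae_iff]
      have : {y | ¬ y ∉ insert x S} = ⋃ y ∈ insert x S, {y} := by
        ext y; simp [imp_iff_not_or]
      rw [this]
      exact (measure_biUnion_null_iff (insert x S).countable_toSet).2 fun y _ => h3 y
    obtain ⟨y, hy1, hy2, hy3⟩ := (h1.and (h2.and h4)).exists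
    obtain ⟨f, hf0, hfi, hfS, hfR⟩ := ih (insert x S) y hy1 hy3
    refine ⟨Fin.cons x f, rfl, ?_, ?_, ?_⟩
    · rw [Fin.cons_injective_iff]
      refine ⟨?_, hfi⟩
      rintro ⟨i, hi⟩
      exact hfS i (by simp [hi])
    · intro i
      refine Fin.cases ?_ (fun i => ?_) i
      · simpa using hxS
      · have := hfS i
        simp only [Finset.mem_insert, not_or] at this
        simpa using this.2
    · intro i
      refine Fin.cases ?_ (fun i => ?_) i
      · simpa [hf0] using hy2
      · simpa [← Fin.succ_castSucc] using hfR i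

lemma exists_injective_walk {X : Type*} [MeasurableSpace X] [StandardBorelSpace X] [Nonempty X]
    (Γ : Measure (X × X)) [IsFiniteMeasure Γ] (hΓ : Γ ≠ 0) (hsymm : Γ.snd ≪ Γ.fst)
    {R : Set (X × X)} (hR : ∀ᵐ p ∂Γ, p ∈ R)
    (hatom : ∀ᵐ x ∂Γ.fst, ∀ y, Γ.condKernel x {y} = 0) (k : ℕ) :
    ∃ f : Fin (k + 1) → X, Function.Injective f ∧
      ∀ i : Fin k, (f i.castSucc, f i.succ) ∈ R := by
  have hdis : Γ.fst ⊗ₘ Γ.condKernel = Γ := Γ.disintegrate Γ.condKernel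
  have key : ∀ {Q : X × X → Prop}, (∀ᵐ p ∂Γ, Q p) →
      ∀ᵐ x ∂Γ.fst, ∀ᵐ y ∂Γ.condKernel x, Q (x, y) := by
    intro Q hQ
    rw [← hdis] at hQ
    exact Measure.ae_ae_of_ae_compProd hQ
  let P : ℕ → X → Prop := fun n => n.rec (fun _ => True) fun _ Q x =>
      (∀ᵐ y ∂Γ.condKernel x, Q y) ∧ (∀ᵐ y ∂Γ.condKernel x, (x, y) ∈ R) ∧
        ∀ y, Γ.condKernel x {y} = 0
  have hP : ∀ n, ∀ᵐ x ∂Γ.fst, P n x := by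
    intro n
    induction n with
    | zero => exact Filter.Eventually.of_forall fun _ => trivial
    | succ n ih =>
      have h1 : ∀ᵐ y ∂Γ.snd, P n y := hsymm.ae_le ih
      have h2 : ∀ᵐ p ∂Γ, P n p.2 := ae_of_ae_map measurable_snd.aemeasurable h1
      filter_upwards [key h2, key hR, hatom] with x a b c using ⟨a, b, c⟩
  have : (ae Γ.fst).NeBot := by
    rw [ae_neBot, ne_eq, ← Measure.measure_univ_eq_zero, Measure.fst_univ,
      Measure.measure_univ_eq_zero]
    exact hΓ
  obtain ⟨x, hx⟩ := (hP k).exists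
  obtain ⟨f, -, h1, -, h2⟩ := exists_walk_avoiding (κ := Γ.condKernel) (R := R) P
    (fun n x h => h) k ∅ x hx (by simp)
  exact ⟨f, h1, h2⟩

lemma ae_condKernel_singleton_eq_zero {X : Type*} [MeasurableSpace X] [StandardBorelSpace X]
    [Nonempty X] (Γ : Measure (X × X)) [IsFiniteMeasure Γ] (μ : Measure X) [IsFiniteMeasure μ]
    (hΓ : ∀ η : ℝ≥0∞, η ≠ 0 → ∃ β : ℝ≥0∞, β ≠ 0 ∧ ∀ A B, MeasurableSet A → MeasurableSet B →
      μ B < β → Γ (A ×ˢ B) ≤ η * (μ A + μ B))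
    (hμ : ∀ β : ℝ≥0∞, β ≠ 0 → ∃ Q : ℕ → Set X, (∀ i, MeasurableSet (Q i)) ∧
      Pairwise (Function.onFun Disjoint Q) ∧ (⋃ i, Q i) = univ ∧ ∀ i, μ (Q i) < β) :
    ∀ᵐ x ∂Γ.fst, ∀ y, Γ.condKernel x {y} = 0 := by
  have hdis : Γ.fst ⊗ₘ Γ.condKernel = Γ := Γ.disintegrate Γ.condKernel
  set κ := Γ.condKernel with hκ
  have hm : ∀ m : ℕ, Γ.fst {x | ∃ y, (m : ℝ≥0∞)⁻¹ ≤ κ x {y}} = 0 := by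
    intro m
    rcases Nat.eq_zero_or_pos m with rfl | hm0
    · have : {x | ∃ y, ((0 : ℕ) : ℝ≥0∞)⁻¹ ≤ κ x {y}} = ∅ := by
        ext x
        simp
      rw [this, measure_empty]
    have hmne : (m : ℝ≥0∞) ≠ 0 := by exact_mod_cast hm0.ne'
    have hmtop : (m : ℝ≥0∞) ≠ ∞ := ENNReal.natCast_ne_top m
    have bound : ∀ η : ℝ≥0∞, η ≠ 0 →
        Γ.fst {x | ∃ y, (m : ℝ≥0∞)⁻¹ ≤ κ x {y}} ≤ m * (m + 1) * μ univ * η := by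
      intro η hη
      obtain ⟨β, hβ, hAB⟩ := hΓ η hη
      obtain ⟨Q, hQm, hQd, hQu, hQβ⟩ := hμ β hβ
      let A : ℕ → Set X := fun i => {x | (m : ℝ≥0∞)⁻¹ ≤ κ x (Q i)}
      have hAm : ∀ i, MeasurableSet (A i) := fun i =>
        measurableSet_le measurable_const (κ.measurable_coe (hQm i))
      have hsub : {x | ∃ y, (m : ℝ≥0∞)⁻¹ ≤ κ x {y}} ⊆ ⋃ i, A i := by
        rintro x ⟨y, hy⟩
        have : y ∈ ⋃ i, Q i := by rw [hQu]; trivial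
        obtain ⟨i, hi⟩ := mem_iUnion.1 this
        exact mem_iUnion.2 ⟨i, hy.trans (measure_mono (by simpa using hi))⟩
      have h1 : ∀ i, Γ.fst (A i) ≤ m * Γ (A i ×ˢ Q i) := by
        intro i
        have : Γ (A i ×ˢ Q i) = ∫⁻ x in A i, κ x (Q i) ∂Γ.fst := by
          conv_lhs => rw [← hdis]
          exact Measure.compProd_apply_prod (hAm i) (hQm i)
        rw [this]
        have h2 : (m : ℝ≥0∞)⁻¹ * Γ.fst (A i) ≤ ∫⁻ x in A i, κ x (Q i) ∂Γ.fst := by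
          rw [← setLIntegral_const]
          exact setLIntegral_mono' (hAm i) fun x hx => hx
        calc Γ.fst (A i) = m * ((m : ℝ≥0∞)⁻¹ * Γ.fst (A i)) := by
              rw [← mul_assoc, ENNReal.mul_inv_cancel hmne hmtop, one_mul]
          _ ≤ _ := by gcongr
      have h3 : ∑' i, μ (A i) ≤ m * μ univ := by
        have h4 : ∀ x, ∑' i, (A i).indicator 1 x ≤ (m : ℝ≥0∞) := by
          intro x
          calc ∑' i, (A i).indicator 1 x ≤ ∑' i, (m : ℝ≥0∞) * κ x (Q i) := by
                refine ENNReal.tsum_le_tsum fun i => ?_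
                by_cases hx : x ∈ A i
                · have h5 : (m : ℝ≥0∞)⁻¹ ≤ κ x (Q i) := hx
                  rw [indicator_of_mem hx, Pi.one_apply,
                    ← ENNReal.mul_inv_cancel hmne hmtop]
                  gcongr
                · rw [indicator_of_notMem hx]
                  exact zero_le
            _ = m * ∑' i, κ x (Q i) := ENNReal.tsum_mul_left
            _ = m * κ x (⋃ i, Q i) := by rw [measure_iUnion hQd hQm]
            _ ≤ m := by rw [hQu, measure_univ, mul_one]
        calc ∑' i, μ (A i) = ∑' i, ∫⁻ x, (A i).indicator 1 x ∂μ := by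
              congr with i
              rw [lintegral_indicator_one (hAm i)]
          _ = ∫⁻ x, ∑' i, (A i).indicator 1 x ∂μ := by
              rw [lintegral_tsum fun i => (measurable_one.indicator (hAm i)).aemeasurable]
          _ ≤ ∫⁻ _, (m : ℝ≥0∞) ∂μ := lintegral_mono h4
          _ = m * μ univ := lintegral_const _
      calc Γ.fst {x | ∃ y, (m : ℝ≥0∞)⁻¹ ≤ κ x {y}} ≤ Γ.fst (⋃ i, A i) := measure_mono hsub
        _ ≤ ∑' i, Γ.fst (A i) := measure_iUnion_le _
        _ ≤ ∑' i, m * (η * (μ (A i) + μ (Q i))) := by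
            refine ENNReal.tsum_le_tsum fun i => (h1 i).trans ?_
            gcongr
            exact hAB _ _ (hAm i) (hQm i) (hQβ i)
        _ = m * (η * (∑' i, μ (A i) + ∑' i, μ (Q i))) := by
            rw [ENNReal.tsum_mul_left, ENNReal.tsum_mul_left, ENNReal.tsum_add]
        _ ≤ m * (η * (m * μ univ + μ univ)) := by
            rw [← measure_iUnion hQd hQm, hQu]
            gcongr
        _ = m * (m + 1) * μ univ * η := by ring
    have hfin : (m : ℝ≥0∞) * (m + 1) * μ univ ≠ ∞ := by finiteness
    by_contra hne
    have h6 := bound (Γ.fst {x | ∃ y, (m : ℝ≥0∞)⁻¹ ≤ κ x {y}} / (2 * (m * (m + 1) * μ univ + 1)))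
      (by
        rw [ne_eq, ENNReal.div_eq_zero_iff, not_or]
        exact ⟨hne, by finiteness⟩)
    set g := Γ.fst {x | ∃ y, (m : ℝ≥0∞)⁻¹ ≤ κ x {y}} with hg
    set c := (m : ℝ≥0∞) * (m + 1) * μ univ with hc
    have hgt : g ≠ ∞ := measure_ne_top _ _
    have h7 : c * (g / (2 * (c + 1))) ≤ g / 2 := by
      rw [← mul_div_assoc]
      refine ENNReal.div_le_of_le_mul ?_
      calc c * g ≤ (c + 1) * g := by gcongr; exact le_self_add
        _ = g / 2 * 2 * (c + 1) := by
            rw [ENNReal.div_mul_cancel (by norm_num) (by norm_num)]; ring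
        _ = g / 2 * (2 * (c + 1)) := by ring
    exact absurd (h6.trans h7) (not_le.2 (ENNReal.half_lt_self hne hgt))
  rw [ae_iff]
  refine measure_mono_null ?_ (measure_iUnion_null hm)
  intro x hx
  simp only [mem_ofPred_eq, not_forall] at hx
  obtain ⟨y, hy⟩ := hx
  obtain ⟨m, hm⟩ := ENNReal.exists_inv_nat_lt hy
  exact mem_iUnion.2 ⟨m, y, hm.le⟩

end walk

section assembly

open Filter Topology

lemma exists_forall_measure_prod_le {X : Type*} [MeasurableSpace X] {μ : Measure X}
    [IsFiniteMeasure μ] {Γ : Measure (X × X)} {M : ℝ≥0∞} {q : ℝ} (hM : M ≠ ∞) (hq : 1 / 2 < q)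
    (h : ∀ A B, MeasurableSet A → MeasurableSet B → Γ (A ×ˢ B) ≤ M * (μ A * μ B) ^ q)
    {η : ℝ≥0∞} (hη : η ≠ 0) :
    ∃ β : ℝ≥0∞, β ≠ 0 ∧ ∀ A B, MeasurableSet A → MeasurableSet B → μ B < β →
      Γ (A ×ˢ B) ≤ η * (μ A + μ B) := by
  have hq' : 0 < q - 1 / 2 := by linarith
  have hlim : Tendsto (fun β => M * (μ univ * β) ^ (q - 1 / 2)) (𝓝 0) (𝓝 0) := by
    have h1 : Tendsto (fun β => (μ univ * β) ^ (q - 1 / 2)) (𝓝 0) (𝓝 ((μ univ * 0) ^ (q - 1 / 2))) :=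
      ((ENNReal.continuous_rpow_const).tendsto _).comp
        (ENNReal.Tendsto.const_mul tendsto_id (Or.inr (measure_ne_top _ _)))
    rw [mul_zero, ENNReal.zero_rpow_of_pos hq'] at h1
    simpa using ENNReal.Tendsto.const_mul h1 (Or.inr hM)
  obtain ⟨β, hβη, hβ⟩ := (((hlim.eventually (gt_mem_nhds (pos_iff_ne_zero.2 hη))).filter_mono
    (nhdsWithin_le_nhds (s := Ioi 0))).and self_mem_nhdsWithin).exists
  refine ⟨β, (mem_Ioi.1 hβ).ne', fun A B hA hB hBβ => (h A B hA hB).trans ?_⟩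
  have hsqrt : (μ A * μ B) ^ (1 / 2 : ℝ) ≤ μ A + μ B := by
    calc (μ A * μ B) ^ (1 / 2 : ℝ) ≤ ((μ A + μ B) * (μ A + μ B)) ^ (1 / 2 : ℝ) := by
          gcongr
          · exact le_self_add
          · exact le_add_self
      _ = μ A + μ B := by
          rw [← sq, ← ENNReal.rpow_two, ← ENNReal.rpow_mul]; norm_num
  calc M * (μ A * μ B) ^ q = M * ((μ A * μ B) ^ (q - 1 / 2) * (μ A * μ B) ^ (1 / 2 : ℝ)) := by
        rw [← ENNReal.rpow_add_of_nonneg _ _ hq'.le (by norm_num), sub_add_cancel]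
    _ ≤ M * ((μ univ * β) ^ (q - 1 / 2) * (μ A + μ B)) := by
        gcongr
        exact subset_univ A
    _ = M * (μ univ * β) ^ (q - 1 / 2) * (μ A + μ B) := (mul_assoc _ _ _).symm
    _ ≤ η * (μ A + μ B) := by gcongr

lemma exists_partition_measure_lt {d : ℕ} {μ : Measure (EuclideanSpace ℝ (Fin d))} {C s : ℝ}
    (hd : 1 ≤ d) (hs : 0 < s)
    (hμ : ∀ x r, 0 < r → μ (Metric.closedBall x r) ≤ ENNReal.ofReal (C * r ^ s))
    {β : ℝ≥0∞} (hβ : β ≠ 0) :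
    ∃ Q : ℕ → Set (EuclideanSpace ℝ (Fin d)), (∀ i, MeasurableSet (Q i)) ∧
      Pairwise (Function.onFun Disjoint Q) ∧ (⋃ i, Q i) = univ ∧ ∀ i, μ (Q i) < β := by
  have hlim : Tendsto (fun n : ℕ => ENNReal.ofReal (C * (d * ((2 : ℝ) ^ n)⁻¹) ^ s)) atTop (𝓝 0) := by
    have h1 : Tendsto (fun n : ℕ => (d : ℝ) * ((2 : ℝ) ^ n)⁻¹) atTop (𝓝 0) := by
      simpa [inv_pow] using (tendsto_pow_atTop_nhds_zero_of_lt_one (r := (2 : ℝ)⁻¹)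
        (by norm_num) (by norm_num)).const_mul (d : ℝ)
    have h2 := ENNReal.tendsto_ofReal ((h1.rpow_const (Or.inr hs.le)).const_mul C)
    simpa [Real.zero_rpow hs.ne'] using h2
  obtain ⟨n, hn⟩ := (hlim.eventually (gt_mem_nhds (pos_iff_ne_zero.2 hβ))).exists
  refine ⟨fun i => (Encodable.encode ∘ dyadicCell n) ⁻¹' {i}, fun i => ?_, fun i j hij => ?_, ?_,
    fun i => ?_⟩
  · exact (measurable_of_countable _).comp (measurable_dyadicCell n) (measurableSet_singleton i)
  · exact Disjoint.preimage _ (disjoint_singleton.2 hij)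
  · rw [← preimage_iUnion, iUnion_of_singleton, preimage_univ]
  · rcases eq_empty_or_nonempty ((Encodable.encode ∘ dyadicCell (d := d) n) ⁻¹' {i}) with h | ⟨x, hx⟩
    · simpa [h] using pos_iff_ne_zero.2 hβ
    · refine lt_of_le_of_lt ?_ hn
      have hd0 : (0 : ℝ) < d := by exact_mod_cast hd
      refine le_trans (measure_mono fun y hy => ?_) (hμ x _ (by positivity))
      refine dist_le_of_dyadicCell_eq (Encodable.encode_injective ?_)
      rw [mem_preimage, mem_singleton_iff] at hx hy
      exact hy.trans hx.symm

end assembly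

/-- Bennett–Iosevich–Taylor. Let `d ≥ 2` and let `E ⊆ ℝ^d` be compact with
Hausdorff dimension `> (d+1)/2`. Then for every `k ≥ 1` there is a non-empty open interval
`I ⊆ (0,∞)` such that for every `t ∈ I` the set `E` contains a non-degenerate `k`-chain with
constant gap `t`: points `x 0, …, x k ∈ E`, pairwise distinct, with consecutive distances `t`. -/
theorem chains_in_sets_of_large_dimension
    (d : ℕ) (hd : 2 ≤ d)
    (E : Set (EuclideanSpace ℝ (Fin d))) (hE : IsCompact E)
    (hdim : ((d : ℝ≥0∞) + 1) / 2 < dimH E) :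
    ∀ k : ℕ, 1 ≤ k → ∃ a b : ℝ, 0 ≤ a ∧ a < b ∧ ∀ t ∈ Set.Ioo a b,
      ∃ x : Fin (k + 1) → EuclideanSpace ℝ (Fin d),
        (∀ j, x j ∈ E) ∧ Function.Injective x ∧
        ∀ i : Fin k, dist (x i.castSucc) (x i.succ) = t := by
  intro k hk
  have hd1 : 1 ≤ d := by omega
  obtain ⟨s, hds, hsE⟩ := exists_between hdim
  lift s to NNReal using hsE.ne_top
  have hds' : ((d : ℝ) + 1) / 2 < s := by
    have := (ENNReal.toReal_lt_toReal hds.ne_top ENNReal.coe_ne_top).2 hds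
    simpa [ENNReal.toReal_add] using this
  have hs0 : (0 : ℝ) < s := lt_trans (by positivity) hds'
  obtain ⟨μ, hfin, hμ0, hμE, C₀, hC₀, hμ⟩ := exists_frostman_measure hE hs0
    (by rwa [ENNReal.ofReal_coe_nnreal])
  obtain ⟨θ, hθ, C, hC, henergy⟩ := exists_lintegral_charFun_restrict_le hd1 hC₀ hds' hμ
  have hint := integrable_charFun_sq_mul_rpow (μ := μ) (a := ((d : ℝ) - 1) / 2) (by
    have := henergy univ MeasurableSet.univ
    rw [Measure.restrict_univ] at this
    exact ne_top_of_le_ne_top (ENNReal.mul_ne_top hC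
      (ENNReal.rpow_ne_top_of_nonneg (by linarith) (measure_ne_top _ _))) this)
  obtain ⟨a, b, ha, hab, hpos⟩ := exists_Ioo_sphericalEnergy_re_pos hd hμ0 hint
  refine ⟨a, b, ha, hab, fun t ht => ?_⟩
  have ht0 : 0 < t := ha.trans_lt ht.1
  have hσ := isSphereMeasure_sphereMeasure d
  have := hσ.finite
  obtain ⟨D, hD, hdecay⟩ := hσ.exists_charFun_smul_le hd
  obtain ⟨Γ, hΓfin, hΓ0, hΓR, hΓ⟩ := exists_measure_dist_eq hE hμE ht0 hσ.ae_norm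
    (hdecay t ht0) hθ hC henergy hint (fun h => (hpos t ht).ne' (by rw [h, Complex.zero_re]))
  set M := ENNReal.ofReal (D * (1 + t ^ (-(((d : ℝ) - 1) / 2)))) * C
  have hM : M ≠ ∞ := ENNReal.mul_ne_top ENNReal.ofReal_ne_top hC
  have hsymm : (Γ + Γ.map Prod.swap).snd = (Γ + Γ.map Prod.swap).fst := by
    rw [← Measure.fst_map_swap, Measure.map_add _ _ measurable_swap,
      Measure.map_map measurable_swap measurable_swap, Prod.swap_swap_eq, Measure.map_id, add_comm]
  have hprod : ∀ A B, MeasurableSet A → MeasurableSet B →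
      (Γ + Γ.map Prod.swap) (A ×ˢ B) ≤ (2 * M) * (μ A * μ B) ^ ((1 + θ) / 2) := by
    intro A B hA hB
    rw [Measure.add_apply, Measure.map_apply measurable_swap (hA.prod hB), preimage_swap_prod,
      two_mul, add_mul]
    refine add_le_add (hΓ A B) ?_
    rw [mul_comm (μ A)]
    exact hΓ B A
  have hatom := ae_condKernel_singleton_eq_zero (Γ + Γ.map Prod.swap) μ
    (fun η hη => exists_forall_measure_prod_le (ENNReal.mul_ne_top (by simp) hM) (by linarith)
      hprod hη)
    (fun β hβ => exists_partition_measure_lt hd1 hs0 hμ hβ)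
  have hR : ∀ᵐ p ∂(Γ + Γ.map Prod.swap), p.1 ∈ E ∧ p.2 ∈ E ∧ dist p.1 p.2 = t := by
    have hmeas : MeasurableSet {p : EuclideanSpace ℝ (Fin d) × EuclideanSpace ℝ (Fin d) |
        p.1 ∈ E ∧ p.2 ∈ E ∧ dist p.1 p.2 = t} :=
      (measurable_fst hE.measurableSet).inter ((measurable_snd hE.measurableSet).inter
        (measurableSet_eq_fun (by fun_prop) measurable_const))
    rw [ae_add_measure_iff, ae_map_iff measurable_swap.aemeasurable hmeas]
    refine ⟨hΓR, ?_⟩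
    filter_upwards [hΓR] with p hp
    exact ⟨hp.2.1, hp.1, (dist_comm _ _).trans hp.2.2⟩
  obtain ⟨x, hx, hxR⟩ := exists_injective_walk (Γ + Γ.map Prod.swap)
    (fun h => hΓ0 (Measure.nonpos_iff_eq_zero'.1 (h ▸ Measure.le_add_right le_rfl)))
    hsymm.absolutelyContinuous (R := {p | p.1 ∈ E ∧ p.2 ∈ E ∧ dist p.1 p.2 = t}) hR hatom k
  refine ⟨x, fun j => ?_, hx, fun i => (hxR i).2.2⟩
  obtain ⟨n, rfl⟩ := Nat.exists_eq_add_of_le' hk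
  refine Fin.cases ?_ (fun i => (hxR i).2.1) j
  exact (hxR 0).1
end

section
/- Let x¹, x², x³ be three non-collinear points of ℝ². Then there exists a compact set A ⊂ ℝ² with dim_H(A) = 2 such that A does not contain the vertices of any triangle similar to the triangle x¹x²x³; that is, there do not exist a scalar λ > 0, a permutation π of {1,2,3}, and pairwise distinct points y¹, y², y³ ∈ A with |y^{π(i)} − y^{π(j)}| = λ |x^i − x^j| for all i, j ∈ {1,2,3}. -/
open MeasureTheory Set
open scoped ENNReal

open Filter
open scoped Nat NNReal Topology

/-- A sequence of finite colourings separating any three distinct infinite words. -/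
lemma exists_separating_colouring (D β : Type*) [Countable D] [Countable β] [Nonempty β] :
    ∃ (b : ℕ → β) (c : ℕ → (ℕ → D) → Fin 3),
      (∀ k d d', (∀ i < k, d i = d' i) → c k d = c k d') ∧
      ∀ (v : β) (d : Fin 3 → ℕ → D), Function.Injective d →
        ∃ k, b k = v ∧ ∀ i, c k (d i) = i := by
  classical
  obtain ⟨e, he⟩ := exists_surjective_nat (β × ℕ × (Fin 2 → List D))
  let word (m : ℕ) (d : ℕ → D) : List D := (List.range m).map d
  have word_eq {m : ℕ} {d d' : ℕ → D} : word m d = word m d' ↔ ∀ i < m, d i = d' i := by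
    simp [word, List.map_inj_left]
  let t (k : ℕ) := e k.unpair.1
  refine ⟨fun k => (t k).1, fun k d =>
    if word (min (t k).2.1 k) d = (t k).2.2 0 then 0
    else if word (min (t k).2.1 k) d = (t k).2.2 1 then 1 else 2, ?_, ?_⟩
  · intro k d d' h
    have : word (min (t k).2.1 k) d = word (min (t k).2.1 k) d' :=
      word_eq.2 fun i hi => h i (hi.trans_le (min_le_right _ _))
    simp only [this]
  · intro v d hd
    have key (p : Fin 3 × Fin 3) : ∃ m, p.1 ≠ p.2 → ∃ i < m, d p.1 i ≠ d p.2 i := by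
      by_cases hp : p.1 = p.2
      · exact ⟨0, fun h => (h hp).elim⟩
      · obtain ⟨i, hi⟩ := Function.ne_iff.1 (hd.ne hp)
        exact ⟨i + 1, fun _ => ⟨i, i.lt_succ_self, hi⟩⟩
    choose m hm using key
    let j := ∑ p, m p
    have sep {a b : Fin 3} (hab : a ≠ b) : word j (d a) ≠ word j (d b) := by
      obtain ⟨i, hi, hne⟩ := hm (a, b) hab
      refine fun h => hne (word_eq.1 h i (hi.trans_le ?_))
      exact Finset.single_le_sum (f := m) (fun _ _ => Nat.zero_le _) (Finset.mem_univ (a, b))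
    obtain ⟨n, hn⟩ := he (v, j, ![word j (d 0), word j (d 1)])
    refine ⟨Nat.pair n j, ?_, ?_⟩
    · simp [t, hn]
    · have hj : min j (Nat.pair n j) = j := min_eq_left (Nat.right_le_pair n j)
      intro i
      fin_cases i <;> simp [t, hn, hj, sep]

/-- A pair of integers, seen as a Gaussian integer. -/
def gaussPoint (m : ℤ × ℤ) : ℂ := ⟨m.1, m.2⟩

lemma gaussPoint_add (m n : ℤ × ℤ) : gaussPoint (m + n) = gaussPoint m + gaussPoint n := by
  apply Complex.ext <;> simp [gaussPoint]

lemma gaussPoint_sub (m n : ℤ × ℤ) : gaussPoint (m - n) = gaussPoint m - gaussPoint n := by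
  apply Complex.ext <;> simp [gaussPoint]

lemma abs_fst_le_norm_gaussPoint (m : ℤ × ℤ) : |(m.1 : ℝ)| ≤ ‖gaussPoint m‖ :=
  Complex.abs_re_le_norm (gaussPoint m)

lemma abs_snd_le_norm_gaussPoint (m : ℤ × ℤ) : |(m.2 : ℝ)| ≤ ‖gaussPoint m‖ :=
  Complex.abs_im_le_norm (gaussPoint m)

lemma norm_gaussPoint_le (m : ℤ × ℤ) : ‖gaussPoint m‖ ≤ |(m.1 : ℝ)| + |(m.2 : ℝ)| :=
  Complex.norm_le_abs_re_add_abs_im _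

lemma one_le_norm_gaussPoint {m : ℤ × ℤ} (hm : m ≠ 0) : 1 ≤ ‖gaussPoint m‖ := by
  have : m.1 ≠ 0 ∨ m.2 ≠ 0 := by
    by_contra! h
    exact hm (Prod.ext h.1 h.2)
  rcases this with h | h
  · exact (by exact_mod_cast Int.one_le_abs h : (1 : ℝ) ≤ |(m.1 : ℝ)|).trans
      (abs_fst_le_norm_gaussPoint m)
  · exact (by exact_mod_cast Int.one_le_abs h : (1 : ℝ) ≤ |(m.2 : ℝ)|).trans
      (abs_snd_le_norm_gaussPoint m)

lemma half_le_norm_gaussPoint_add_half (m : ℤ × ℤ) : 1 / 2 ≤ ‖gaussPoint m + 1 / 2‖ := by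
  refine le_trans ?_ (Complex.abs_re_le_norm _)
  have : (gaussPoint m + 1 / 2).re = m.1 + 1 / 2 := by simp [gaussPoint]
  rw [this]
  rcases le_or_gt 0 m.1 with h | h
  · have : (0 : ℝ) ≤ m.1 := by exact_mod_cast h
    exact le_trans (by linarith) (le_abs_self _)
  · have : (m.1 : ℝ) ≤ -1 := by exact_mod_cast Int.le_sub_one_of_lt h
    exact le_trans (by linarith) (neg_le_abs _)

/-- The nearest Gaussian integer. -/
noncomputable def gaussRound (z : ℂ) : ℤ × ℤ := (round z.re, round z.im)

lemma norm_gaussPoint_gaussRound_sub_le (z : ℂ) : ‖gaussPoint (gaussRound z) - z‖ ≤ 1 := by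
  refine (Complex.norm_le_abs_re_add_abs_im _).trans ?_
  have h₁ := abs_sub_round z.re
  have h₂ := abs_sub_round z.im
  rw [abs_sub_comm] at h₁ h₂
  simp only [gaussPoint, gaussRound, Complex.sub_re, Complex.sub_im]
  linarith

/-- The side length, up to a constant, of the squares of the `k`-th generation. -/
noncomputable def scale (c : ℝ) (k : ℕ) : ℝ := c ^ k / k !

lemma scale_pos {c : ℝ} (hc : 0 < c) (k : ℕ) : 0 < scale c k := by
  unfold scale; positivity

lemma scale_succ_mul (c : ℝ) (k : ℕ) : scale c (k + 1) * (k + 1) = c * scale c k := by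
  unfold scale
  rw [Nat.factorial_succ, pow_succ]
  push_cast
  field_simp

lemma scale_succ_le {c : ℝ} (hc : 0 < c) (k : ℕ) : scale c (k + 1) ≤ c * scale c k := by
  rw [← scale_succ_mul]
  exact le_mul_of_one_le_right (scale_pos hc _).le (by linarith [k.cast_nonneg (α := ℝ)])

lemma scale_add_le {c : ℝ} (hc : 0 < c) (hc' : c ≤ 1 / 2) (k n : ℕ) :
    scale c (k + n) ≤ scale c k / 2 ^ n := by
  induction n with
  | zero => simp
  | succ n ih =>
    calc scale c (k + (n + 1)) ≤ c * scale c (k + n) := scale_succ_le hc _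
      _ ≤ 1 / 2 * (scale c k / 2 ^ n) := by
        gcongr
        exact (scale_pos hc _).le
      _ = _ := by rw [pow_succ]; field_simp

lemma tendsto_scale (c : ℝ) : Tendsto (scale c) atTop (𝓝 0) :=
  FloorSemiring.tendsto_pow_div_factorial_atTop c

/-- The scales decay faster than any geometric progression. -/
lemma exists_scale_rpow_le {c : ℝ} (hc : 0 < c) (hc' : c ≤ 1) {s : ℝ} (hs : 0 < s) :
    ∃ C : ℝ, 0 < C ∧ ∀ k, scale c k ^ s ≤ C * c ^ k := by
  set y : ℝ := (c⁻¹) ^ s⁻¹ with hy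
  have hy0 : 0 < y := by positivity
  refine ⟨Real.exp y ^ s, by positivity, fun k => ?_⟩
  have h₁ : y ^ k / k ! ≤ Real.exp y := Real.pow_div_factorial_le_exp y hy0.le k
  have h₂ : scale c k ≤ Real.exp y * (y ^ k)⁻¹ := by
    calc scale c k ≤ 1 / k ! := by
          unfold scale
          gcongr
          exact pow_le_one₀ hc.le hc'
      _ = y ^ k / k ! * (y ^ k)⁻¹ := by field_simp
      _ ≤ _ := by gcongr
  calc scale c k ^ s ≤ (Real.exp y * (y ^ k)⁻¹) ^ s :=
        Real.rpow_le_rpow (scale_pos hc k).le h₂ hs.le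
    _ = Real.exp y ^ s * ((y ^ s) ^ k)⁻¹ := by
        rw [Real.mul_rpow (Real.exp_pos y).le (by positivity), Real.inv_rpow (by positivity),
          ← Real.rpow_natCast, ← Real.rpow_natCast, ← Real.rpow_mul hy0.le, ← Real.rpow_mul hy0.le,
          mul_comm s]
    _ = _ := by
        rw [hy, ← Real.rpow_mul (by positivity), inv_mul_cancel₀ hs.ne', Real.rpow_one, inv_pow,
          inv_inv]

/-- Sequences of pairs of digits in the factorial number system. -/
def digitBox : Set (ℕ → ℤ × ℤ) := univ.pi fun k => Icc 0 ((k : ℤ), (k : ℤ))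

lemma isCompact_digitBox : IsCompact digitBox :=
  isCompact_univ_pi fun _ => (finite_Icc _ _).isCompact

lemma norm_gaussPoint_le_of_mem_digitBox {d : ℕ → ℤ × ℤ} (hd : d ∈ digitBox) (k : ℕ) :
    ‖gaussPoint (d k)‖ ≤ 2 * k := by
  obtain ⟨⟨h₁, h₂⟩, h₃, h₄⟩ := hd k trivial
  refine (norm_gaussPoint_le _).trans ?_
  simp only [Prod.fst_zero, Prod.snd_zero] at h₁ h₂ h₃ h₄
  have h₁' : (0 : ℝ) ≤ (d k).1 := by exact_mod_cast h₁
  have h₂' : (0 : ℝ) ≤ (d k).2 := by exact_mod_cast h₂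
  have h₃' : ((d k).1 : ℝ) ≤ k := by exact_mod_cast h₃
  have h₄' : ((d k).2 : ℝ) ≤ k := by exact_mod_cast h₄
  rw [abs_of_nonneg h₁', abs_of_nonneg h₂']
  linarith

lemma norm_gaussPoint_sub_le_of_mem_digitBox {d d' : ℕ → ℤ × ℤ} (hd : d ∈ digitBox)
    (hd' : d' ∈ digitBox) (k : ℕ) : ‖gaussPoint (d k - d' k)‖ ≤ 2 * k := by
  obtain ⟨⟨h₁, h₂⟩, h₃, h₄⟩ := hd k trivial
  obtain ⟨⟨h₁', h₂'⟩, h₃', h₄'⟩ := hd' k trivial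
  simp only [Prod.fst_zero, Prod.snd_zero] at h₁ h₂ h₃ h₄ h₁' h₂' h₃' h₄'
  have h : |((d k - d' k).1 : ℝ)| ≤ k := by
    rw [Prod.fst_sub]; exact_mod_cast abs_le.2 (by constructor <;> linarith)
  have h' : |((d k - d' k).2 : ℝ)| ≤ k := by
    rw [Prod.snd_sub]; exact_mod_cast abs_le.2 (by constructor <;> linarith)
  linarith [norm_gaussPoint_le (d k - d' k)]

/-- A choice of a shifted lattice for every word and every generation. -/
structure LatticeChoice (K : ℝ) where
  ratio : ℕ → (ℕ → ℤ × ℤ) → ℂ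
  shift : ℕ → (ℕ → ℤ × ℤ) → ℂ
  one_le : 1 ≤ K
  norm_ratio_le : ∀ k d, ‖ratio k d‖ ≤ K
  one_le_norm_ratio : ∀ k d, 1 ≤ K * ‖ratio k d‖
  norm_shift_le : ∀ k d, ‖shift k d‖ ≤ 1 / 2
  ratio_congr : ∀ k d d', (∀ i < k, d i = d' i) → ratio k d = ratio k d'
  shift_congr : ∀ k d d', (∀ i < k, d i = d' i) → shift k d = shift k d'

namespace LatticeChoice

/-- The contraction constant of the construction. -/
noncomputable def contraction (K : ℝ) : ℝ := 1 / (100 * K ^ 2)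

variable {K : ℝ} (P : LatticeChoice K)

/-- The mesh of the lattice of the `k`-th generation. -/
noncomputable def mesh (_ : LatticeChoice K) (k : ℕ) : ℝ := scale (contraction K) k

/-- The corner of the square of the `k`-th generation coded by the word `d`. -/
noncomputable def corner : ℕ → (ℕ → ℤ × ℤ) → ℂ
  | 0, _ => 0
  | k + 1, d => P.mesh (k + 1) * P.ratio k d *
      (gaussPoint (gaussRound (corner k d / (P.mesh (k + 1) * P.ratio k d)) + d k) + P.shift k d)

lemma contraction_pos (hK : 1 ≤ K) : 0 < contraction K := by
  unfold contraction; positivity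

lemma contraction_le (hK : 1 ≤ K) : contraction K ≤ 1 / 100 := by
  unfold contraction
  gcongr
  nlinarith

lemma mesh_pos (k : ℕ) : 0 < P.mesh k := scale_pos (contraction_pos P.one_le) k

lemma mul_contraction (hK : 1 ≤ K) : K * contraction K = 1 / (100 * K) := by
  unfold contraction
  field_simp

lemma ratio_ne_zero (k : ℕ) (d : ℕ → ℤ × ℤ) : P.ratio k d ≠ 0 := by
  intro h
  have := P.one_le_norm_ratio k d
  norm_num [h] at this

lemma corner_congr {k : ℕ} {d d' : ℕ → ℤ × ℤ} (h : ∀ i < k, d i = d' i) :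
    P.corner k d = P.corner k d' := by
  induction k with
  | zero => rfl
  | succ k ih =>
    have hk : ∀ i < k, d i = d' i := fun i hi => h i (hi.trans k.lt_succ_self)
    simp only [corner, ih hk, P.ratio_congr k d d' hk, P.shift_congr k d d' hk, h k k.lt_succ_self]

lemma dist_corner_succ_le {d : ℕ → ℤ × ℤ} (hd : d ∈ digitBox) (k : ℕ) :
    dist (P.corner k d) (P.corner (k + 1) d) ≤ P.mesh k / (50 * K) := by
  have hK := P.one_le
  set a : ℂ := P.mesh (k + 1) * P.ratio k d with ha
  have ha0 : a ≠ 0 := mul_ne_zero (by exact_mod_cast (P.mesh_pos _).ne') (P.ratio_ne_zero k d)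
  have hna : ‖a‖ ≤ P.mesh (k + 1) * K := by
    rw [ha, norm_mul, Complex.norm_real, Real.norm_of_nonneg (P.mesh_pos _).le]
    exact mul_le_mul_of_nonneg_left (P.norm_ratio_le k d) (P.mesh_pos _).le
  set z := P.corner k d / a with hz
  have hca : P.corner k d = a * z := by rw [hz]; field_simp
  have hstep : P.corner (k + 1) d - P.corner k d =
      a * ((gaussPoint (gaussRound z) - z) + gaussPoint (d k) + P.shift k d) := by
    rw [corner, ← ha, ← hz, gaussPoint_add, hca]
    ring
  rw [dist_comm, dist_eq_norm, hstep, norm_mul]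
  have hn : ‖(gaussPoint (gaussRound z) - z) + gaussPoint (d k) + P.shift k d‖ ≤
      2 * ((k : ℝ) + 1) := by
    refine (norm_add₃_le).trans ?_
    linarith [norm_gaussPoint_gaussRound_sub_le z, norm_gaussPoint_le_of_mem_digitBox hd k,
      P.norm_shift_le k d]
  calc ‖a‖ * _ ≤ (P.mesh (k + 1) * K) * (2 * ((k : ℝ) + 1)) := by
        gcongr
        exact (norm_nonneg a).trans hna
    _ = 2 * K * (P.mesh (k + 1) * ((k : ℝ) + 1)) := by ring
    _ = 2 * (K * contraction K) * P.mesh k := by rw [mesh, scale_succ_mul, mesh]; ring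
    _ = _ := by rw [mul_contraction hK]; field_simp; ring

lemma dist_corner_add_le {d : ℕ → ℤ × ℤ} (hd : d ∈ digitBox) (k n : ℕ) :
    dist (P.corner (k + n) d) (P.corner (k + (n + 1)) d) ≤ P.mesh k / (25 * K) / 2 / 2 ^ n := by
  have hK := P.one_le
  calc _ ≤ P.mesh (k + n) / (50 * K) := P.dist_corner_succ_le hd _
    _ ≤ (P.mesh k / 2 ^ n) / (50 * K) := by
      gcongr
      exact scale_add_le (contraction_pos hK) (by linarith [contraction_le hK]) k n
    _ = _ := by field_simp; ring

/-- The point coded by an infinite word. -/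
noncomputable def point (d : ℕ → ℤ × ℤ) : ℂ := limUnder atTop fun k => P.corner k d

lemma tendsto_corner {d : ℕ → ℤ × ℤ} (hd : d ∈ digitBox) :
    Tendsto (fun k => P.corner k d) atTop (𝓝 (P.point d)) := by
  have : CauchySeq fun n => P.corner n d := by
    refine cauchySeq_of_le_geometric_two (C := P.mesh 0 / (25 * K)) fun n => ?_
    simpa using P.dist_corner_add_le hd 0 n
  exact this.tendsto_limUnder

lemma dist_corner_point_le {d : ℕ → ℤ × ℤ} (hd : d ∈ digitBox) (k : ℕ) :
    dist (P.corner k d) (P.point d) ≤ P.mesh k / (25 * K) := by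
  have h : Tendsto (fun n => P.corner (k + n) d) atTop (𝓝 (P.point d)) := by
    simpa only [add_comm k] using (tendsto_add_atTop_iff_nat k).2 (P.tendsto_corner hd)
  exact dist_le_of_le_geometric_two_of_tendsto₀ (fun n => P.dist_corner_add_le hd k n) h

lemma continuousOn_point : ContinuousOn P.point digitBox := by
  have hK := P.one_le
  intro d hd
  refine Metric.tendsto_nhds.2 fun ε hε => ?_
  obtain ⟨k, hk⟩ := ((tendsto_scale (contraction K)).eventually (gt_mem_nhds hε)).exists
  have hU : {d' : ℕ → ℤ × ℤ | ∀ i ∈ Finset.range k, d' i = d i} ∈ 𝓝 d := by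
    refine (Filter.eventually_all_finset _).2 fun i _ => ?_
    have hi : Continuous fun d' : ℕ → ℤ × ℤ => d' i := continuous_apply i
    exact hi.continuousAt.eventually_mem (s := {d i}) (mem_nhds_discrete.2 rfl)
  filter_upwards [self_mem_nhdsWithin, mem_nhdsWithin_of_mem_nhds hU] with d' hd' h
  have hc : P.corner k d' = P.corner k d := P.corner_congr fun i hi => h i (Finset.mem_range.2 hi)
  have h₁ := P.dist_corner_point_le hd k
  have h₂ := P.dist_corner_point_le hd' k
  rw [hc] at h₂
  have h₃ : P.mesh k / (25 * K) ≤ P.mesh k / 25 := by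
    have := P.mesh_pos k
    gcongr
    linarith
  have hk' : P.mesh k < ε := hk
  have h₄ := P.mesh_pos k
  linarith [dist_triangle_left (P.point d') (P.point d) (P.corner k d)]

/-- The points coded by `d` are close to the lattice of each generation. -/
lemma exists_norm_point_sub_le {d : ℕ → ℤ × ℤ} (hd : d ∈ digitBox) (k : ℕ) :
    ∃ m : ℤ × ℤ, ‖P.point d - P.mesh (k + 1) * P.ratio k d * (gaussPoint m + P.shift k d)‖ ≤
      P.mesh (k + 1) / (25 * K) := by
  refine ⟨gaussRound (P.corner k d / (P.mesh (k + 1) * P.ratio k d)) + d k, ?_⟩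
  rw [← dist_eq_norm, dist_comm]
  exact P.dist_corner_point_le hd (k + 1)

/-- Words which first differ at the `k`-th digit code points which are far apart. -/
lemma le_dist_point {d d' : ℕ → ℤ × ℤ} (hd : d ∈ digitBox) (hd' : d' ∈ digitBox) {k : ℕ}
    (h : ∀ i < k, d i = d' i) (hne : d k ≠ d' k) :
    P.mesh (k + 1) * ‖gaussPoint (d k - d' k)‖ / (2 * K) ≤ dist (P.point d) (P.point d') := by
  have hK := P.one_le
  have hc : P.corner (k + 1) d - P.corner (k + 1) d' =
      P.mesh (k + 1) * P.ratio k d * gaussPoint (d k - d' k) := by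
    simp only [corner, P.corner_congr h, P.ratio_congr k d d' h, P.shift_congr k d d' h,
      gaussPoint_add, gaussPoint_sub]
    ring
  have hdist : P.mesh (k + 1) * ‖gaussPoint (d k - d' k)‖ / K ≤
      dist (P.corner (k + 1) d) (P.corner (k + 1) d') := by
    rw [dist_eq_norm, hc, norm_mul, norm_mul, Complex.norm_real,
      Real.norm_of_nonneg (P.mesh_pos _).le, div_le_iff₀ (by linarith)]
    calc P.mesh (k + 1) * ‖gaussPoint (d k - d' k)‖
        ≤ P.mesh (k + 1) * ‖gaussPoint (d k - d' k)‖ * (K * ‖P.ratio k d‖) :=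
          le_mul_of_one_le_right (mul_nonneg (P.mesh_pos _).le (norm_nonneg _))
            (P.one_le_norm_ratio k d)
      _ = _ := by ring
  have h₁ := P.dist_corner_point_le hd (k + 1)
  have h₂ := P.dist_corner_point_le hd' (k + 1)
  have h₃ : P.mesh (k + 1) / K ≤ P.mesh (k + 1) * ‖gaussPoint (d k - d' k)‖ / K := by
    gcongr
    exact le_mul_of_one_le_right (P.mesh_pos _).le (one_le_norm_gaussPoint (sub_ne_zero.2 hne))
  have h₄ := dist_triangle4 (P.corner (k + 1) d) (P.point d) (P.point d') (P.corner (k + 1) d')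
  rw [dist_comm (P.point d')] at h₄
  have h₅ : P.mesh (k + 1) / (25 * K) = P.mesh (k + 1) / K / 25 := by field_simp
  have h₆ : P.mesh (k + 1) * ‖gaussPoint (d k - d' k)‖ / (2 * K) =
    P.mesh (k + 1) * ‖gaussPoint (d k - d' k)‖ / K / 2 := by field_simp
  have h₇ : 0 < P.mesh (k + 1) / K := div_pos (P.mesh_pos _) (by linarith)
  rw [h₅] at h₁ h₂
  rw [h₆]
  linarith

end LatticeChoice

/-- The `k`-th digit of `x` in the factorial number system. -/
noncomputable def factorialDigit (x : ℝ) (k : ℕ) : ℤ :=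
  ⌊x * (k + 1)!⌋ - (k + 1) * ⌊x * k !⌋

lemma factorialDigit_mem_Icc (x : ℝ) (k : ℕ) : factorialDigit x k ∈ Icc (0 : ℤ) k := by
  have h : x * (k + 1)! = (k + 1) * (x * k !) := by
    rw [Nat.factorial_succ]; push_cast; ring
  have hk : (0 : ℝ) < (k : ℝ) + 1 := by positivity
  rw [factorialDigit, h]
  constructor
  · rw [sub_nonneg, Int.le_floor]
    push_cast
    gcongr
    exact Int.floor_le _
  · have : ⌊((k : ℝ) + 1) * (x * k !)⌋ < (k + 1) * (⌊x * k !⌋ + 1) := by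
      rw [Int.floor_lt]
      push_cast
      gcongr
      exact Int.lt_floor_add_one _
    linarith

lemma floor_mul_factorial_congr {x y : ℝ} (hx : x ∈ Ico (0 : ℝ) 1) (hy : y ∈ Ico (0 : ℝ) 1)
    {k : ℕ} (h : ∀ i < k, factorialDigit x i = factorialDigit y i) :
    ⌊x * k !⌋ = ⌊y * k !⌋ := by
  induction k with
  | zero => simp [Int.floor_eq_zero_iff.2 hx, Int.floor_eq_zero_iff.2 hy]
  | succ k ih =>
    have h₁ := h k k.lt_succ_self
    have h₂ := ih fun i hi => h i (hi.trans k.lt_succ_self)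
    rw [factorialDigit, factorialDigit, h₂] at h₁
    linarith

lemma abs_sub_mul_factorial_le {x y : ℝ} (hx : x ∈ Ico (0 : ℝ) 1) (hy : y ∈ Ico (0 : ℝ) 1)
    {k : ℕ} (h : ∀ i < k, factorialDigit x i = factorialDigit y i) :
    |x - y| * (k + 1)! ≤ |((factorialDigit x k - factorialDigit y k : ℤ) : ℝ)| + 1 := by
  have h₁ : factorialDigit x k - factorialDigit y k = ⌊x * (k + 1)!⌋ - ⌊y * (k + 1)!⌋ := by
    rw [factorialDigit, factorialDigit, floor_mul_factorial_congr hx hy h]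
    ring
  have h₂ : |x - y| * (k + 1)! = |x * (k + 1)! - y * (k + 1)!| := by
    rw [← sub_mul, abs_mul, abs_of_nonneg (by positivity : (0 : ℝ) ≤ (k + 1)!)]
  rw [h₁, h₂]
  push_cast
  have h₃ : x * (k + 1)! - y * (k + 1)! = ((⌊x * (k + 1)!⌋ : ℝ) - ⌊y * (k + 1)!⌋) +
      (Int.fract (x * (k + 1)!) - Int.fract (y * (k + 1)!)) := by
    simp only [Int.fract]; ring
  rw [h₃]
  refine (abs_add_le _ _).trans (add_le_add le_rfl ?_)
  rw [abs_le]
  constructor <;> linarith [Int.fract_nonneg (x * (k + 1)!), Int.fract_nonneg (y * (k + 1)!),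
    Int.fract_lt_one (x * (k + 1)!), Int.fract_lt_one (y * (k + 1)!)]

lemma exists_factorialDigit_ne {x y : ℝ} (hx : x ∈ Ico (0 : ℝ) 1) (hy : y ∈ Ico (0 : ℝ) 1)
    (hxy : x ≠ y) : ∃ k, factorialDigit x k ≠ factorialDigit y k := by
  by_contra! h
  have h₀ : 0 < |x - y| := abs_pos.2 (sub_ne_zero.2 hxy)
  obtain ⟨n, hn⟩ := exists_nat_gt (1 / |x - y|)
  have h₁ := abs_sub_mul_factorial_le hx hy (k := n) fun i _ => h i
  rw [h n, sub_self, Int.cast_zero, abs_zero, zero_add] at h₁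
  have h₂ : (n : ℝ) ≤ (n + 1)! := by
    exact_mod_cast n.le_succ.trans (Nat.self_le_factorial _)
  rw [div_lt_iff₀ h₀] at hn
  nlinarith

/-- The pairs of digits of a point of the unit square. -/
noncomputable def squareDigits (t : ℝ × ℝ) (k : ℕ) : ℤ × ℤ :=
  (factorialDigit t.1 k, factorialDigit t.2 k)

lemma squareDigits_mem_digitBox (t : ℝ × ℝ) : squareDigits t ∈ digitBox := fun k _ =>
  ⟨⟨(factorialDigit_mem_Icc t.1 k).1, (factorialDigit_mem_Icc t.2 k).1⟩,
    (factorialDigit_mem_Icc t.1 k).2, (factorialDigit_mem_Icc t.2 k).2⟩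

/-- The half-open unit square. -/
def unitSquare : Set (ℝ × ℝ) := Ico (0 : ℝ) 1 ×ˢ Ico (0 : ℝ) 1

lemma exists_first_squareDigits_ne {t u : ℝ × ℝ} (ht : t ∈ unitSquare) (hu : u ∈ unitSquare)
    (htu : t ≠ u) : ∃ k, (∀ i < k, squareDigits t i = squareDigits u i) ∧
      squareDigits t k ≠ squareDigits u k := by
  classical
  have h : ∃ k, squareDigits t k ≠ squareDigits u k := by
    by_contra! h
    refine htu (Prod.ext ?_ ?_) <;> by_contra hne
    · obtain ⟨k, hk⟩ := exists_factorialDigit_ne ht.1 hu.1 hne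
      exact hk (congrArg Prod.fst (h k))
    · obtain ⟨k, hk⟩ := exists_factorialDigit_ne ht.2 hu.2 hne
      exact hk (congrArg Prod.snd (h k))
  exact ⟨Nat.find h, fun i hi => not_not.1 (Nat.find_min h hi), Nat.find_spec h⟩

lemma dist_mul_factorial_le {t u : ℝ × ℝ} (ht : t ∈ unitSquare) (hu : u ∈ unitSquare) {k : ℕ}
    (h : ∀ i < k, squareDigits t i = squareDigits u i) (hne : squareDigits t k ≠ squareDigits u k) :
    dist t u * (k + 1)! ≤ 2 * ‖gaussPoint (squareDigits t k - squareDigits u k)‖ := by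
  have h₀ := one_le_norm_gaussPoint (sub_ne_zero.2 hne)
  have h₁ := abs_sub_mul_factorial_le ht.1 hu.1 (k := k) fun i hi => congrArg Prod.fst (h i hi)
  have h₂ := abs_sub_mul_factorial_le ht.2 hu.2 (k := k) fun i hi => congrArg Prod.snd (h i hi)
  have h₃ := abs_fst_le_norm_gaussPoint (squareDigits t k - squareDigits u k)
  have h₄ := abs_snd_le_norm_gaussPoint (squareDigits t k - squareDigits u k)
  rw [Prod.fst_sub] at h₃
  rw [Prod.snd_sub] at h₄
  simp only [squareDigits] at h₀ h₃ h₄ ⊢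
  rw [Prod.dist_eq, max_mul_of_nonneg _ _ (by positivity), Real.dist_eq, Real.dist_eq]
  exact max_le (by linarith) (by linarith)

lemma mul_dimH_le_dimH_image {X Y : Type*} [MetricSpace X] [MetricSpace Y] {F : X → Y} {s : Set X}
    {C r : ℝ≥0} (hr : 0 < r)
    (h : ∀ t ∈ s, ∀ u ∈ s, dist t u ≤ C * dist (F t) (F u) ^ (r : ℝ)) :
    r * dimH s ≤ dimH (F '' s) := by
  rcases s.eq_empty_or_nonempty with rfl | ⟨x, _⟩
  · simp
  have : Nonempty X := ⟨x⟩
  have hr' : (r : ℝ) ≠ 0 := by exact_mod_cast hr.ne'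
  have hinj : InjOn F s := fun t ht u hu htu => by
    have := h t ht u hu
    rw [htu, dist_self, Real.zero_rpow hr', mul_zero] at this
    exact dist_le_zero.1 this
  have hhol : HolderOnWith C r (Function.invFunOn F s) (F '' s) := by
    rintro _ ⟨t, ht, rfl⟩ _ ⟨u, hu, rfl⟩
    rw [hinj.leftInvOn_invFunOn ht, hinj.leftInvOn_invFunOn hu, edist_nndist, edist_nndist,
      ← ENNReal.coe_rpow_of_nonneg _ r.coe_nonneg, ← ENNReal.coe_mul, ENNReal.coe_le_coe,
      ← NNReal.coe_le_coe]
    push_cast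
    exact h t ht u hu
  have := hhol.dimH_image_le hr
  rw [hinj.leftInvOn_invFunOn.image_image] at this
  rw [mul_comm]
  exact (ENNReal.le_div_iff_mul_le (by simp [hr.ne']) (by simp)).1 this

lemma dimH_unitSquare : dimH unitSquare = 2 := by
  have : (interior unitSquare).Nonempty := by
    rw [unitSquare, interior_prod_eq, interior_Ico]
    exact ⟨(1 / 2, 1 / 2), by norm_num⟩
  rw [Real.dimH_of_nonempty_interior this]
  simp

namespace LatticeChoice

variable {K : ℝ} (P : LatticeChoice K)

/-- The compact set of all the points coded by words. -/
def carrier : Set ℂ := P.point '' digitBox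

lemma isCompact_carrier : IsCompact P.carrier :=
  isCompact_digitBox.image_of_continuousOn P.continuousOn_point

lemma exists_dist_le_rpow {r : ℝ} (hr : 0 < r) (hr' : r < 1) :
    ∃ C : ℝ, 0 < C ∧ ∀ t ∈ unitSquare, ∀ u ∈ unitSquare,
      dist t u ≤ C * dist (P.point (squareDigits t)) (P.point (squareDigits u)) ^ r := by
  have hK := P.one_le
  have hc := contraction_pos hK
  have hc' := contraction_le hK
  obtain ⟨C, hC, hCk⟩ := exists_scale_rpow_le hc (by linarith) (sub_pos.2 hr')
  refine ⟨4 * K * C / contraction K, by positivity, fun t ht u hu => ?_⟩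
  rcases eq_or_ne t u with rfl | htu
  · rw [dist_self]; positivity
  obtain ⟨k, hk, hne⟩ := exists_first_squareDigits_ne ht hu htu
  have hdt := squareDigits_mem_digitBox t
  have hdu := squareDigits_mem_digitBox u
  set Δ := ‖gaussPoint (squareDigits t k - squareDigits u k)‖ with hΔ
  have hΔ1 : 1 ≤ Δ := one_le_norm_gaussPoint (sub_ne_zero.2 hne)
  have hΔ2 : Δ ≤ 2 * (k + 1 : ℝ) := by
    linarith [norm_gaussPoint_sub_le_of_mem_digitBox hdt hdu k]
  set q := P.mesh (k + 1) * Δ / (2 * K) with hq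
  have hm := P.mesh_pos (k + 1)
  have hq0 : 0 < q := by positivity
  have hqle : q ≤ dist (P.point (squareDigits t)) (P.point (squareDigits u)) :=
    P.le_dist_point hdt hdu hk hne
  have hqm : q ≤ scale (contraction K) k := by
    calc q ≤ P.mesh (k + 1) * (2 * (k + 1 : ℝ)) / (2 * 1) := by rw [hq]; gcongr
      _ = P.mesh (k + 1) * (k + 1 : ℝ) := by ring
      _ = contraction K * scale (contraction K) k := scale_succ_mul _ _
      _ ≤ 1 * scale (contraction K) k := by
        gcongr
        · exact (P.mesh_pos k).le
        · linarith
      _ = _ := one_mul _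
  have hq1 : q ^ (1 - r) ≤ C * contraction K ^ k :=
    (Real.rpow_le_rpow hq0.le hqm (by linarith)).trans (hCk k)
  have hqsplit : q = q ^ (1 - r) * q ^ r := by
    rw [← Real.rpow_add hq0]; simp
  have hd := dist_mul_factorial_le ht hu hk hne
  rw [← hΔ] at hd
  have hmesh : P.mesh (k + 1) = contraction K ^ (k + 1) / (k + 1)! := rfl
  calc dist t u ≤ 2 * Δ / (k + 1)! := by
        rwa [le_div_iff₀ (by positivity)]
    _ = 4 * K / contraction K ^ (k + 1) * q := by
        rw [hq, hmesh]; field_simp; norm_num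
    _ = 4 * K / contraction K ^ (k + 1) * (q ^ (1 - r) * q ^ r) := by rw [← hqsplit]
    _ ≤ 4 * K / contraction K ^ (k + 1) * (C * contraction K ^ k *
          dist (P.point (squareDigits t)) (P.point (squareDigits u)) ^ r) := by gcongr
    _ = _ := by rw [pow_succ]; field_simp

lemma dimH_carrier : dimH P.carrier = 2 := by
  apply le_antisymm
  · calc dimH P.carrier ≤ dimH (univ : Set ℂ) := dimH_mono (subset_univ _)
      _ = 2 := by rw [Real.dimH_univ_eq_finrank, Complex.finrank_real_complex]; simp
  · have key (r : ℝ≥0) (hr : 0 < r) (hr' : r < 1) : (r : ℝ≥0∞) * 2 ≤ dimH P.carrier := by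
      obtain ⟨C, hC, h⟩ := P.exists_dist_le_rpow (r := r) (by exact_mod_cast hr)
        (by exact_mod_cast hr')
      lift C to ℝ≥0 using hC.le
      calc (r : ℝ≥0∞) * 2 = r * dimH unitSquare := by rw [dimH_unitSquare]
        _ ≤ dimH ((fun t => P.point (squareDigits t)) '' unitSquare) :=
          mul_dimH_le_dimH_image hr h
        _ ≤ dimH P.carrier := dimH_mono (by
          rintro _ ⟨t, _, rfl⟩
          exact mem_image_of_mem _ (squareDigits_mem_digitBox t))
    refine ENNReal.le_of_forall_nnreal_lt fun s hs => ?_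
    have hs' : s < 2 := by exact_mod_cast hs
    rcases eq_or_ne s 0 with rfl | hs0
    · simp
    have h2 := key (s / 2) (by positivity) (by
      rw [div_lt_one (by norm_num)]; exact hs')
    have : ((s / 2 : ℝ≥0) : ℝ≥0∞) * 2 = s := by
      rw [← ENNReal.coe_ofNat, ← ENNReal.coe_mul, div_mul_cancel₀ _ two_ne_zero]
    rwa [this] at h2

end LatticeChoice

/-- The sides of a triangle determine the ratio of two of them up to conjugation. -/
lemma eq_or_eq_conj_of_norm_eq {v w : ℂ} (h : ‖v‖ = ‖w‖) (h' : ‖v - 1‖ = ‖w - 1‖) :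
    v = w ∨ v = starRingEnd ℂ w := by
  have h₁ : v.re * v.re + v.im * v.im = w.re * w.re + w.im * w.im := by
    rw [← Complex.normSq_apply, ← Complex.normSq_apply, Complex.normSq_eq_norm_sq,
      Complex.normSq_eq_norm_sq, h]
  have h₂ : (v.re - 1) * (v.re - 1) + v.im * v.im = (w.re - 1) * (w.re - 1) + w.im * w.im := by
    have := congrArg (· ^ 2) h'
    simp only [← Complex.normSq_eq_norm_sq, Complex.normSq_apply] at this
    simpa using this
  have hre : v.re = w.re := by linarith
  have him : v.im * v.im = w.im * w.im := by rw [hre] at h₁; linarith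
  rcases mul_self_eq_mul_self_iff.1 him with h | h
  · exact Or.inl (Complex.ext hre h)
  · exact Or.inr (Complex.ext hre (by simpa using h))

/-- A compact set of full dimension which contains no solution of `y₂ - y₀ = ω (y₁ - y₀)` in
distinct points for `ω` in a finite family. -/
lemma exists_compact_dimH_eq_two_forall_ne {β : Type*} [Finite β] [Nonempty β] (ω : β → ℂ)
    (h₀ : ∀ v, ω v ≠ 0) (h₁ : ∀ v, ω v ≠ 1) :
    ∃ A : Set ℂ, IsCompact A ∧ dimH A = 2 ∧ ∀ v (y : Fin 3 → ℂ), (∀ i, y i ∈ A) →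
      Function.Injective y → y 2 - y 0 ≠ ω v * (y 1 - y 0) := by
  have := Fintype.ofFinite β
  obtain ⟨b, c, hc, hsep⟩ := exists_separating_colouring (ℤ × ℤ) β
  let lam (v : β) : Fin 3 → ℂ := ![(ω v - 1)⁻¹, (ω v)⁻¹, 1]
  have lam_ne_zero (v : β) (i : Fin 3) : lam v i ≠ 0 := by
    fin_cases i <;> simp [lam, h₀, sub_ne_zero, h₁]
  set K : ℝ := 1 + ∑ p : β × Fin 3, (‖lam p.1 p.2‖ + ‖lam p.1 p.2‖⁻¹) with hK
  have lam_le (v : β) (i : Fin 3) : ‖lam v i‖ + ‖lam v i‖⁻¹ ≤ K := by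
    have := Finset.single_le_sum (f := fun p : β × Fin 3 => ‖lam p.1 p.2‖ + ‖lam p.1 p.2‖⁻¹)
      (fun _ _ => by positivity) (Finset.mem_univ (v, i))
    simp only at this
    linarith
  have hK1 : 1 ≤ K := by
    rw [hK, le_add_iff_nonneg_right]
    positivity
  have lam_inv_le (v : β) (i : Fin 3) : ‖lam v i‖⁻¹ ≤ K := by
    linarith [lam_le v i, norm_nonneg (lam v i)]
  let P : LatticeChoice K :=
    { ratio := fun k d => lam (b k) (c k d)
      shift := fun k d => if c k d = 2 then 1 / 2 else 0
      one_le := hK1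
      norm_ratio_le := fun k d => by
        have : 0 ≤ ‖lam (b k) (c k d)‖⁻¹ := by positivity
        linarith [lam_le (b k) (c k d)]
      one_le_norm_ratio := fun k d =>
        (inv_le_iff_one_le_mul₀ (norm_pos_iff.2 (lam_ne_zero _ _))).1 (lam_inv_le _ _)
      norm_shift_le := fun k d => by split_ifs <;> norm_num
      ratio_congr := fun k d d' h => by rw [hc k d d' h]
      shift_congr := fun k d d' h => by rw [hc k d d' h] }
  refine ⟨P.carrier, P.isCompact_carrier, P.dimH_carrier, fun v y hy hinj heq => ?_⟩
  choose d hd hdy using hy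
  obtain ⟨k, hbk, hck⟩ := hsep v d fun i j hij => hinj (by rw [← hdy, ← hdy, hij])
  choose m hm using fun i => P.exists_norm_point_sub_le (hd i) k
  have hη := P.mesh_pos (k + 1)
  set η := P.mesh (k + 1) with hηdef
  have hratio (i : Fin 3) : P.ratio k (d i) = lam v i := by
    change lam (b k) (c k (d i)) = _
    rw [hbk, hck]
  have hshift (i : Fin 3) : P.shift k (d i) = if i = 2 then 1 / 2 else 0 := by
    change (if c k (d i) = 2 then (1 / 2 : ℂ) else 0) = _
    rw [hck]
  simp only [hratio, hshift, hdy] at hm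
  set E : Fin 3 → ℂ := fun i => y i - η * lam v i * (gaussPoint (m i) + if i = 2 then 1 / 2 else 0)
    with hE
  have hlam0 : (ω v - 1) * lam v 0 = 1 := mul_inv_cancel₀ (sub_ne_zero.2 (h₁ v))
  have hlam1 : ω v * lam v 1 = 1 := mul_inv_cancel₀ (h₀ v)
  have hlam2 : lam v 2 = 1 := rfl
  have hω0 : ‖ω v - 1‖ ≤ K := by simpa [lam] using lam_inv_le v 0
  have hω1 : ‖ω v‖ ≤ K := by simpa [lam] using lam_inv_le v 1
  have hmain : (η : ℂ) * (gaussPoint (m 0 - m 1 + m 2) + 1 / 2) =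
      -((ω v - 1) * E 0 - ω v * E 1 + E 2) := by
    simp only [hE, gaussPoint_add, gaussPoint_sub, hlam2]
    simp
    linear_combination (-η * gaussPoint (m 0)) * hlam0 + (η * gaussPoint (m 1)) * hlam1 + heq
  have hnorm := congrArg norm hmain
  rw [norm_mul, Complex.norm_real, Real.norm_of_nonneg hη.le, norm_neg] at hnorm
  have hlow := mul_le_mul_of_nonneg_left (half_le_norm_gaussPoint_add_half (m 0 - m 1 + m 2)) hη.le
  have hup : ‖(ω v - 1) * E 0 - ω v * E 1 + E 2‖ ≤ 3 * (K * (η / (25 * K))) := by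
    have e0 : ‖(ω v - 1) * E 0‖ ≤ K * (η / (25 * K)) := by
      rw [norm_mul]; gcongr; exact hm 0
    have e1 : ‖ω v * E 1‖ ≤ K * (η / (25 * K)) := by
      rw [norm_mul]; gcongr; exact hm 1
    have e2 : ‖E 2‖ ≤ K * (η / (25 * K)) :=
      (hm 2).trans (le_mul_of_one_le_left (by positivity) hK1)
    linarith [norm_add_le ((ω v - 1) * E 0 - ω v * E 1) (E 2),
      norm_sub_le ((ω v - 1) * E 0) (ω v * E 1)]
  have : K * (η / (25 * K)) = η / 25 := by field_simp
  linarith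

/-- Maga. Given three non-collinear points `x 0, x 1, x 2` of the plane,
there is a compact set `A ⊆ ℝ²` of full Hausdorff dimension `2` that does not contain the
vertices of any triangle similar to the triangle `x 0 x 1 x 2`. -/
theorem exists_full_dimensional_set_without_similar_triangles
    (x : Fin 3 → EuclideanSpace ℝ (Fin 2))
    (hx : ¬ Collinear ℝ (Set.range x)) :
    ∃ A : Set (EuclideanSpace ℝ (Fin 2)), IsCompact A ∧ dimH A = 2 ∧
      ¬ ∃ (lam : ℝ) (π : Equiv.Perm (Fin 3)) (y : Fin 3 → EuclideanSpace ℝ (Fin 2)),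
        0 < lam ∧ (∀ i, y i ∈ A) ∧ Function.Injective y ∧
        ∀ i j : Fin 3, dist (y (π i)) (y (π j)) = lam * dist (x i) (x j) := by
  let Φ : ℂ ≃ₗᵢ[ℝ] EuclideanSpace ℝ (Fin 2) := Complex.orthonormalBasisOneI.repr
  have hxinj : Function.Injective x := (affineIndependent_iff_not_collinear.2 hx).injective
  set u : Fin 3 → ℂ := fun i => Φ.symm (x i) with hu
  have huinj : Function.Injective u := Φ.symm.injective.comp hxinj
  have h10 : u 1 - u 0 ≠ 0 := sub_ne_zero.2 (huinj.ne (by decide))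
  set w : ℂ := (u 2 - u 0) / (u 1 - u 0) with hw
  have hw0 : w ≠ 0 := div_ne_zero (sub_ne_zero.2 (huinj.ne (by decide))) h10
  have hw1 : w - 1 = (u 2 - u 1) / (u 1 - u 0) := by rw [hw]; field_simp; ring
  have hw1' : w ≠ 1 := by
    rw [← sub_ne_zero, hw1]
    exact div_ne_zero (sub_ne_zero.2 (huinj.ne (by decide))) h10
  obtain ⟨A, hA, hdim, havoid⟩ := exists_compact_dimH_eq_two_forall_ne ![w, starRingEnd ℂ w]
    (by intro v; fin_cases v <;> simp [hw0])
    (by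
      intro v
      fin_cases v
      · simpa using hw1'
      · simpa using fun h => hw1' ((starRingEnd ℂ).injective (by simpa using h)))
  refine ⟨Φ '' A, hA.image Φ.continuous, by rw [Φ.isometry.dimH_image, hdim], ?_⟩
  rintro ⟨r, π, y, hr, hyA, hyinj, hdist⟩
  choose z hz hzy using fun i => hyA (π i)
  have hzinj : Function.Injective z := fun i j hij =>
    π.injective (hyinj (by rw [← hzy, ← hzy, hij]))
  have hz' (i j : Fin 3) : ‖z i - z j‖ = r * ‖u i - u j‖ := by
    rw [← dist_eq_norm, ← dist_eq_norm, ← Φ.dist_map, hzy, hzy, hdist, hu]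
    simp only [Φ.symm.dist_map]
  have hz10 : z 1 - z 0 ≠ 0 := sub_ne_zero.2 (hzinj.ne (by decide))
  have hv1 : (z 2 - z 0) / (z 1 - z 0) - 1 = (z 2 - z 1) / (z 1 - z 0) := by field_simp; ring
  rcases eq_or_eq_conj_of_norm_eq (v := (z 2 - z 0) / (z 1 - z 0)) (w := w)
    (by rw [hw, norm_div, norm_div, hz', hz', mul_div_mul_left _ _ hr.ne'])
    (by rw [hv1, hw1, norm_div, norm_div, hz', hz', mul_div_mul_left _ _ hr.ne']) with h | h
  · exact havoid 0 z hz hzinj (by rw [div_eq_iff hz10] at h; simpa using h)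
  · exact havoid 1 z hz hzinj (by rw [div_eq_iff hz10] at h; simpa using h)
end
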